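/- Let n ≥ 2, 1 < p < ∞ and β < 0. Let Ω ⊂ ℝⁿ be a bounded, open, convex set and let Ω* be the ball centered at the origin with P(Ω*) = P(Ω). Then λ_{p,β}(Ω) ≤ λ_{p,β}(Ω*); that is, among bounded open convex sets of given perimeter the ball maximizes the first Robin eigenvalue of the p-Laplacian with negative boundary parameter. -/

import Mathlib

open MeasureTheory Metric Set Bornology
open scoped NNReal ENNReal Pointwise symmDiff

noncomputable section

/-- The perimeter of a (convex) set: the `(n-1)`-dimensional Hausdorff measure of its
topological boundary. -/
def perim (n : ℕ) (Ω : Set (EuclideanSpace ℝ (Fin n))) : ℝ :=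
  (μH[(n : ℝ) - 1] (frontier Ω)).toReal

/-- The Rayleigh quotient of `u` on `Ω` with boundary parameter `β`. -/
def rayleigh (n : ℕ) (p β : ℝ) (Ω : Set (EuclideanSpace ℝ (Fin n)))
    (u : EuclideanSpace ℝ (Fin n) → ℝ) : ℝ :=
  ((∫ x in Ω, ‖fderiv ℝ u x‖ ^ p) +
      β * ∫ x in frontier Ω, |u x| ^ p ∂(μH[(n : ℝ) - 1])) /
    ∫ x in Ω, |u x| ^ p

/-- The first Robin eigenvalue of the `p`-Laplacian on `Ω` with boundary parameter `β`. -/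
def robinEig (n : ℕ) (p β : ℝ) (Ω : Set (EuclideanSpace ℝ (Fin n))) : ℝ :=
  sInf { r : ℝ | ∃ u : EuclideanSpace ℝ (Fin n) → ℝ,
    (∃ K : ℝ≥0, LipschitzOnWith K u (closure Ω)) ∧
    (0 < ∫ x in Ω, |u x| ^ p) ∧ r = rayleigh n p β Ω u }

/-- `v` is a first eigenfunction for the Robin `p`-Laplacian on `Ω`: a positive radial
Lipschitz function on the closure of `Ω` whose Rayleigh quotient equals `λ_{p,β}(Ω)`. -/
def IsFirstEigenfunction (n : ℕ) (p β : ℝ) (Ω : Set (EuclideanSpace ℝ (Fin n)))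
    (v : EuclideanSpace ℝ (Fin n) → ℝ) : Prop :=
  (∃ K : ℝ≥0, LipschitzOnWith K v (closure Ω)) ∧
  (∀ x ∈ closure Ω, 0 < v x) ∧
  (∃ h : ℝ → ℝ, ∀ x ∈ closure Ω, v x = h ‖x‖) ∧
  (0 < ∫ x in Ω, |v x| ^ p) ∧
  rayleigh n p β Ω v = robinEig n p β Ω

/-- `ω_n`, the Lebesgue measure of the unit ball of `ℝⁿ`. -/
def unitBallVol (n : ℕ) : ℝ :=
  (volume (ball (0 : EuclideanSpace ℝ (Fin n)) 1)).toReal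

/-- One-dimensional Brunn–Minkowski for compact sets. -/
lemma volume_add_le_of_isCompact {K L C : Set ℝ} (hK : IsCompact K) (hL : IsCompact L)
    (hK0 : K.Nonempty) (hL0 : L.Nonempty) (h : ∀ x ∈ K, ∀ y ∈ L, x + y ∈ C) :
    volume K + volume L ≤ volume C := by
  obtain ⟨a, ha, hamax⟩ := hK.exists_isGreatest hK0
  obtain ⟨b, hb, hbmin⟩ := hL.exists_isLeast hL0
  have h1 : (fun x => x + b) '' K \ {a + b} ⊆ C ∩ Iio (a + b) := by
    rintro _ ⟨⟨x, hx, rfl⟩, hne⟩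
    refine ⟨h x hx b hb, ?_⟩
    have : x ≤ a := hamax hx
    have h2 : x + b ≠ a + b := hne
    exact lt_of_le_of_ne (by simpa using this) h2
  have h2 : (fun y => a + y) '' L ⊆ C \ Iio (a + b) := by
    rintro _ ⟨y, hy, rfl⟩
    refine ⟨h a ha y hy, ?_⟩
    have : b ≤ y := hbmin hy
    simpa using this
  have e1 : volume ((fun x => x + b) '' K \ {a + b}) = volume K := by
    rw [measure_sdiff_null (by simp)]
    simp
  have e2 : volume ((fun y => a + y) '' L) = volume L := by simp
  calc volume K + volume L ≤ volume (C ∩ Iio (a + b)) + volume (C \ Iio (a + b)) := by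
        rw [← e1, ← e2]; exact add_le_add (measure_mono h1) (measure_mono h2)
    _ = volume C := measure_inter_add_sdiff _ measurableSet_Iio

/-- One-dimensional Brunn–Minkowski for measurable sets. -/
lemma volume_add_le_of_add_mem {A B C : Set ℝ} (hA : MeasurableSet A) (hB : MeasurableSet B)
    (hA0 : A.Nonempty) (hB0 : B.Nonempty) (h : ∀ x ∈ A, ∀ y ∈ B, x + y ∈ C) :
    volume A + volume B ≤ volume C := by
  obtain ⟨a, ha⟩ := hA0
  obtain ⟨b, hb⟩ := hB0
  have key : ∀ K ⊆ A, ∀ L ⊆ B, IsCompact K → IsCompact L → volume K + volume L ≤ volume C := by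
    intro K hKA L hLB hK hL
    calc volume K + volume L ≤ volume (insert a K) + volume (insert b L) :=
          add_le_add (measure_mono (subset_insert _ _)) (measure_mono (subset_insert _ _))
      _ ≤ volume C := volume_add_le_of_isCompact (hK.insert a) (hL.insert b) ⟨a, by simp⟩
          ⟨b, by simp⟩ (fun x hx y hy => h x (insert_subset ha hKA hx) y (insert_subset hb hLB hy))
  rw [hA.measure_eq_iSup_isCompact, hB.measure_eq_iSup_isCompact]
  refine ENNReal.biSup_add_biSup_le' (p := fun K => K ⊆ A ∧ IsCompact K)
    (q := fun K => K ⊆ B ∧ IsCompact K) ⟨∅, by simp⟩ ⟨∅, by simp⟩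
    (f := fun K => volume K) (g := fun K => volume K) (a := volume C)
    (fun K hK L hL => key K hK.1 L hL.1 hK.2 hL.2) |>.trans' ?_
  simp only [iSup_and]
  rfl

lemma ENNReal.four_mul_le_add_sq (x y : ℝ≥0∞) : 4 * (x * y) ≤ (x + y) ^ 2 := by
  induction x with
  | top => simp
  | coe x =>
    induction y with
    | top => simp
    | coe y =>
      norm_cast
      rw [← NNReal.coe_le_coe]
      push_cast
      nlinarith [sq_nonneg ((x : ℝ) - y)]

lemma lintegral_add_lintegral_le_of_level {f g k : ℝ → ℝ} (hf : Measurable f) (hg : Measurable g)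
    (hk : Measurable k) (f0 : 0 ≤ f) (g0 : 0 ≤ g) (k0 : 0 ≤ k) (f1 : ∀ x, f x ≤ 1)
    (g1 : ∀ x, g x ≤ 1) (fs : ∀ s < 1, ∃ x, s < f x) (gs : ∀ s < 1, ∃ x, s < g x)
    (H : ∀ s, 0 ≤ s → ∀ x y, s < f x → s < g y → s < k (x + y)) :
    (∫⁻ x, ENNReal.ofReal (f x)) + (∫⁻ x, ENNReal.ofReal (g x)) ≤
      ∫⁻ x, ENNReal.ofReal (k x) := by
  rw [lintegral_eq_lintegral_meas_lt _ (ae_of_all _ f0) hf.aemeasurable,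
    lintegral_eq_lintegral_meas_lt _ (ae_of_all _ g0) hg.aemeasurable,
    lintegral_eq_lintegral_meas_lt _ (ae_of_all _ k0) hk.aemeasurable]
  rw [← lintegral_add_left']
  · refine setLIntegral_mono' measurableSet_Ioi ?_
    intro s hs
    have hs' : (0 : ℝ) < s := hs
    by_cases h1 : s < 1
    · exact volume_add_le_of_add_mem (measurableSet_lt measurable_const hf)
        (measurableSet_lt measurable_const hg) (fs s h1) (gs s h1)
        (fun x hx y hy => H s hs'.le x y hx hy)
    · have e1 : {x | s < f x} = ∅ := by
        ext x; simpa using (f1 x).trans (not_lt.1 h1)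
      have e2 : {x | s < g x} = ∅ := by
        ext x; simpa using (g1 x).trans (not_lt.1 h1)
      rw [e1, e2]; simp
  · apply Measurable.aemeasurable
    apply Antitone.measurable
    intro s t hst
    exact measure_mono (fun x (hx : t < f x) => lt_of_le_of_lt hst hx)

/-- One-dimensional Prékopa–Leindler inequality for bounded functions. -/
lemma prekopa_leindler_one_of_bdd {f g h : ℝ → ℝ≥0∞} (hf : Measurable f) (hg : Measurable g)
    (hh : Measurable h) (N : ℝ≥0) (fN : ∀ x, f x ≤ N) (gN : ∀ x, g x ≤ N)
    (H : ∀ x y, f x * g y ≤ h (x + y) ^ 2) :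
    4 * ((∫⁻ x, f x) * ∫⁻ x, g x) ≤ (∫⁻ x, h x) ^ 2 := by
  set A := ⨆ x, f x with hA
  set B := ⨆ x, g x with hB
  have fA : ∀ x, f x ≤ A := fun x => le_iSup f x
  have gB : ∀ x, g x ≤ B := fun x => le_iSup g x
  have At : A ≠ ⊤ := ((iSup_le fN).trans_lt ENNReal.coe_lt_top).ne
  have Bt : B ≠ ⊤ := ((iSup_le gN).trans_lt ENNReal.coe_lt_top).ne
  by_cases A0 : A = 0
  · have : ∀ x, f x = 0 := fun x => le_antisymm ((fA x).trans A0.le) bot_le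
    simp [this]
  by_cases B0 : B = 0
  · have : ∀ x, g x = 0 := fun x => le_antisymm ((gB x).trans B0.le) bot_le
    simp [this]
  set c : ℝ≥0∞ := (A * B) ^ (1 / 2 : ℝ) with hc
  have c2 : c ^ 2 = A * B := by
    rw [hc, ← ENNReal.rpow_natCast, ← ENNReal.rpow_mul]; norm_num
  have c0 : c ≠ 0 := by
    intro h; rw [h] at c2; simp [A0, B0] at c2
  have ct : c ≠ ⊤ := by
    intro h; rw [h] at c2
    exact ENNReal.mul_ne_top At Bt (by rw [← c2]; simp)
  have fA1 : ∀ x, f x / A ≤ 1 := fun x => ENNReal.div_le_of_le_mul (by simpa using fA x)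
  have gB1 : ∀ x, g x / B ≤ 1 := fun x => ENNReal.div_le_of_le_mul (by simpa using gB x)
  have ft : ∀ x, f x / A ≠ ⊤ := fun x => ((fA1 x).trans_lt (by simp)).ne
  have gt : ∀ x, g x / B ≠ ⊤ := fun x => ((gB1 x).trans_lt (by simp)).ne
  have kt : ∀ x, min (h x / c) 1 ≠ ⊤ := fun x => ((min_le_right _ _).trans_lt (by simp)).ne
  have key := lintegral_add_lintegral_le_of_level (f := fun x => (f x / A).toReal)
    (g := fun x => (g x / B).toReal) (k := fun x => (min (h x / c) 1).toReal)
    (hf.div_const _).ennreal_toReal (hg.div_const _).ennreal_toReal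
    ((hh.div_const _).min measurable_const).ennreal_toReal
    (fun _ => ENNReal.toReal_nonneg) (fun _ => ENNReal.toReal_nonneg)
    (fun _ => ENNReal.toReal_nonneg)
    (fun x => ENNReal.toReal_le_of_le_ofReal zero_le_one (by simpa using fA1 x))
    (fun x => ENNReal.toReal_le_of_le_ofReal zero_le_one (by simpa using gB1 x))
    ?_ ?_ ?_
  · simp only [ENNReal.ofReal_toReal (ft _), ENNReal.ofReal_toReal (gt _),
      ENNReal.ofReal_toReal (kt _)] at key
    have key2 : (∫⁻ x, f x) / A + (∫⁻ x, g x) / B ≤ (∫⁻ x, h x) / c := by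
      simp only [div_eq_mul_inv] at key ⊢
      rw [lintegral_mul_const _ hf, lintegral_mul_const _ hg] at key
      rw [← lintegral_mul_const _ hh]
      exact key.trans (lintegral_mono fun x => min_le_left _ _)
    have k3 := (ENNReal.four_mul_le_add_sq _ _).trans (pow_le_pow_left' key2 2)
    have k4 := mul_le_mul_left k3 (c ^ 2)
    calc 4 * ((∫⁻ x, f x) * ∫⁻ x, g x)
        = 4 * ((∫⁻ x, f x) / A * ((∫⁻ x, g x) / B)) * (A * B) := by
          have e1 : (∫⁻ x, f x) / A * A = ∫⁻ x, f x := ENNReal.div_mul_cancel A0 At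
          have e2 : (∫⁻ x, g x) / B * B = ∫⁻ x, g x := ENNReal.div_mul_cancel B0 Bt
          nth_rewrite 1 [← e1]; nth_rewrite 1 [← e2]; ring
      _ ≤ ((∫⁻ x, h x) / c) ^ 2 * c ^ 2 := by rw [← c2]; exact k4
      _ = (∫⁻ x, h x) ^ 2 := by rw [← mul_pow, ENNReal.div_mul_cancel c0 ct]
  · intro s hs
    by_cases s0 : s < 0
    · exact ⟨0, s0.trans_le ENNReal.toReal_nonneg⟩
    have : ENNReal.ofReal s * A < A := by
      calc _ < 1 * A := (ENNReal.mul_lt_mul_iff_left A0 At).2 (by simpa using hs)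
        _ = A := one_mul A
    obtain ⟨x, hx⟩ := lt_iSup_iff.1 this
    refine ⟨x, (ENNReal.ofReal_lt_iff_lt_toReal (not_lt.1 s0) (ft x)).1 ?_⟩
    rwa [ENNReal.lt_div_iff_mul_lt (Or.inl A0) (Or.inl At)]
  · intro s hs
    by_cases s0 : s < 0
    · exact ⟨0, s0.trans_le ENNReal.toReal_nonneg⟩
    have : ENNReal.ofReal s * B < B := by
      calc _ < 1 * B := (ENNReal.mul_lt_mul_iff_left B0 Bt).2 (by simpa using hs)
        _ = B := one_mul B
    obtain ⟨x, hx⟩ := lt_iSup_iff.1 this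
    refine ⟨x, (ENNReal.ofReal_lt_iff_lt_toReal (not_lt.1 s0) (gt x)).1 ?_⟩
    rwa [ENNReal.lt_div_iff_mul_lt (Or.inl B0) (Or.inl Bt)]
  · intro s s0 x y hx hy
    rw [← ENNReal.ofReal_lt_iff_lt_toReal s0 (ft x)] at hx
    rw [← ENNReal.ofReal_lt_iff_lt_toReal s0 (gt y)] at hy
    rw [← ENNReal.ofReal_lt_iff_lt_toReal s0 (kt _)]
    have hs1 := hx.trans_le (fA1 x)
    refine lt_min ?_ hs1
    rw [ENNReal.lt_div_iff_mul_lt (Or.inl c0) (Or.inl ct)]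
    rw [ENNReal.lt_div_iff_mul_lt (Or.inl A0) (Or.inl At)] at hx
    rw [ENNReal.lt_div_iff_mul_lt (Or.inl B0) (Or.inl Bt)] at hy
    have := (ENNReal.mul_lt_mul hx hy).trans_le (H x y)
    refine lt_of_pow_lt_pow_left' 2 (this.trans_le' ?_)
    rw [mul_pow, c2]
    exact le_of_eq (by ring)

/-- One-dimensional Prékopa–Leindler inequality. -/
lemma prekopa_leindler_one {f g h : ℝ → ℝ≥0∞} (hf : Measurable f) (hg : Measurable g)
    (hh : Measurable h) (H : ∀ x y, f x * g y ≤ h (x + y) ^ 2) :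
    4 * ((∫⁻ x, f x) * ∫⁻ x, g x) ≤ (∫⁻ x, h x) ^ 2 := by
  have e : ∀ f : ℝ → ℝ≥0∞, Measurable f →
      ∫⁻ x, f x = ⨆ N : ℕ, ∫⁻ x, min (f x) N := by
    intro f hf
    rw [← lintegral_iSup (fun N => hf.min measurable_const)
      (fun N M hNM x => min_le_min le_rfl (by exact_mod_cast hNM))]
    congr 1; ext x
    rw [← inf_iSup_eq, ENNReal.iSup_natCast, inf_top_eq]
  have key : ∀ N M : ℕ, 4 * ((∫⁻ x, min (f x) N) * ∫⁻ x, min (g x) M) ≤ (∫⁻ x, h x) ^ 2 := by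
    intro N M
    refine prekopa_leindler_one_of_bdd (hf.min measurable_const) (hg.min measurable_const) hh
      (max N M) (fun x => (min_le_right _ _).trans (by norm_cast; exact le_max_left _ _))
      (fun x => (min_le_right _ _).trans (by norm_cast; exact le_max_right _ _)) ?_
    exact fun x y => (mul_le_mul' (min_le_left _ _) (min_le_left _ _)).trans (H x y)
  rw [e f hf, e g hg]
  simp only [ENNReal.iSup_mul, ENNReal.mul_iSup, iSup_le_iff]
  exact fun N M => key M N

lemma prekopa_leindler (n : ℕ) : ∀ {f g h : (Fin n → ℝ) → ℝ≥0∞}, Measurable f → Measurable g →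
    Measurable h → (∀ x y, f x * g y ≤ h (x + y) ^ 2) →
    4 ^ n * ((∫⁻ x, f x) * ∫⁻ x, g x) ≤ (∫⁻ x, h x) ^ 2 := by
  induction n with
  | zero =>
    intro f g h hf hg hh H
    simp only [pow_zero, one_mul, lintegral_unique]
    have := H default default
    rw [Subsingleton.elim (default + default : Fin 0 → ℝ) default] at this
    have e : (volume : Measure (Fin 0 → ℝ)) univ = 1 := by simp [volume_pi]
    rw [e]
    simp only [mul_one]
    convert this
  | succ n ih =>
    intro f g h hf hg hh H
    have mp := (volume_preserving_piFinSuccAbove (fun _ : Fin (n + 1) => ℝ) 0).symm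
    have e : ∀ f : (Fin (n + 1) → ℝ) → ℝ≥0∞, Measurable f →
        ∫⁻ x, f x = ∫⁻ a : ℝ, ∫⁻ y : Fin n → ℝ, f (Fin.cons a y) := by
      intro f hf
      rw [← mp.lintegral_comp hf, Measure.volume_eq_prod, lintegral_prod _ (by fun_prop)]
      refine lintegral_congr fun a => lintegral_congr fun y => congrArg f ?_
      ext i
      refine Fin.cases ?_ (fun j => ?_) i <;> simp [Fin.insertNthEquiv]
    have mc : Measurable fun z : ℝ × (Fin n → ℝ) => (Fin.cons z.1 z.2 : Fin (n + 1) → ℝ) := by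
      rw [measurable_pi_iff]
      intro i
      refine Fin.cases ?_ (fun j => ?_) i
      · simpa using measurable_fst
      · simp only [Fin.cons_succ]; exact (measurable_pi_apply j).comp measurable_snd
    have mI : ∀ f : (Fin (n + 1) → ℝ) → ℝ≥0∞, Measurable f →
        Measurable fun a : ℝ => ∫⁻ y : Fin n → ℝ, f (Fin.cons a y) := fun f hf =>
      (hf.comp mc).lintegral_prod_right'
    have m1 : ∀ f : (Fin (n + 1) → ℝ) → ℝ≥0∞, Measurable f → ∀ a : ℝ,
        Measurable fun y : Fin n → ℝ => f (Fin.cons a y) := fun f hf a =>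
      (hf.comp mc).comp measurable_prodMk_left
    rw [e f hf, e g hg, e h hh]
    have key := prekopa_leindler_one (f := fun a => 2 ^ n * ∫⁻ y : Fin n → ℝ, f (Fin.cons a y))
      (g := fun a => 2 ^ n * ∫⁻ y : Fin n → ℝ, g (Fin.cons a y))
      ((mI f hf).const_mul _) ((mI g hg).const_mul _) (mI h hh) ?_
    · rw [lintegral_const_mul _ (mI f hf), lintegral_const_mul _ (mI g hg)] at key
      refine le_trans (le_of_eq ?_) key
      rw [pow_succ, show (4 : ℝ≥0∞) ^ n = 2 ^ n * 2 ^ n by rw [← mul_pow]; norm_num]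
      ring
    · intro a b
      refine le_trans (le_of_eq ?_) (ih (m1 f hf a) (m1 g hg b) (m1 h hh (a + b)) ?_)
      · rw [show (4 : ℝ≥0∞) ^ n = 2 ^ n * 2 ^ n by rw [← mul_pow]; norm_num]
        ring
      · intro x y
        refine (H _ _).trans (le_of_eq ?_)
        congr 2
        ext i
        refine Fin.cases ?_ (fun j => ?_) i <;> simp

/-- Brunn–Minkowski inequality, multiplicative form. -/
lemma volume_mul_volume_le {n : ℕ} {A B C : Set (EuclideanSpace ℝ (Fin n))}
    (hA : MeasurableSet A) (hB : MeasurableSet B) (hC : MeasurableSet C)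
    (h : ∀ x ∈ A, ∀ y ∈ B, x + y ∈ C) :
    4 ^ n * (volume A * volume B) ≤ volume C ^ 2 := by
  have mp := (EuclideanSpace.volume_preserving_symm_measurableEquiv_toLp (Fin n)).symm
  set e := (MeasurableEquiv.toLp 2 (Fin n → ℝ)) with he
  have v : ∀ A : Set (EuclideanSpace ℝ (Fin n)), MeasurableSet A →
      volume A = ∫⁻ x : Fin n → ℝ, A.indicator 1 (e x) := by
    intro A hA
    have := mp.lintegral_comp (f := A.indicator 1) (measurable_one.indicator hA)
    rw [lintegral_indicator_one hA] at this
    exact this.symm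
  rw [v A hA, v B hB, v C hC]
  refine prekopa_leindler n ((measurable_one.indicator hA).comp e.measurable)
    ((measurable_one.indicator hB).comp e.measurable)
    ((measurable_one.indicator hC).comp e.measurable) ?_
  intro x y
  by_cases hx : e x ∈ A <;> by_cases hy : e y ∈ B
  · have : e (x + y) ∈ C := h _ hx _ hy
    simp [hx, hy, this]
  all_goals simp [hx, hy]

/-- Brunn–Minkowski inequality: the volume of a midpoint set is at least the minimum. -/
lemma min_volume_le_of_midpoint {n : ℕ} {A B C : Set (EuclideanSpace ℝ (Fin n))}
    (hA : IsOpen A) (hB : IsOpen B) (hC : IsOpen C)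
    (h : ∀ x ∈ A, ∀ y ∈ B, (2⁻¹ : ℝ) • (x + y) ∈ C) :
    min (volume A) (volume B) ≤ volume C := by
  have h2 := volume_mul_volume_le (C := (2 : ℝ) • C) hA.measurableSet hB.measurableSet
    (hC.smul₀ two_ne_zero).measurableSet (fun x hx y hy => by
      rw [mem_smul_set_iff_inv_smul_mem₀ two_ne_zero]; exact h x hx y hy)
  rw [Measure.addHaar_smul, finrank_euclideanSpace_fin, mul_pow,
    show ENNReal.ofReal |(2 : ℝ) ^ n| ^ 2 = 4 ^ n by
      rw [abs_of_pos (by positivity), ← ENNReal.ofReal_pow (by positivity), ← pow_mul,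
        mul_comm n 2, pow_mul, ENNReal.ofReal_pow (by norm_num)]; norm_num] at h2
  rw [ENNReal.mul_le_mul_iff_right (by simp) (by finiteness)] at h2
  refine (ENNReal.pow_le_pow_left_iff two_ne_zero).1 ?_
  refine le_trans ?_ h2
  rw [sq]
  exact mul_le_mul' (min_le_left _ _) (min_le_right _ _)

/-- An open bounded convex set. -/
structure IsOpenConvexBody {n : ℕ} (C : Set (EuclideanSpace ℝ (Fin n))) : Prop where
  isOpen : IsOpen C
  isBounded : IsBounded C
  convex : Convex ℝ C

/-- A nonnegative additive function on the half-line is linear. -/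
lemma eq_mul_of_additive {f : ℝ → ℝ} (f0 : ∀ y, 0 ≤ y → 0 ≤ f y)
    (fa : ∀ y z, 0 ≤ y → 0 ≤ z → f (y + z) = f y + f z) (y : ℝ) (hy : 0 ≤ y) :
    f y = y * f 1 := by
  have mono : ∀ a b, 0 ≤ a → a ≤ b → f a ≤ f b := by
    intro a b ha hab
    have := fa a (b - a) ha (sub_nonneg.2 hab)
    rw [add_sub_cancel] at this
    linarith [f0 (b - a) (sub_nonneg.2 hab)]
  have hn : ∀ (N : ℕ) z, 0 ≤ z → f (N * z) = N * f z := by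
    intro N z hz
    induction N with
    | zero =>
      have := fa 0 0 le_rfl le_rfl
      simp at this; simp [this]
    | succ N ih =>
      push_cast
      rw [add_mul, one_mul, fa _ _ (by positivity) hz, ih]; ring
  have hbd : ∀ N : ℕ, N * |f y - y * f 1| ≤ f 1 := by
    intro N
    have h1 := Nat.floor_le (show 0 ≤ N * y by positivity)
    have h2 := (Nat.lt_floor_add_one (N * y)).le
    set k := ⌊N * y⌋₊
    have e0 := hn k 1 zero_le_one
    have e1 := hn (k + 1) 1 zero_le_one
    have m1 := mono (k * 1) (N * y) (by positivity) (by simpa using h1)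
    have m2 := mono (N * y) ((k + 1 : ℕ) * 1) (by positivity) (by push_cast; simpa using h2)
    rw [e0, hn N y hy] at m1
    rw [e1, hn N y hy] at m2
    push_cast at m2
    have hf1 := f0 1 zero_le_one
    rw [← abs_of_nonneg (Nat.cast_nonneg (α := ℝ) N), ← abs_mul, abs_le]
    constructor <;> nlinarith
  by_contra hne
  have hpos : 0 < |f y - y * f 1| := abs_pos.2 (sub_ne_zero.2 hne)
  obtain ⟨N, hN⟩ := exists_nat_gt (f 1 / |f y - y * f 1|)
  rw [div_lt_iff₀ hpos] at hN
  linarith [hbd N]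

section segments

variable {n : ℕ}

/-- The segment `[0, y u]`. -/
def seg (u : EuclideanSpace ℝ (Fin n)) (y : ℝ) : Set (EuclideanSpace ℝ (Fin n)) :=
  (fun t : ℝ => t • u) '' Icc 0 y

/-- The volume growth of `C` under adding the segment `[0, u]`. -/
def segGrowth (u : EuclideanSpace ℝ (Fin n)) (C : Set (EuclideanSpace ℝ (Fin n))) : ℝ :=
  volume.real (C + seg u 1) - volume.real C

lemma mem_add_seg {u : EuclideanSpace ℝ (Fin n)} {y : ℝ} {C : Set (EuclideanSpace ℝ (Fin n))}
    {x : EuclideanSpace ℝ (Fin n)} :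
    x ∈ C + seg u y ↔ ∃ t, 0 ≤ t ∧ t ≤ y ∧ x - t • u ∈ C := by
  constructor
  · rintro ⟨c, hc, _, ⟨t, ht, rfl⟩, rfl⟩
    exact ⟨t, ht.1, ht.2, by simpa using hc⟩
  · rintro ⟨t, h0, h1, h⟩
    exact ⟨_, h, t • u, ⟨t, ⟨h0, h1⟩, rfl⟩, by simp⟩

lemma isCompact_seg (u : EuclideanSpace ℝ (Fin n)) (y : ℝ) : IsCompact (seg u y) :=
  isCompact_Icc.image (by fun_prop)

lemma convex_seg (u : EuclideanSpace ℝ (Fin n)) (y : ℝ) : Convex ℝ (seg u y) :=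
  (convex_Icc 0 y).is_linear_image ⟨fun a b => add_smul a b u, fun a b => smul_assoc a b u⟩

lemma IsOpenConvexBody.add {C S : Set (EuclideanSpace ℝ (Fin n))} (hC : IsOpenConvexBody C)
    (hS : IsCompact S) (hS' : Convex ℝ S) : IsOpenConvexBody (C + S) :=
  ⟨hC.isOpen.add_right, hC.isBounded.add hS.isBounded, hC.convex.add hS'⟩

lemma IsOpenConvexBody.add_seg {C : Set (EuclideanSpace ℝ (Fin n))} (hC : IsOpenConvexBody C)
    (u : EuclideanSpace ℝ (Fin n)) (y : ℝ) : IsOpenConvexBody (C + seg u y) :=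
  hC.add (isCompact_seg u y) (convex_seg u y)

lemma IsOpenConvexBody.smul {C : Set (EuclideanSpace ℝ (Fin n))} (hC : IsOpenConvexBody C)
    {r : ℝ} (hr : r ≠ 0) : IsOpenConvexBody (r • C) :=
  ⟨hC.isOpen.smul₀ hr, hC.isBounded.smul₀ r, hC.convex.smul r⟩

lemma IsOpenConvexBody.volume_ne_top {C : Set (EuclideanSpace ℝ (Fin n))}
    (hC : IsOpenConvexBody C) : volume C ≠ ⊤ := hC.isBounded.measure_lt_top.ne

lemma IsOpenConvexBody.real_mono {C D : Set (EuclideanSpace ℝ (Fin n))}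
    (hD : IsOpenConvexBody D) (h : C ⊆ D) : volume.real C ≤ volume.real D :=
  measureReal_mono h hD.volume_ne_top

lemma IsOpenConvexBody.real_diff {C D : Set (EuclideanSpace ℝ (Fin n))}
    (hC : IsOpenConvexBody C) (hD : IsOpenConvexBody D) (h : C ⊆ D) :
    volume.real (D \ C) = volume.real D - volume.real C := by
  exact measureReal_sdiff h hC.isOpen.measurableSet hD.volume_ne_top

lemma subset_add_seg (C : Set (EuclideanSpace ℝ (Fin n))) (u : EuclideanSpace ℝ (Fin n)) {y : ℝ}
    (hy : 0 ≤ y) : C ⊆ C + seg u y := fun x hx =>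
  mem_add_seg.2 ⟨0, le_rfl, hy, by simpa using hx⟩

lemma add_seg_mono_right (C : Set (EuclideanSpace ℝ (Fin n))) (u : EuclideanSpace ℝ (Fin n))
    {y z : ℝ} (hyz : y ≤ z) : C + seg u y ⊆ C + seg u z := fun x hx => by
  obtain ⟨t, h0, h1, h⟩ := mem_add_seg.1 hx
  exact mem_add_seg.2 ⟨t, h0, h1.trans hyz, h⟩

/-- Volume is affine in the length of an added segment. -/
lemma IsOpenConvexBody.real_add_seg {C : Set (EuclideanSpace ℝ (Fin n))}
    (hC : IsOpenConvexBody C) (u : EuclideanSpace ℝ (Fin n)) {y : ℝ} (hy : 0 ≤ y) :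
    volume.real (C + seg u y) = volume.real C + y * segGrowth u C := by
  have key := eq_mul_of_additive (f := fun y => volume.real (C + seg u y) - volume.real C)
    (fun y hy => sub_nonneg.2 ((hC.add_seg u y).real_mono (subset_add_seg C u hy))) ?_ y hy
  · unfold segGrowth
    linarith
  · intro y z hy hz
    have e : (C + seg u (y + z)) \ (C + seg u y) = (y • u) +ᵥ ((C + seg u z) \ C) := by
      ext x
      rw [mem_vadd_set_iff_neg_vadd_mem]
      simp only [mem_sdiff, mem_add_seg, vadd_eq_add, not_exists, not_and]
      constructor
      · rintro ⟨⟨t, h0, h1, h⟩, hn⟩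
        have hty : y < t := by
          by_contra hcon
          exact hn t h0 (not_lt.1 hcon) h
        refine ⟨⟨t - y, by linarith, by linarith, ?_⟩, fun hc => hn y hy le_rfl ?_⟩
        · convert h using 1; module
        · convert hc using 1; module
      · rintro ⟨⟨t, h0, h1, h⟩, hn⟩
        refine ⟨⟨t + y, by linarith, by linarith, ?_⟩, fun s hs0 hs1 hs => hn ?_⟩
        · convert h using 1; module
        · rcases (add_nonneg h0 (sub_nonneg.2 hs1)).eq_or_lt with h2 | h2
          · have : t = 0 := by linarith
            subst this
            convert h using 1; module
          · have h3 : t + (y - s) ≠ 0 := h2.ne'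
            obtain ⟨α, hα⟩ : ∃ α, α = (y - s) / (t + (y - s)) := ⟨_, rfl⟩
            obtain ⟨γ, hγ⟩ : ∃ γ, γ = t / (t + (y - s)) := ⟨_, rfl⟩
            have h4 : α + γ = 1 := by rw [hα, hγ, ← add_div, add_comm, div_self h3]
            have h5 : α * t = γ * (y - s) := by rw [hα, hγ]; ring
            convert hC.convex h hs (hα ▸ div_nonneg (sub_nonneg.2 hs1) h2.le)
              (hγ ▸ div_nonneg h0 h2.le) h4 using 1
            match_scalars
            · linear_combination y * h4 + h5
            · linear_combination -h4
    have e2 := congrArg volume.real e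
    rw [(hC.add_seg u y).real_diff (hC.add_seg u _) (add_seg_mono_right C u (by linarith)),
      measureReal_def (s := _ +ᵥ _), measure_vadd, ← measureReal_def,
      hC.real_diff (hC.add_seg u z) (subset_add_seg C u hz)] at e2
    linarith

lemma segGrowth_nonneg {C : Set (EuclideanSpace ℝ (Fin n))}
    (hC : IsOpenConvexBody C) (u : EuclideanSpace ℝ (Fin n)) : 0 ≤ segGrowth u C :=
  sub_nonneg.2 ((hC.add_seg u 1).real_mono (subset_add_seg C u zero_le_one))

lemma le_of_forall_affine {a b c d : ℝ} (h : ∀ y : ℝ, 0 ≤ y → a + y * b ≤ c + y * d) : b ≤ d := by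
  by_contra hcon
  push Not at hcon
  have h1 : 0 ≤ |c - a| / (b - d) + 1 :=
    add_nonneg (div_nonneg (abs_nonneg _) (sub_nonneg.2 hcon.le)) zero_le_one
  have h2 := h _ h1
  have h3 : (|c - a| / (b - d) + 1) * (b - d) = |c - a| + (b - d) := by
    have : b - d ≠ 0 := by linarith
    field_simp
  nlinarith [le_abs_self (c - a)]

lemma segGrowth_mono {C D : Set (EuclideanSpace ℝ (Fin n))}
    (hC : IsOpenConvexBody C) (hD : IsOpenConvexBody D) (h : C ⊆ D)
    (u : EuclideanSpace ℝ (Fin n)) : segGrowth u C ≤ segGrowth u D := by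
  refine le_of_forall_affine (a := volume.real C) (c := volume.real D) fun y hy => ?_
  rw [← hC.real_add_seg u hy, ← hD.real_add_seg u hy]
  exact (hD.add_seg u y).real_mono (add_subset_add_right h)

lemma IsOpenConvexBody.min_real_le {A B C : Set (EuclideanSpace ℝ (Fin n))}
    (hA : IsOpenConvexBody A) (hB : IsOpenConvexBody B) (hC : IsOpenConvexBody C)
    (h : ∀ x ∈ A, ∀ y ∈ B, (2⁻¹ : ℝ) • (x + y) ∈ C) :
    min (volume.real A) (volume.real B) ≤ volume.real C := by
  have := min_volume_le_of_midpoint hA.isOpen hB.isOpen hC.isOpen h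
  rcases min_le_iff.1 this with h1 | h1
  · exact min_le_of_left_le (ENNReal.toReal_mono hC.volume_ne_top h1)
  · exact min_le_of_right_le (ENNReal.toReal_mono hC.volume_ne_top h1)

/-- Quasi-concavity of the volume growth along a segment. -/
lemma min_segGrowth_le {A B C : Set (EuclideanSpace ℝ (Fin n))}
    (hA : IsOpenConvexBody A) (hB : IsOpenConvexBody B) (hC : IsOpenConvexBody C)
    (h : ∀ x ∈ A, ∀ y ∈ B, (2⁻¹ : ℝ) • (x + y) ∈ C) (u : EuclideanSpace ℝ (Fin n)) :
    min (segGrowth u A) (segGrowth u B) ≤ segGrowth u C := by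
  refine le_of_forall_affine (a := min (volume.real A) (volume.real B))
    (c := volume.real C) fun y hy => ?_
  rw [← hC.real_add_seg u hy]
  refine le_trans ?_ ((hA.add_seg u y).min_real_le (hB.add_seg u y) (hC.add_seg u y) ?_)
  · rw [hA.real_add_seg u hy, hB.real_add_seg u hy]
    refine le_min ?_ ?_
    · have := mul_le_mul_of_nonneg_left (min_le_left (segGrowth u A) (segGrowth u B)) hy
      linarith [min_le_left (volume.real A) (volume.real B)]
    · have := mul_le_mul_of_nonneg_left (min_le_right (segGrowth u A) (segGrowth u B)) hy
      linarith [min_le_right (volume.real A) (volume.real B)]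
  · intro x hx z hz
    obtain ⟨t, t0, t1, ht⟩ := mem_add_seg.1 hx
    obtain ⟨s, s0, s1, hs⟩ := mem_add_seg.1 hz
    refine mem_add_seg.2 ⟨(t + s) / 2, by linarith, by linarith, ?_⟩
    convert h _ ht _ hs using 1
    module

lemma real_smul_set (C : Set (EuclideanSpace ℝ (Fin n))) {r : ℝ} (hr : 0 ≤ r) :
    volume.real (r • C) = r ^ n * volume.real C := by
  rw [measureReal_def, Measure.addHaar_smul, finrank_euclideanSpace_fin, ENNReal.toReal_mul,
    abs_of_nonneg (by positivity), ENNReal.toReal_ofReal (by positivity), measureReal_def]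

lemma smul_add_seg (C : Set (EuclideanSpace ℝ (Fin n))) (u : EuclideanSpace ℝ (Fin n)) {r : ℝ}
    (hr : 0 < r) (y : ℝ) : r • (C + seg u y) = r • C + seg u (r * y) := by
  ext x
  simp only [mem_smul_set_iff_inv_smul_mem₀ hr.ne', mem_add_seg]
  constructor
  · rintro ⟨t, h0, h1, h⟩
    refine ⟨r * t, by positivity, by gcongr, ?_⟩
    convert h using 1
    match_scalars <;> field_simp
  · rintro ⟨t, h0, h1, h⟩
    refine ⟨r⁻¹ * t, by positivity, ?_, ?_⟩
    · rw [inv_mul_le_iff₀ hr]; exact h1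
    · convert h using 1
      match_scalars <;> ring

lemma segGrowth_smul {C : Set (EuclideanSpace ℝ (Fin n))} (hC : IsOpenConvexBody C)
    (u : EuclideanSpace ℝ (Fin n)) {r : ℝ} (hr : 0 < r) :
    r * segGrowth u (r • C) = r ^ n * segGrowth u C := by
  have h := congrArg volume.real (smul_add_seg C u hr 1)
  rw [real_smul_set _ hr.le, hC.real_add_seg u zero_le_one, mul_one,
    (hC.smul hr.ne').real_add_seg u hr.le, real_smul_set _ hr.le] at h
  linarith

lemma real_diff_vadd_le {C : Set (EuclideanSpace ℝ (Fin n))} (hC : IsOpenConvexBody C)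
    (u : EuclideanSpace ℝ (Fin n)) {h : ℝ} (hh : 0 ≤ h) :
    volume.real {x ∈ C | x + h • u ∉ C} ≤ h * segGrowth u C := by
  have e : (h • u) +ᵥ {x ∈ C | x + h • u ∉ C} ⊆ (C + seg u h) \ C := by
    rintro _ ⟨x, ⟨hx, hx'⟩, rfl⟩
    refine ⟨mem_add_seg.2 ⟨h, hh, le_rfl, by simpa using hx⟩, ?_⟩
    simpa [add_comm] using hx'
  have h1 := measureReal_mono e ((measure_mono sdiff_subset).trans_lt
    (hC.add_seg u h).isBounded.measure_lt_top).ne (μ := volume)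
  rw [measureReal_def, measure_vadd, ← measureReal_def,
    hC.real_diff (hC.add_seg u h) (subset_add_seg C u hh), hC.real_add_seg u hh] at h1
  linarith

end segments

section separatelyAffine

variable {ι : Type*} [Fintype ι] [DecidableEq ι]

/-- Smooth functions on `ℝ^ι` that are affine in each coordinate. -/
structure SeparatelyAffine (F : (ι → ℝ) → ℝ) : Prop where
  contDiff : ContDiff ℝ 2 F
  affine : ∀ y i z, F (y + Pi.single i z) = F y + z * (F (y + Pi.single i 1) - F y)

/-- The forward difference in the `i`-th coordinate. -/
def fdiff (i : ι) (F : (ι → ℝ) → ℝ) (y : ι → ℝ) : ℝ := F (y + Pi.single i 1) - F y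

lemma SeparatelyAffine.fdiff {F : (ι → ℝ) → ℝ} (hF : SeparatelyAffine F) (i : ι) :
    SeparatelyAffine (fdiff i F) := by
  refine ⟨(hF.contDiff.comp (contDiff_id.add contDiff_const)).sub hF.contDiff, fun y j z => ?_⟩
  have h1 := hF.affine (y + Pi.single i 1) j z
  have h2 := hF.affine y j z
  simp only [_root_.fdiff]
  rw [add_right_comm y (Pi.single j z), add_right_comm y (Pi.single j 1), h1, h2]
  ring

lemma fdiff_comm (i j : ι) (F : (ι → ℝ) → ℝ) : fdiff i (fdiff j F) = fdiff j (fdiff i F) := by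
  ext y
  simp only [fdiff]
  rw [add_right_comm]
  ring

lemma SeparatelyAffine.apply_add {F : (ι → ℝ) → ℝ} (hF : SeparatelyAffine F) (y : ι → ℝ) (i : ι)
    (z : ℝ) : F (y + Pi.single i z) = F y + z * _root_.fdiff i F y := hF.affine y i z

lemma SeparatelyAffine.hasDerivAt {F : (ι → ℝ) → ℝ} (hF : SeparatelyAffine F) (y v : ι → ℝ)
    (τ : ℝ) : HasDerivAt (fun τ : ℝ => F (y + τ • v)) (∑ i, v i * _root_.fdiff i F (y + τ • v))
      τ := by
  have hd : Differentiable ℝ F := hF.contDiff.differentiable two_ne_zero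
  have h1 : ∀ x i, fderiv ℝ F x (Pi.single i 1) = _root_.fdiff i F x := by
    intro x i
    have h2 : HasDerivAt (fun z : ℝ => F (x + z • Pi.single i 1)) (fderiv ℝ F x (Pi.single i 1))
        0 := by
      have h3 : HasDerivAt (fun z : ℝ => x + z • (Pi.single i 1 : ι → ℝ)) (Pi.single i 1) 0 := by
        simpa using ((hasDerivAt_id (0 : ℝ)).smul_const (Pi.single i 1 : ι → ℝ)).const_add x
      have h4 : HasFDerivAt F (fderiv ℝ F x) (x + (0 : ℝ) • Pi.single i 1) := by
        simpa using (hd x).hasFDerivAt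
      exact h4.comp_hasDerivAt (0 : ℝ) h3
    have h5 : HasDerivAt (fun z : ℝ => F (x + z • Pi.single i 1)) (_root_.fdiff i F x) 0 := by
      have e : (fun z : ℝ => F (x + z • Pi.single i 1)) =
          fun z => F x + z * _root_.fdiff i F x := by
        ext z
        rw [← Pi.single_smul, smul_eq_mul, mul_one, hF.apply_add]
      rw [e]
      simpa using ((hasDerivAt_id (0 : ℝ)).mul_const (_root_.fdiff i F x)).const_add (F x)
    exact h2.unique h5
  have h3 : HasDerivAt (fun z : ℝ => y + z • v) v τ := by
    simpa using ((hasDerivAt_id τ).smul_const v).const_add y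
  have h4 := ((hd (y + τ • v)).hasFDerivAt).comp_hasDerivAt τ h3
  refine h4.congr_deriv ?_
  have e : v = ∑ i, v i • (Pi.single i 1 : ι → ℝ) := by
    ext j; simp [Finset.sum_apply, Pi.single_apply]
  have e2 := congrArg (fderiv ℝ F (y + τ • v)) e
  rw [e2, map_sum]
  simp only [map_smul, h1, smul_eq_mul]

/-- A function that is separately affine on the nonnegative orthant extends to a smooth separately
affine function. -/
lemma exists_separatelyAffine_eq {φ : (ι → ℝ) → ℝ}
    (hφ : ∀ y, 0 ≤ y → ∀ i z, 0 ≤ z →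
      φ (y + Pi.single i z) = φ y + z * (φ (y + Pi.single i 1) - φ y)) :
    ∃ F, SeparatelyAffine F ∧ ∀ y, 0 ≤ y → F y = φ y := by
  suffices H : ∀ (s : Finset ι) (φ : (ι → ℝ) → ℝ), (∀ y, 0 ≤ y → ∀ i z, 0 ≤ z →
      φ (y + Pi.single i z) = φ y + z * (φ (y + Pi.single i 1) - φ y)) →
      ∃ F, SeparatelyAffine F ∧ (∀ y i z, i ∉ s → F (y + Pi.single i z) = F y) ∧
        ∀ y, 0 ≤ y → (∀ i ∉ s, y i = 0) → F y = φ y by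
    obtain ⟨F, h1, -, h2⟩ := H Finset.univ φ hφ
    exact ⟨F, h1, fun y hy => h2 y hy (by simp)⟩
  clear hφ φ
  intro s
  induction s using Finset.induction_on with
  | empty =>
    intro φ hφ
    refine ⟨fun _ => φ 0, ⟨contDiff_const, by simp⟩, by simp, fun y hy h => ?_⟩
    have : y = 0 := by ext i; simpa using h i
    simp [this]
  | insert a s ha ih =>
    intro φ hφ
    have hsingle : ∀ i, (0 : ι → ℝ) ≤ Pi.single i 1 := fun i => Pi.single_nonneg.2 zero_le_one
    obtain ⟨F1, a1, i1, e1⟩ := ih φ hφ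
    obtain ⟨F2, a2, i2, e2⟩ := ih (fun y => φ (y + Pi.single a 1)) (fun y hy i z hz => by
      have := hφ (y + Pi.single a 1) (add_nonneg hy (hsingle a)) i z hz
      rw [add_right_comm y (Pi.single i z), add_right_comm y (Pi.single i 1)]
      exact this)
    refine ⟨fun y => F1 y + y a * (F2 y - F1 y), ⟨?_, ?_⟩, ?_, ?_⟩
    · exact a1.contDiff.add ((contDiff_apply ℝ ℝ a).mul (a2.contDiff.sub a1.contDiff))
    · intro y i z
      by_cases hi : i = a
      · subst hi
        simp only [i1 _ _ _ ha, i2 _ _ _ ha, Pi.add_apply, Pi.single_eq_same]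
        ring
      · simp only [Pi.add_apply, Pi.single_eq_of_ne (Ne.symm hi)]
        rw [a1.affine y i z, a2.affine y i z]
        ring
    · intro y i z hi
      simp only [Finset.mem_insert, not_or] at hi
      simp [i1 _ _ _ hi.2, i2 _ _ _ hi.2, Pi.single_eq_of_ne (Ne.symm hi.1)]
    · intro y hy hs
      set y0 : ι → ℝ := Function.update y a 0 with hy0
      have hd : y = y0 + Pi.single a (y a) := by
        ext i
        by_cases hi : i = a
        · subst hi; simp [hy0]
        · simp [hy0, hi]
      have y0n : 0 ≤ y0 := by
        intro i
        by_cases hi : i = a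
        · subst hi; simp [hy0]
        · simpa [hy0, hi] using hy i
      have y0s : ∀ i ∉ s, y0 i = 0 := by
        intro i his
        by_cases hi : i = a
        · subst hi; simp [hy0]
        · simpa [hy0, hi] using hs i (by simp [hi, his])
      have f1 : F1 y = φ y0 := by rw [hd, i1 _ _ _ ha, e1 y0 y0n y0s]
      have f2 : F2 y = φ (y0 + Pi.single a 1) := by rw [hd, i2 _ _ _ ha, e2 y0 y0n y0s]
      have := hφ y0 y0n a (y a) (hy a)
      rw [← hd] at this
      simp only [f1, f2, this]

end separatelyAffine

section zonotope

variable {n : ℕ} {ι : Type*} [Fintype ι]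

/-- The zonotope `∑ [0, y i • u i]`. -/
def zono (u : ι → EuclideanSpace ℝ (Fin n)) (y : ι → ℝ) : Set (EuclideanSpace ℝ (Fin n)) :=
  (fun τ : ι → ℝ => ∑ i, τ i • u i) '' Icc 0 y

lemma mem_zono {u : ι → EuclideanSpace ℝ (Fin n)} {y : ι → ℝ} {x : EuclideanSpace ℝ (Fin n)} :
    x ∈ zono u y ↔ ∃ τ : ι → ℝ, (∀ i, 0 ≤ τ i) ∧ (∀ i, τ i ≤ y i) ∧ ∑ i, τ i • u i = x := by
  constructor
  · rintro ⟨τ, hτ, rfl⟩; exact ⟨τ, hτ.1, hτ.2, rfl⟩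
  · rintro ⟨τ, h0, h1, rfl⟩; exact ⟨τ, ⟨h0, h1⟩, rfl⟩

lemma isCompact_zono (u : ι → EuclideanSpace ℝ (Fin n)) (y : ι → ℝ) : IsCompact (zono u y) :=
  isCompact_Icc.image (by fun_prop)

lemma convex_zono (u : ι → EuclideanSpace ℝ (Fin n)) (y : ι → ℝ) : Convex ℝ (zono u y) :=
  (convex_Icc 0 y).is_linear_image
    ⟨fun a b => by simp [add_smul, Finset.sum_add_distrib], fun a b => by
      simp [Finset.smul_sum, mul_smul]⟩

lemma zono_zero (u : ι → EuclideanSpace ℝ (Fin n)) : zono u 0 = {0} := by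
  simp [zono]

lemma zero_mem_zono (u : ι → EuclideanSpace ℝ (Fin n)) {y : ι → ℝ} (hy : 0 ≤ y) :
    0 ∈ zono u y := mem_zono.2 ⟨0, by simp, hy, by simp⟩

lemma zono_add_single [DecidableEq ι] (u : ι → EuclideanSpace ℝ (Fin n)) {y : ι → ℝ}
    (hy : 0 ≤ y) (i : ι) {z : ℝ} (hz : 0 ≤ z) :
    zono u (y + Pi.single i z) = zono u y + seg (u i) z := by
  ext x
  rw [mem_add_seg, mem_zono]
  have hsum : ∀ t : ℝ, ∑ j, (Pi.single i t : ι → ℝ) j • u j = t • u i := by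
    intro t
    rw [Finset.sum_eq_single i] <;> simp +contextual
  constructor
  · rintro ⟨τ, h0, h1, rfl⟩
    refine ⟨max (τ i - y i) 0, le_max_right _ _, ?_, mem_zono.2
      ⟨τ - Pi.single i (max (τ i - y i) 0), ?_, ?_, ?_⟩⟩
    · have := h1 i
      simp at this
      exact max_le (by linarith) hz
    · intro j
      by_cases hj : j = i
      · subst hj; simp; exact ⟨hy _, h0 _⟩
      · simp [hj, h0 j]
    · intro j
      by_cases hj : j = i
      · subst hj; simp only [Pi.sub_apply, Pi.single_eq_same]
        linarith [le_max_left (τ j - y j) 0]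
      · simpa [hj] using h1 j
    · simp only [Pi.sub_apply, sub_smul, Finset.sum_sub_distrib, hsum]
  · rintro ⟨t, h0, h1, h⟩
    obtain ⟨τ, t0, t1, ht⟩ := mem_zono.1 h
    refine ⟨τ + Pi.single i t, ?_, ?_, ?_⟩
    · intro j
      exact add_nonneg (t0 j) ((Pi.single_nonneg.2 h0 : (0 : ι → ℝ) ≤ Pi.single i t) j)
    · intro j
      exact add_le_add (t1 j) ((Pi.single_mono i h1 : (Pi.single i t : ι → ℝ) ≤ _) j)
    · simp only [Pi.add_apply, add_smul, Finset.sum_add_distrib, hsum, ht, sub_add_cancel]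

lemma smul_zono (u : ι → EuclideanSpace ℝ (Fin n)) (y : ι → ℝ) {r : ℝ} (hr : 0 < r) :
    r • zono u y = zono u (r • y) := by
  ext x
  rw [mem_smul_set_iff_inv_smul_mem₀ hr.ne', mem_zono, mem_zono]
  constructor
  · rintro ⟨τ, h0, h1, h⟩
    refine ⟨r • τ, fun i => mul_nonneg hr.le (h0 i), fun i =>
      mul_le_mul_of_nonneg_left (h1 i) hr.le, ?_⟩
    simp only [Pi.smul_apply, smul_assoc, ← Finset.smul_sum, h]
    rw [smul_inv_smul₀ hr.ne']
  · rintro ⟨τ, h0, h1, h⟩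
    refine ⟨r⁻¹ • τ, fun i => mul_nonneg (inv_pos.2 hr).le (h0 i), fun i => ?_, ?_⟩
    · simpa [inv_mul_le_iff₀ hr] using h1 i
    · simp only [Pi.smul_apply, smul_assoc, ← Finset.smul_sum, h]

lemma midpoint_mem_add_zono {u : ι → EuclideanSpace ℝ (Fin n)}
    {A B C : Set (EuclideanSpace ℝ (Fin n))} {y y' z : ι → ℝ}
    (h : ∀ a ∈ A, ∀ b ∈ B, (2⁻¹ : ℝ) • (a + b) ∈ C) (hz : ∀ i, y i + y' i = 2 * z i) :
    ∀ a ∈ A + zono u y, ∀ b ∈ B + zono u y', (2⁻¹ : ℝ) • (a + b) ∈ C + zono u z := by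
  rintro _ ⟨a, ha, _, ⟨τ, hτ, rfl⟩, rfl⟩ _ ⟨b, hb, _, ⟨σ, hσ, rfl⟩, rfl⟩
  refine ⟨_, h a ha b hb, _, mem_zono.2 ⟨(2⁻¹ : ℝ) • (τ + σ), ?_, ?_, rfl⟩, ?_⟩
  · intro i
    have := hτ.1 i; have := hσ.1 i
    simp only [Pi.zero_apply, Pi.smul_apply, Pi.add_apply, smul_eq_mul] at *
    linarith
  · intro i
    have := hτ.2 i; have := hσ.2 i; have := hz i
    simp only [Pi.smul_apply, Pi.add_apply, smul_eq_mul] at *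
    linarith
  · simp only [Pi.smul_apply, smul_assoc, ← Finset.smul_sum, Pi.add_apply, add_smul,
      Finset.sum_add_distrib]
    module

lemma IsOpenConvexBody.add_zono {K : Set (EuclideanSpace ℝ (Fin n))} (hK : IsOpenConvexBody K)
    (u : ι → EuclideanSpace ℝ (Fin n)) (y : ι → ℝ) : IsOpenConvexBody (K + zono u y) :=
  hK.add (isCompact_zono u y) (convex_zono u y)

lemma add_zono_add_single [DecidableEq ι] (K : Set (EuclideanSpace ℝ (Fin n)))
    (u : ι → EuclideanSpace ℝ (Fin n)) {y : ι → ℝ}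
    (hy : 0 ≤ y) (i : ι) {z : ℝ} (hz : 0 ≤ z) :
    K + zono u (y + Pi.single i z) = K + zono u y + seg (u i) z := by
  rw [zono_add_single u hy i hz, add_assoc]

lemma IsOpenConvexBody.exists_separatelyAffine [DecidableEq ι]
    {K : Set (EuclideanSpace ℝ (Fin n))}
    (hK : IsOpenConvexBody K) (u : ι → EuclideanSpace ℝ (Fin n)) :
    ∃ F : (ι → ℝ) → ℝ, SeparatelyAffine F ∧
      (∀ y, 0 ≤ y → F y = volume.real (K + zono u y)) ∧
      ∀ y, 0 ≤ y → ∀ i, fdiff i F y = segGrowth (u i) (K + zono u y) := by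
  have key : ∀ y, 0 ≤ y → ∀ i z, 0 ≤ z → volume.real (K + zono u (y + Pi.single i z)) =
      volume.real (K + zono u y) + z * segGrowth (u i) (K + zono u y) := by
    intro y hy i z hz
    rw [add_zono_add_single K u hy i hz, (hK.add_zono u y).real_add_seg _ hz]
  obtain ⟨F, hF, hFe⟩ := exists_separatelyAffine_eq (φ := fun y => volume.real (K + zono u y))
    (fun y hy i z hz => by
      rw [key y hy i z hz, key y hy i 1 zero_le_one]; ring)
  refine ⟨F, hF, hFe, fun y hy i => ?_⟩
  have h1 : (0 : ι → ℝ) ≤ Pi.single i 1 := Pi.single_nonneg.2 zero_le_one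
  rw [fdiff, hFe _ (add_nonneg hy h1), hFe _ hy, key y hy i 1 zero_le_one]
  ring

end zonotope

section bochner

variable {κ : Type*} [Fintype κ] [DecidableEq κ]

open Matrix in
/-- A nonnegative symmetric matrix with Perron vector `w` such that `N² ≥ N` is nonpositive on the
orthogonal complement of `w`. -/
lemma dotProduct_mulVec_nonpos_of_sq_ge {N : Matrix κ κ ℝ} (hN : N.IsHermitian)
    (hN0 : ∀ i j, 0 ≤ N i j) {w : κ → ℝ} (hw : ∀ i, 0 < w i) (hNw : N *ᵥ w = w) (o : κ)
    (ho : ∀ j, 0 < N o j) (hsq : ∀ y : κ → ℝ, y ⬝ᵥ N *ᵥ y ≤ (N *ᵥ y) ⬝ᵥ (N *ᵥ y))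
    {y : κ → ℝ} (hy : w ⬝ᵥ y = 0) : y ⬝ᵥ N *ᵥ y ≤ 0 := by
  have hsymm : ∀ i j, N i j = N j i := fun i j => by
    have := hN.apply i j; simpa using this.symm
  have hT : Nᵀ = N := by ext i j; exact hsymm j i
  have inner_eq : ∀ a b : EuclideanSpace ℝ κ, inner ℝ a b = a.ofLp ⬝ᵥ b.ofLp := by
    intro a b
    rw [PiLp.inner_apply, dotProduct]
    exact Finset.sum_congr rfl fun i _ => by simp [mul_comm]
  have hb : ∀ i, 0 < hN.eigenvalues i →
      (hN.eigenvectorBasis i).ofLp ⬝ᵥ y = 0 := by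
    intro i hi
    set b : κ → ℝ := (hN.eigenvectorBasis i).ofLp with hbdef
    have hNb : N *ᵥ b = hN.eigenvalues i • b := hN.mulVec_eigenvectorBasis i
    have hbb : b ⬝ᵥ b = 1 := by
      rw [← inner_eq, real_inner_self_eq_norm_sq, hN.eigenvectorBasis.orthonormal.1 i]; norm_num
    have h1 := hsq b
    rw [hNb] at h1
    simp only [dotProduct_smul, smul_dotProduct, hbb, smul_eq_mul, mul_one] at h1
    have h2 : 1 ≤ hN.eigenvalues i := by nlinarith
    have h3 : ∑ j, ∑ k, N j k * (w j * w k) * (b j / w j - b k / w k) ^ 2 =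
        2 * (1 - hN.eigenvalues i) := by
      have e : ∀ j k, N j k * (w j * w k) * (b j / w j - b k / w k) ^ 2 =
          (N j k * w k) * (b j ^ 2 / w j) + (N k j * w j) * (b k ^ 2 / w k) -
            2 * (b j * (N j k * b k)) := by
        intro j k
        have := (hw j).ne'; have := (hw k).ne'
        rw [hsymm k j]
        field_simp
        ring
      have hrow : ∀ j, ∑ k, N j k * w k = w j := fun j => congrFun hNw j
      have s1 : ∑ j, ∑ k, (N j k * w k) * (b j ^ 2 / w j) = 1 := by
        rw [← hbb, dotProduct]
        refine Finset.sum_congr rfl fun j _ => ?_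
        rw [← Finset.sum_mul, hrow]
        have := (hw j).ne'
        field_simp
      have s2 : ∑ j, ∑ k, (N k j * w j) * (b k ^ 2 / w k) = 1 := by
        rw [Finset.sum_comm]; exact s1
      have s3 : ∑ j, ∑ k, (b j * (N j k * b k)) = hN.eigenvalues i := by
        have : b ⬝ᵥ N *ᵥ b = hN.eigenvalues i := by
          rw [hNb, dotProduct_smul, hbb]; simp
        rw [← this]
        simp only [dotProduct, mulVec, Finset.mul_sum]
      have s4 : ∑ j, ∑ k, 2 * (b j * (N j k * b k)) = 2 * hN.eigenvalues i := by
        rw [← s3]; simp only [Finset.mul_sum]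
      simp only [e, Finset.sum_sub_distrib, Finset.sum_add_distrib, s1, s2, s4]
      ring
    have hnn : ∀ j k, 0 ≤ N j k * (w j * w k) * (b j / w j - b k / w k) ^ 2 := fun j k =>
      mul_nonneg (mul_nonneg (hN0 j k) (mul_pos (hw j) (hw k)).le) (sq_nonneg _)
    have h4 : ∑ j, ∑ k, N j k * (w j * w k) * (b j / w j - b k / w k) ^ 2 = 0 :=
      le_antisymm (by rw [h3]; linarith)
        (Finset.sum_nonneg fun j _ => Finset.sum_nonneg fun k _ => hnn j k)
    have h5 : ∀ k, b k = b o / w o * w k := by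
      intro k
      have h6 := (Finset.sum_eq_zero_iff_of_nonneg
        (fun j _ => Finset.sum_nonneg fun k _ => hnn j k)).1 h4 o (Finset.mem_univ _)
      have h7 := (Finset.sum_eq_zero_iff_of_nonneg (fun k _ => hnn o k)).1 h6 k (Finset.mem_univ _)
      have h8 : N o k * (w o * w k) ≠ 0 := (mul_pos (ho k) (mul_pos (hw o) (hw k))).ne'
      have h9 := (mul_eq_zero.1 h7).resolve_left h8
      have h10 := pow_eq_zero_iff (two_ne_zero) |>.1 h9
      have := (hw k).ne'
      rw [sub_eq_zero.1 h10]; field_simp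
    have h6 : b = (b o / w o) • w := by ext k; exact h5 k
    rw [h6, smul_dotProduct, hy, smul_zero]
  have e1 := hN.eigenvectorBasis.sum_inner_mul_inner (WithLp.toLp 2 y) (WithLp.toLp 2 (N *ᵥ y))
  simp only [inner_eq] at e1
  rw [← e1]
  refine Finset.sum_nonpos fun i _ => ?_
  set b : κ → ℝ := (hN.eigenvectorBasis i).ofLp with hbdef
  have hNb : N *ᵥ b = hN.eigenvalues i • b := hN.mulVec_eigenvectorBasis i
  have e2 : b ⬝ᵥ N *ᵥ y = hN.eigenvalues i * (b ⬝ᵥ y) := by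
    rw [dotProduct_mulVec, ← mulVec_transpose, hT, hNb, smul_dotProduct, smul_eq_mul]
  rw [e2, dotProduct_comm y b]
  rcases le_or_gt (hN.eigenvalues i) 0 with h | h
  · nlinarith [sq_nonneg (b ⬝ᵥ y)]
  · rw [hb i h]; simp

/-- Weighted version of `dotProduct_mulVec_nonpos_of_sq_ge`. -/
lemma sum_mul_sum_nonpos_of_sq_ge {M : κ → κ → ℝ} (hM : ∀ i j, M i j = M j i)
    (hM0 : ∀ i j, 0 ≤ M i j) {v d : κ → ℝ} (hv : ∀ i, 0 < v i) (hd : ∀ i, 0 < d i)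
    (hMv : ∀ i, ∑ j, M i j * v j = d i * v i) (o : κ) (ho : ∀ j, 0 < M o j)
    (hsq : ∀ x : κ → ℝ, ∑ i, x i * ∑ j, M i j * x j ≤ ∑ i, (∑ j, M i j * x j) ^ 2 / d i)
    {x : κ → ℝ} (hx : ∑ i, v i * ∑ j, M i j * x j = 0) :
    ∑ i, x i * ∑ j, M i j * x j ≤ 0 := by
  set r : κ → ℝ := fun i => √(d i) with hr
  have r0 : ∀ i, 0 < r i := fun i => Real.sqrt_pos.2 (hd i)
  have r2 : ∀ i, d i = r i * r i := fun i => (Real.mul_self_sqrt (hd i).le).symm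
  set N : Matrix κ κ ℝ := Matrix.of fun i j => M i j / (r i * r j) with hNdef
  have hNy : ∀ y : κ → ℝ, ∀ i, N.mulVec y i = (∑ j, M i j * (y j / r j)) / r i := by
    intro y i
    simp only [Matrix.mulVec, dotProduct, hNdef, Matrix.of_apply, Finset.sum_div]
    refine Finset.sum_congr rfl fun j _ => ?_
    have := (r0 i).ne'; have := (r0 j).ne'
    field_simp
  have q : ∀ y : κ → ℝ, y ⬝ᵥ N.mulVec y = ∑ i, (y i / r i) * ∑ j, M i j * (y j / r j) := by
    intro y
    simp only [dotProduct, hNy]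
    refine Finset.sum_congr rfl fun i _ => by ring
  have hcancel : ∀ x : κ → ℝ, ∀ j, r j * x j / r j = x j := fun x j => by
    have := (r0 j).ne'; field_simp
  have key := dotProduct_mulVec_nonpos_of_sq_ge (N := N) (w := fun i => r i * v i)
    (y := fun i => r i * x i) ?_ ?_ (fun i => mul_pos (r0 i) (hv i)) ?_ o ?_ ?_ ?_
  · rw [q] at key
    simpa only [hcancel] using key
  · ext i j
    simp [hNdef, hM i j, mul_comm]
  · intro i j
    exact div_nonneg (hM0 i j) (mul_pos (r0 i) (r0 j)).le
  · ext i
    rw [hNy]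
    simp only [hcancel, hMv, r2]
    have := (r0 i).ne'
    field_simp
  · intro j
    exact div_pos (ho j) (mul_pos (r0 o) (r0 j))
  · intro y
    rw [q]
    refine (hsq fun i => y i / r i).trans (le_of_eq ?_)
    simp only [dotProduct, hNy]
    refine Finset.sum_congr rfl fun i _ => ?_
    rw [r2]; have := (r0 i).ne'
    field_simp
  · rw [← hx]
    simp only [dotProduct]
    have : ∑ i, v i * ∑ j, M i j * x j = ∑ i, x i * ∑ j, M i j * v j := by
      simp only [Finset.mul_sum]
      rw [Finset.sum_comm]
      refine Finset.sum_congr rfl fun i _ => Finset.sum_congr rfl fun j _ => ?_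
      rw [hM i j]; ring
    rw [this]
    refine Finset.sum_congr rfl fun i _ => ?_
    rw [hMv, r2]; ring

/-- Reversed Cauchy–Schwarz inequality for a symmetric form that is nonpositive on the complement
of a vector. -/
lemma reversed_cauchy_schwarz {a b c s t : ℝ} (ha : 0 ≤ a)
    (h : ∀ α γ : ℝ, α * s + γ * t = 0 → α ^ 2 * a + 2 * α * γ * b + γ ^ 2 * c ≤ 0) :
    a * c ≤ b ^ 2 := by
  by_contra hcon
  push Not at hcon
  have hac : 0 < a * c := (sq_nonneg b).trans_lt hcon
  have ha' : 0 < a := by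
    rcases ha.eq_or_lt with h0 | h0
    · rw [← h0] at hac; simp at hac
    · exact h0
  have hc' : 0 < c := by
    by_contra hc; nlinarith
  by_cases hs : s = 0
  · have := h 1 0 (by simp [hs]); simp at this; linarith
  · have h1 := h t (-s) (by ring)
    have h2 : 0 < s ^ 2 := by positivity
    nlinarith [sq_nonneg (t * a - s * b), mul_pos h2 (sub_pos.2 hcon)]

open Matrix in
lemma dotProduct_mulVec_expand {M : Matrix κ κ ℝ} (hM : ∀ i j, M i j = M j i) (v x : κ → ℝ)
    (α γ : ℝ) : (α • v + γ • x) ⬝ᵥ M *ᵥ (α • v + γ • x) =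
      α ^ 2 * (v ⬝ᵥ M *ᵥ v) + 2 * α * γ * (v ⬝ᵥ M *ᵥ x) + γ ^ 2 * (x ⬝ᵥ M *ᵥ x) := by
  have hT : Mᵀ = M := by ext i j; exact hM j i
  have : x ⬝ᵥ M *ᵥ v = v ⬝ᵥ M *ᵥ x := by
    rw [dotProduct_mulVec, ← mulVec_transpose, hT, dotProduct_comm]
  simp only [mulVec_add, mulVec_smul, add_dotProduct, dotProduct_add, smul_dotProduct,
    dotProduct_smul, smul_eq_mul, this]
  ring

open Matrix in
lemma mul_le_sq_of_lorentz {M : Matrix κ κ ℝ} (hM : ∀ i j, M i j = M j i) (v x w : κ → ℝ)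
    (hv : 0 ≤ v ⬝ᵥ M *ᵥ v)
    (h : ∀ x : κ → ℝ, w ⬝ᵥ M *ᵥ x = 0 → x ⬝ᵥ M *ᵥ x ≤ 0) :
    (v ⬝ᵥ M *ᵥ v) * (x ⬝ᵥ M *ᵥ x) ≤ (v ⬝ᵥ M *ᵥ x) ^ 2 := by
  refine reversed_cauchy_schwarz (s := w ⬝ᵥ M *ᵥ v) (t := w ⬝ᵥ M *ᵥ x) hv fun α γ hαγ => ?_
  rw [← dotProduct_mulVec_expand hM]
  apply h
  simpa only [mulVec_add, mulVec_smul, dotProduct_add, dotProduct_smul, smul_eq_mul] using hαγ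

open Matrix in
/-- A nonnegative symmetric trilinear form all of whose contractions with basis vectors are
Lorentzian satisfies the Alexandrov–Fenchel type inequality (strictly positive vectors). -/
lemma tensor_mul_le_sq_of_pos {T : κ → Matrix κ κ ℝ} (h1 : ∀ i j k, T i j k = T j i k)
    (h2 : ∀ i j k, T i j k = T i k j) (h0 : ∀ i j k, 0 ≤ T i j k) (e : κ)
    (he : ∀ k, 0 < T e e k)
    (hL : ∀ k (x : κ → ℝ), (T k *ᵥ x) e = 0 → x ⬝ᵥ T k *ᵥ x ≤ 0)
    {v : κ → ℝ} (hv : ∀ i, 0 < v i) :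
    (∑ k, v k * (v ⬝ᵥ T k *ᵥ v)) * (∑ k, v k * T e e k) ≤ (v ⬝ᵥ T e *ᵥ v) ^ 2 := by
  set M : Matrix κ κ ℝ := Matrix.of fun i j => ∑ k, v k * T k i j with hMdef
  have hM : ∀ i j, M i j = M j i := fun i j =>
    Finset.sum_congr rfl fun k _ => by rw [h2]
  have hM0 : ∀ i j, 0 ≤ M i j := fun i j =>
    Finset.sum_nonneg fun k _ => mul_nonneg (hv k).le (h0 k i j)
  have hMe : ∀ j, 0 < M e j := fun j =>
    (mul_pos (hv e) (he j)).trans_le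
      (Finset.single_le_sum (f := fun k => v k * T k e j)
        (fun k _ => mul_nonneg (hv k).le (h0 k e j)) (Finset.mem_univ e))
  have hMx : ∀ (x : κ → ℝ) i, (M *ᵥ x) i = v ⬝ᵥ T i *ᵥ x := by
    intro x i
    simp only [mulVec, dotProduct, hMdef, Matrix.of_apply, Finset.sum_mul, Finset.mul_sum]
    rw [Finset.sum_comm]
    refine Finset.sum_congr rfl fun k _ => Finset.sum_congr rfl fun j _ => ?_
    rw [h1 k i j]; ring
  have hMq : ∀ x y : κ → ℝ, x ⬝ᵥ M *ᵥ y = ∑ k, v k * (x ⬝ᵥ T k *ᵥ y) := by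
    intro x y
    simp only [mulVec, dotProduct, hMdef, Matrix.of_apply, Finset.sum_mul, Finset.mul_sum]
    rw [Finset.sum_congr rfl fun i _ => Finset.sum_comm, Finset.sum_comm]
    refine Finset.sum_congr rfl fun k _ => Finset.sum_congr rfl fun i _ =>
      Finset.sum_congr rfl fun j _ => by ring
  have hMv : ∀ i, 0 < (M *ᵥ v) i := fun i => by
    refine (mul_pos (hMe i) (hv e)).trans_le ?_
    rw [hM e i]
    exact Finset.single_le_sum (f := fun j => M i j * v j)
        (fun j _ => mul_nonneg (hM0 i j) (hv j).le) (Finset.mem_univ e)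
  have key : ∀ x : κ → ℝ, v ⬝ᵥ M *ᵥ x = 0 → x ⬝ᵥ M *ᵥ x ≤ 0 := by
    intro x hx
    refine sum_mul_sum_nonpos_of_sq_ge hM hM0 hv (d := fun i => (M *ᵥ v) i / v i)
      (fun i => div_pos (hMv i) (hv i)) (fun i => ?_) e hMe (fun x => ?_) hx
    · rw [div_mul_cancel₀ _ (hv i).ne']; rfl
    · change x ⬝ᵥ M *ᵥ x ≤ ∑ i, ((M *ᵥ x) i) ^ 2 / ((M *ᵥ v) i / v i)
      rw [hMq]
      refine Finset.sum_le_sum fun k _ => ?_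
      rw [div_div_eq_mul_div, le_div_iff₀ (hMv k)]
      have := mul_le_sq_of_lorentz (M := T k) (h2 k) v x (Pi.single e 1)
        (by rw [← hMx]; exact (hMv k).le)
        (fun x hx => hL k x (by rwa [single_one_dotProduct] at hx))
      rw [hMx, hMx]
      nlinarith [hv k]
  have fin := mul_le_sq_of_lorentz hM v (Pi.single e 1) v
    (Finset.sum_nonneg fun i _ => mul_nonneg (hv i).le (hMv i).le) key
  have e1 : (Pi.single e 1 : κ → ℝ) ⬝ᵥ M *ᵥ Pi.single e 1 = ∑ k, v k * T e e k := by
    rw [hMq]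
    refine Finset.sum_congr rfl fun k _ => ?_
    simp only [single_one_dotProduct, mulVec_single_one, col_apply]
    rw [h1 k e e, h2 e k e]
  have e2 : v ⬝ᵥ M *ᵥ Pi.single e 1 = v ⬝ᵥ T e *ᵥ v := by
    rw [← hMx v e, mulVec_single_one]
    simp only [mulVec, dotProduct, col_apply]
    exact Finset.sum_congr rfl fun i _ => by rw [hM e i]; ring
  rwa [e1, e2, hMq] at fin

open Matrix in
/-- A nonnegative symmetric trilinear form all of whose contractions with basis vectors are
Lorentzian satisfies the Alexandrov–Fenchel type inequality. -/
lemma tensor_mul_le_sq {T : κ → Matrix κ κ ℝ} (h1 : ∀ i j k, T i j k = T j i k)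
    (h2 : ∀ i j k, T i j k = T i k j) (h0 : ∀ i j k, 0 ≤ T i j k) (e : κ)
    (he : ∀ k, 0 < T e e k)
    (hL : ∀ k (x : κ → ℝ), (T k *ᵥ x) e = 0 → x ⬝ᵥ T k *ᵥ x ≤ 0)
    {v : κ → ℝ} (hv : ∀ i, 0 ≤ v i) :
    (∑ k, v k * (v ⬝ᵥ T k *ᵥ v)) * (∑ k, v k * T e e k) ≤ (v ⬝ᵥ T e *ᵥ v) ^ 2 := by
  set w : ℝ → κ → ℝ := fun s i => v i + s with hw
  have key : ∀ s : ℝ, 0 < s → 0 ≤ (w s ⬝ᵥ T e *ᵥ w s) ^ 2 -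
      (∑ k, w s k * (w s ⬝ᵥ T k *ᵥ w s)) *
        (∑ k, w s k * T e e k) := fun s hs =>
    sub_nonneg.2 (tensor_mul_le_sq_of_pos h1 h2 h0 e he hL
      (fun i => add_pos_of_nonneg_of_pos (hv i) hs))
  have hc : Continuous fun s : ℝ => (w s ⬝ᵥ T e *ᵥ w s) ^ 2 -
      (∑ k, w s k * (w s ⬝ᵥ T k *ᵥ w s)) *
        (∑ k, w s k * T e e k) := by
    simp only [dotProduct, mulVec, hw]
    fun_prop
  have h3 := ge_of_tendsto ((hc.tendsto 0).mono_left nhdsWithin_le_nhds)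
    (Filter.eventually_of_mem self_mem_nhdsWithin fun s (hs : s ∈ Ioi (0 : ℝ)) => key s hs)
  have h4 : w 0 = v := by ext; simp [hw]
  simp only [h4] at h3
  linarith

end bochner

section alexandrovFenchel

variable {n : ℕ}

/-- If `s ↦ (1 + s x)ᵐ φ(s / (1 + s x))` satisfies a midpoint quasi-concavity inequality at `0` and
is critical there, then its second derivative is nonpositive. -/
lemma second_deriv_nonpos {φ φ' : ℝ → ℝ} {c x : ℝ} {m : ℕ}
    (h1 : ∀ σ, HasDerivAt φ (φ' σ) σ) (h2 : HasDerivAt φ' c 0)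
    (hq : ∀ᶠ s in nhds (0 : ℝ), min ((1 + s * x) ^ m * φ (s / (1 + s * x)))
      ((1 + -s * x) ^ m * φ (-s / (1 + -s * x))) ≤ φ 0)
    (h0 : m * x * φ 0 + φ' 0 = 0) :
    m * (m - 1) * x ^ 2 * φ 0 + 2 * (m - 1) * x * φ' 0 + c ≤ 0 := by
  by_contra hcon
  push Not at hcon
  set D := m * (m - 1) * x ^ 2 * φ 0 + 2 * (m - 1) * x * φ' 0 + c with hD
  set Q : ℝ → ℝ := fun s => (1 + s * x) ^ m * φ (s / (1 + s * x)) - D / 4 * s ^ 2 with hQ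
  have hr : ∀ s, HasDerivAt (fun s : ℝ => 1 + s * x) x s := fun s => by
    simpa using ((hasDerivAt_id s).mul_const x).const_add 1
  have hσ : ∀ s, 1 + s * x ≠ 0 →
      HasDerivAt (fun s : ℝ => s / (1 + s * x)) (1 / (1 + s * x) ^ 2) s := fun s hs =>
    ((hasDerivAt_id s).div (hr s) hs).congr_deriv (by simp)
  set Q' : ℝ → ℝ := fun s => m * (1 + s * x) ^ (m - 1) * x * φ (s / (1 + s * x)) +
    (1 + s * x) ^ m * (φ' (s / (1 + s * x)) * (1 / (1 + s * x) ^ 2)) - D / 2 * s with hQ'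
  have hne : ∀ᶠ s in nhds (0 : ℝ), 1 + s * x ≠ 0 :=
    (by fun_prop : Continuous fun s : ℝ => 1 + s * x).continuousAt.eventually_ne (by simp)
  have hder : ∀ s, 1 + s * x ≠ 0 → HasDerivAt Q (Q' s) s := fun s hs => by
    have e1 := ((hr s).pow m).mul ((h1 _).comp s (hσ s hs))
    refine (e1.sub (((hasDerivAt_id s).pow 2).const_mul (D / 4))).congr_deriv ?_
    simp [hQ']
    ring
  have hd : deriv Q =ᶠ[nhds 0] Q' := by
    filter_upwards [hne] with s hs using (hder s hs).deriv
  have hσ0 : HasDerivAt (fun s : ℝ => s / (1 + s * x)) 1 0 := by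
    simpa using hσ 0 (by simp)
  have hQ'' : HasDerivAt Q' (D / 2) 0 := by
    have hφ : HasDerivAt (fun s : ℝ => φ (s / (1 + s * x))) (φ' 0) 0 := by
      have := (h1 (0 / (1 + 0 * x))).comp 0 hσ0
      simpa [Function.comp_def] using this
    have hφ' : HasDerivAt (fun s : ℝ => φ' (s / (1 + s * x))) c 0 := by
      have h2' : HasDerivAt φ' c (0 / (1 + 0 * x)) := by simpa using h2
      simpa [Function.comp_def] using h2'.comp 0 hσ0
    have hi : HasDerivAt (fun s : ℝ => 1 / (1 + s * x) ^ 2) (-2 * x) 0 := by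
      have := ((hr 0).pow 2).inv (by simp)
      simp only [one_div]
      exact this.congr_deriv (by simp)
    have e := ((((((hr 0).pow (m - 1)).const_mul (m : ℝ)).mul_const x).mul hφ).add
      (((hr 0).pow m).mul (hφ'.mul hi))).sub ((hasDerivAt_id (0 : ℝ)).const_mul (D / 2))
    refine e.congr_deriv ?_
    simp only [Pi.pow_apply, Pi.mul_apply, zero_mul, add_zero, one_pow, mul_one,
      div_one, hD]
    rcases m with _ | _ | m
    · simp; ring
    · simp; ring
    · push_cast
      ring
  have hmin : IsLocalMin Q 0 := by
    refine isLocalMin_of_deriv_deriv_pos ?_ ?_ (hder 0 (by simp)).continuousAt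
    · rw [hd.deriv_eq, hQ''.deriv]; linarith
    · rw [hd.self_of_nhds]; simp [hQ']; linarith
  have hmin' : ∀ᶠ s in nhds (0 : ℝ), Q 0 ≤ Q (-s) := by
    have : Filter.Tendsto (fun s : ℝ => -s) (nhds 0) (nhds 0) := by
      simpa using (continuous_neg (G := ℝ)).tendsto 0
    exact this.eventually hmin
  obtain ⟨s, ⟨⟨h3, h4⟩, h5⟩, hs⟩ := ((((show ∀ᶠ s in nhds (0 : ℝ), Q 0 ≤ Q s from hmin).and
    hmin').and hq).filter_mono nhdsWithin_le_nhds |>.and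
      (self_mem_nhdsWithin : ∀ᶠ s in nhdsWithin (0 : ℝ) (Ioi 0), s ∈ Ioi (0 : ℝ))).exists
  have hs' : 0 < s := hs
  have h6 : 0 < D / 4 * s ^ 2 := by positivity
  simp only [hQ] at h3 h4
  simp at h3 h4
  rcases min_le_iff.1 h5 with h | h
  · linarith
  · simp at h; linarith

variable {ι : Type*} [Fintype ι] [DecidableEq ι]

/-- The Hessian form at `(1, 0)` of `(r, y) ↦ rᵐ G(y / r)`, in terms of the value, the gradient and
the Hessian of `G`. -/
def homHess (m G0 : ℝ) (G1 : ι → ℝ) (G2 : ι → ι → ℝ) : Matrix (Option ι) (Option ι) ℝ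
  | none, none => m * (m - 1) * G0
  | none, some i => (m - 1) * G1 i
  | some i, none => (m - 1) * G1 i
  | some i, some j => G2 i j

open Matrix in
lemma homHess_mulVec_none (m G0 : ℝ) (G1 : ι → ℝ) (G2 : ι → ι → ℝ) (x : Option ι → ℝ) :
    (homHess m G0 G1 G2 *ᵥ x) none =
      (m - 1) * (m * x none * G0 + ∑ i, x (some i) * G1 i) := by
  simp only [mulVec, dotProduct, Fintype.sum_option, homHess, mul_add, Finset.mul_sum]
  congr 1
  · ring
  · exact Finset.sum_congr rfl fun i _ => by ring

open Matrix in
lemma dotProduct_homHess_mulVec (m G0 : ℝ) (G1 : ι → ℝ) (G2 : ι → ι → ℝ) (x : Option ι → ℝ) :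
    x ⬝ᵥ homHess m G0 G1 G2 *ᵥ x =
      m * (m - 1) * x none ^ 2 * G0 + 2 * (m - 1) * x none * ∑ i, x (some i) * G1 i +
        ∑ i, x (some i) * ∑ j, x (some j) * G2 i j := by
  simp only [mulVec, dotProduct, Fintype.sum_option, homHess, mul_add, Finset.mul_sum,
    Finset.sum_add_distrib]
  have e : ∀ i, x (some i) * ((m - 1) * G1 i * x none) = (m - 1) * x none * (x (some i) * G1 i) :=
    fun i => by ring
  have e' : ∀ i, x none * ((m - 1) * G1 i * x (some i)) = (m - 1) * x none * (x (some i) * G1 i) :=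
    fun i => by ring
  have e2 : ∀ i, 2 * (m - 1) * x none * (x (some i) * G1 i) =
    (m - 1) * x none * (x (some i) * G1 i) + (m - 1) * x none * (x (some i) * G1 i) :=
    fun i => by ring
  have e3 : ∀ i j, x (some i) * (G2 i j * x (some j)) = x (some i) * (x (some j) * G2 i j) :=
    fun i j => by ring
  simp only [e, e', e2, e3, Finset.sum_add_distrib]
  ring

/-- Nonnegativity on the orthant passes to forward differences. -/
lemma SeparatelyAffine.fdiff_nonneg {F : (ι → ℝ) → ℝ} (hF : SeparatelyAffine F)
    (h : ∀ y, 0 ≤ y → 0 ≤ F y) (i : ι) (y : ι → ℝ) (hy : 0 ≤ y) : 0 ≤ _root_.fdiff i F y := by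
  refine le_of_forall_affine (a := 0) (c := F y) fun z hz => ?_
  rw [← hF.apply_add, mul_zero, add_zero]
  exact h _ (add_nonneg hy (Pi.single_nonneg.2 hz))

/-- Second-order consequence of quasi-concavity for a separately affine function. -/
lemma SeparatelyAffine.homHess_nonpos {G : (ι → ℝ) → ℝ} (hG : SeparatelyAffine G) (y : ι → ℝ)
    (m : ℕ) (x : Option ι → ℝ)
    (hq : ∀ᶠ s in nhds (0 : ℝ), min ((1 + s * x none) ^ m *
        G (y + (s / (1 + s * x none)) • fun i => x (some i)))
      ((1 + -s * x none) ^ m *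
        G (y + (-s / (1 + -s * x none)) • fun i => x (some i))) ≤ G y)
    (h0 : m * x none * G y + ∑ i, x (some i) * _root_.fdiff i G y = 0) :
    x ⬝ᵥ (homHess m (G y) (fun i => _root_.fdiff i G y)
      fun i j => _root_.fdiff i (_root_.fdiff j G) y).mulVec x ≤ 0 := by
  rw [dotProduct_homHess_mulVec]
  have key := second_deriv_nonpos (φ := fun σ => G (y + σ • fun i => x (some i)))
    (φ' := fun σ => ∑ i, x (some i) * _root_.fdiff i G (y + σ • fun i => x (some i)))
    (c := ∑ i, x (some i) * ∑ j, x (some j) *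
      _root_.fdiff i (_root_.fdiff j G) (y + (0 : ℝ) • fun i => x (some i)))
    (x := x none) (m := m) (fun σ => hG.hasDerivAt y _ σ) ?_ ?_ ?_
  · simpa using key
  · refine (HasDerivAt.fun_sum fun i _ =>
      ((hG.fdiff i).hasDerivAt y (fun i => x (some i)) 0).const_mul (x (some i))).congr_deriv ?_
    simp only [fdiff_comm]
  · simpa using hq
  · simpa using h0

end alexandrovFenchel

section bodies

variable {n : ℕ}

lemma segGrowth_pos {C : Set (EuclideanSpace ℝ (Fin n))} (hC : IsOpenConvexBody C)
    (hne : C.Nonempty) {u : EuclideanSpace ℝ (Fin n)} (hu : u ≠ 0) : 0 < segGrowth u C := by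
  refine (segGrowth_nonneg hC u).lt_of_ne' fun h0 => ?_
  obtain ⟨ρ, hρ⟩ := hC.isBounded.subset_closedBall 0
  obtain ⟨c, hc⟩ := hne
  have hρ0 : 0 ≤ ρ := by
    have := hρ hc
    rw [mem_closedBall_zero_iff] at this
    exact (norm_nonneg c).trans this
  have hu' : 0 < ‖u‖ := norm_pos_iff.2 hu
  set y : ℝ := (2 * ρ + 1) / ‖u‖ with hy
  have hy0 : 0 ≤ y := by positivity
  have h1 := hC.real_add_seg u hy0
  rw [h0, mul_zero, add_zero] at h1
  have hdisj : Disjoint C (y • u +ᵥ C) := by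
    rw [Set.disjoint_left]
    rintro _ hx ⟨z, hz, rfl⟩
    have h2 := mem_closedBall_zero_iff.1 (hρ hx)
    have h3 := mem_closedBall_zero_iff.1 (hρ hz)
    have h4 : ‖y • u‖ = 2 * ρ + 1 := by
      rw [norm_smul, Real.norm_of_nonneg hy0, hy, div_mul_cancel₀ _ hu'.ne']
    have h5 : ‖y • u‖ ≤ ‖y • u +ᵥ z‖ + ‖z‖ := by
      simpa using norm_sub_le (y • u +ᵥ z) z
    linarith
  have hsub : C ∪ (y • u +ᵥ C) ⊆ C + seg u y := by
    rintro x (hx | ⟨z, hz, rfl⟩)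
    · exact subset_add_seg C u hy0 hx
    · exact mem_add_seg.2 ⟨y, hy0, le_rfl, by simpa using hz⟩
  have h2 := (hC.add_seg u y).real_mono hsub
  have hfin : volume (y • u +ᵥ C) ≠ ⊤ := by rw [measure_vadd]; exact hC.volume_ne_top
  rw [measureReal_union hdisj (hC.isOpen.vadd _).measurableSet hC.volume_ne_top hfin, h1,
    measureReal_def, measureReal_def, measure_vadd] at h2
  have h3 : 0 < (volume C).toReal :=
    ENNReal.toReal_pos (hC.isOpen.measure_pos volume ⟨c, hc⟩).ne' hC.volume_ne_top
  linarith

variable {ι : Type*} [Fintype ι]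

lemma eventually_scaling_pos {y x : ι → ℝ} (hy : ∀ i, 0 < y i) (a : ℝ) :
    ∀ᶠ s in nhds (0 : ℝ), 0 < 1 + s * a ∧ 0 ≤ y + (s / (1 + s * a)) • x := by
  have h1 : ∀ᶠ s in nhds (0 : ℝ), 0 < 1 + s * a :=
    (by fun_prop : Continuous fun s : ℝ => 1 + s * a).continuousAt.eventually_const_lt (by simp)
  have h2 : ∀ᶠ s in nhds (0 : ℝ), ∀ i, 0 < y i + s / (1 + s * a) * x i := by
    rw [Filter.eventually_all]
    intro i
    have hc : ContinuousAt (fun s : ℝ => y i + s / (1 + s * a) * x i) 0 := by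
      refine continuousAt_const.add (ContinuousAt.mul (ContinuousAt.div (by fun_prop)
        (by fun_prop) (by simp)) continuousAt_const)
    exact hc.eventually_const_lt (by simpa using hy i)
  filter_upwards [h1, h2] with s h1 h2
  exact ⟨h1, fun i => (h2 i).le⟩

lemma smul_add_zono (K : Set (EuclideanSpace ℝ (Fin n))) (u : ι → EuclideanSpace ℝ (Fin n))
    (y : ι → ℝ) {r : ℝ} (hr : 0 < r) : r • (K + zono u y) = r • K + zono u (r • y) := by
  rw [smul_add, smul_zono u y hr]

lemma midpoint_mem_of_scaling {K : Set (EuclideanSpace ℝ (Fin n))} (hK : Convex ℝ K)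
    (u : ι → EuclideanSpace ℝ (Fin n)) (y x : ι → ℝ) {a s : ℝ} (h1 : 0 < 1 + s * a)
    (h2 : 0 < 1 + -s * a) :
    ∀ p ∈ (1 + s * a) • (K + zono u (y + (s / (1 + s * a)) • x)),
    ∀ q ∈ (1 + -s * a) • (K + zono u (y + (-s / (1 + -s * a)) • x)),
      (2⁻¹ : ℝ) • (p + q) ∈ K + zono u y := by
  rw [smul_add_zono K u _ h1, smul_add_zono K u _ h2]
  refine midpoint_mem_add_zono ?_ fun i => ?_
  · rintro _ ⟨c, hc, rfl⟩ _ ⟨d, hd, rfl⟩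
    have := hK hc hd (a := 2⁻¹ * (1 + s * a)) (b := 2⁻¹ * (1 + -s * a)) (by positivity)
      (by positivity) (by ring)
    simpa only [smul_add, smul_smul] using this
  · simp only [Pi.smul_apply, Pi.add_apply, smul_eq_mul]
    have e : ∀ r s : ℝ, 0 < r → r * (y i + s / r * x i) = r * y i + s * x i := fun r s hr => by
      have := hr.ne'
      field_simp
    rw [e _ _ h1, e _ _ h2]
    ring

variable [DecidableEq ι]

/-- The volume polynomial of a convex body plus a zonotope, with nonnegative coefficients. -/
structure IsVolumePolynomial (K : Set (EuclideanSpace ℝ (Fin n)))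
    (u : ι → EuclideanSpace ℝ (Fin n)) (F : (ι → ℝ) → ℝ) : Prop where
  affine : SeparatelyAffine F
  eq_volume : ∀ y, 0 ≤ y → F y = volume.real (K + zono u y)
  fdiff_eq : ∀ y, 0 ≤ y → ∀ i, fdiff i F y = segGrowth (u i) (K + zono u y)

lemma IsVolumePolynomial.homHess_volume_nonpos {K : Set (EuclideanSpace ℝ (Fin n))}
    (hK : IsOpenConvexBody K)
    {u : ι → EuclideanSpace ℝ (Fin n)} {F : (ι → ℝ) → ℝ} (hF : IsVolumePolynomial K u F)
    {y : ι → ℝ} (hy : ∀ i, 0 < y i) (x : Option ι → ℝ)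
    (h0 : n * x none * F y + ∑ i, x (some i) * fdiff i F y = 0) :
    x ⬝ᵥ (homHess n (F y) (fun i => fdiff i F y)
      fun i j => fdiff i (fdiff j F) y).mulVec x ≤ 0 := by
  refine hF.affine.homHess_nonpos y n x ?_ h0
  have e1 := eventually_scaling_pos (x := fun i => x (some i)) hy (x none)
  have e2 := (show Filter.Tendsto (fun s : ℝ => -s) (nhds 0) (nhds 0) by
    simpa using (continuous_neg (G := ℝ)).tendsto 0).eventually e1
  filter_upwards [e1, e2] with s h1 h2
  rw [hF.eq_volume _ h1.2, hF.eq_volume _ h2.2, hF.eq_volume y fun i => (hy i).le,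
    ← real_smul_set _ h1.1.le, ← real_smul_set _ h2.1.le]
  exact IsOpenConvexBody.min_real_le ((hK.add_zono u _).smul h1.1.ne')
    ((hK.add_zono u _).smul h2.1.ne') (hK.add_zono u _)
    (midpoint_mem_of_scaling hK.convex u y _ h1.1 h2.1)

lemma IsVolumePolynomial.homHess_fdiff_nonpos (hn : 1 ≤ n) {K : Set (EuclideanSpace ℝ (Fin n))}
    (hK : IsOpenConvexBody K)
    {u : ι → EuclideanSpace ℝ (Fin n)} {F : (ι → ℝ) → ℝ} (hF : IsVolumePolynomial K u F)
    {y : ι → ℝ} (hy : ∀ i, 0 < y i) (k : ι) (x : Option ι → ℝ)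
    (h0 : (n - 1 : ℕ) * x none * fdiff k F y + ∑ i, x (some i) * fdiff i (fdiff k F) y = 0) :
    x ⬝ᵥ (homHess (n - 1 : ℕ) (fdiff k F y) (fun i => fdiff i (fdiff k F) y)
      fun i j => fdiff i (fdiff j (fdiff k F)) y).mulVec x ≤ 0 := by
  refine (hF.affine.fdiff k).homHess_nonpos y (n - 1) x ?_ h0
  have e1 := eventually_scaling_pos (x := fun i => x (some i)) hy (x none)
  have e2 := (show Filter.Tendsto (fun s : ℝ => -s) (nhds 0) (nhds 0) by
    simpa using (continuous_neg (G := ℝ)).tendsto 0).eventually e1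
  have hs : ∀ (C : Set (EuclideanSpace ℝ (Fin n))) (r : ℝ), IsOpenConvexBody C → 0 < r →
      r ^ (n - 1) * segGrowth (u k) C = segGrowth (u k) (r • C) := by
    intro C r hC hr
    have := segGrowth_smul hC (u k) hr
    obtain ⟨m, rfl⟩ : ∃ m, n = m + 1 := ⟨n - 1, by omega⟩
    rw [pow_succ'] at this
    simp only [add_tsub_cancel_right]
    exact (mul_left_cancel₀ hr.ne' (by rw [this]; ring)).symm
  filter_upwards [e1, e2] with s h1 h2
  rw [hF.fdiff_eq _ h1.2, hF.fdiff_eq _ h2.2, hF.fdiff_eq y fun i => (hy i).le,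
    hs _ _ (hK.add_zono u _) h1.1, hs _ _ (hK.add_zono u _) h2.1]
  exact min_segGrowth_le ((hK.add_zono u _).smul h1.1.ne')
    ((hK.add_zono u _).smul h2.1.ne') (hK.add_zono u _)
    (midpoint_mem_of_scaling hK.convex u y _ h1.1 h2.1) (u k)

/-- An Alexandrov–Fenchel inequality for the volume polynomial. -/
lemma IsVolumePolynomial.alexandrov_fenchel (hn : 2 ≤ n) {K : Set (EuclideanSpace ℝ (Fin n))}
    (hK : IsOpenConvexBody K) (hne : K.Nonempty)
    {u : ι → EuclideanSpace ℝ (Fin n)} (hu : ∀ i, u i ≠ 0)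
    {F : (ι → ℝ) → ℝ} (hF : IsVolumePolynomial K u F) {y : ι → ℝ} (hy : ∀ i, 0 < y i) :
    (n - 1) * (∑ k, fdiff k F y) * (∑ k, ∑ i, ∑ j, fdiff i (fdiff j (fdiff k F)) y) ≤
      (n - 2) * (∑ k, ∑ i, fdiff i (fdiff k F) y) ^ 2 := by
  have hy0 : 0 ≤ y := fun i => (hy i).le
  have hbody := hK.add_zono u y
  have hbne : (K + zono u y).Nonempty := hne.add ⟨0, zero_mem_zono u hy0⟩
  have ha : ∀ k, 0 < fdiff k F y := fun k => by
    rw [hF.fdiff_eq y hy0]; exact segGrowth_pos hbody hbne (hu k)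
  have hV : 0 < F y := by
    rw [hF.eq_volume y hy0]
    exact ENNReal.toReal_pos (hbody.isOpen.measure_pos volume hbne).ne' hbody.volume_ne_top
  have hF0 : ∀ y, 0 ≤ y → 0 ≤ F y := fun y hy => by
    rw [hF.eq_volume y hy]; exact measureReal_nonneg
  have ha2 : ∀ i j, 0 ≤ fdiff i (fdiff j F) y := fun i j =>
    (hF.affine.fdiff j).fdiff_nonneg (hF.affine.fdiff_nonneg hF0 j) i y hy0
  have ha3 : ∀ i j k, 0 ≤ fdiff i (fdiff j (fdiff k F)) y := fun i j k =>
    ((hF.affine.fdiff k).fdiff j).fdiff_nonneg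
      ((hF.affine.fdiff k).fdiff_nonneg (hF.affine.fdiff_nonneg hF0 k) j) i y hy0
  have hn1 : ((n - 1 : ℕ) : ℝ) = n - 1 := by push_cast [show 1 ≤ n by omega]; ring
  rcases hn.eq_or_lt with rfl | hn3
  · have h3 : ∀ k, ∑ i, ∑ j, fdiff i (fdiff j (fdiff k F)) y ≤ 0 := by
      intro k
      set x : Option ι → ℝ := fun o => o.elim (-(∑ i, fdiff i (fdiff k F) y) / fdiff k F y)
        fun _ => 1 with hx
      have := hF.homHess_fdiff_nonpos (by norm_num) hK hy k x ?_
      · rw [dotProduct_homHess_mulVec] at this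
        simpa [hx] using this
      · have := (ha k).ne'
        simp [hx]
        field_simp
        ring
    have h4 : ∑ k, ∑ i, ∑ j, fdiff i (fdiff j (fdiff k F)) y ≤ 0 :=
      Finset.sum_nonpos fun k _ => h3 k
    have h5 : 0 ≤ ∑ k, fdiff k F y := Finset.sum_nonneg fun k _ => (ha k).le
    norm_num
    nlinarith
  · have hn3' : (3 : ℝ) ≤ n := by exact_mod_cast hn3
    have hc2 : (0 : ℝ) < n - 2 := by linarith
    set T : Option ι → Matrix (Option ι) (Option ι) ℝ := fun o => o.elim
      (((n : ℝ) - 2) • homHess n (F y) (fun i => fdiff i F y) fun i j => fdiff i (fdiff j F) y)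
      fun k => homHess (n - 1 : ℕ) (fdiff k F y) (fun i => fdiff i (fdiff k F) y)
        fun i j => fdiff i (fdiff j (fdiff k F)) y with hT
    have key := tensor_mul_le_sq (T := T) ?_ ?_ ?_ none ?_ ?_
      (v := fun o : Option ι => o.elim 0 fun _ => 1) ?_
    · simp only [Fintype.sum_option, hT, Option.elim, zero_mul, zero_add, one_mul,
        dotProduct_homHess_mulVec, Matrix.smul_mulVec, dotProduct_smul, smul_eq_mul,
        Matrix.smul_apply, homHess] at key
      simp only [ne_eq, OfNat.ofNat_ne_zero, not_false_eq_true, zero_pow, mul_zero, zero_mul,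
        zero_add] at key
      simp only [← Finset.mul_sum] at key
      have e : ∑ i, ∑ j, fdiff i (fdiff j F) y = ∑ k, ∑ i, fdiff i (fdiff k F) y :=
        Finset.sum_comm
      rw [e] at key
      refine le_of_mul_le_mul_left (le_trans (le_of_eq ?_) (key.trans (le_of_eq ?_))) hc2 <;> ring
    · rintro (_ | i) (_ | j) (_ | k) <;>
        simp only [hT, homHess, hn1, Option.elim, Matrix.smul_apply, smul_eq_mul] <;>
        try ring1
      · rw [fdiff_comm j k]; ring
      · rw [fdiff_comm k i]; ring
      · rw [fdiff_comm i j]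
      · rw [fdiff_comm j k, fdiff_comm i k, fdiff_comm i j]
    · rintro (_ | i) (_ | j) (_ | k) <;>
        simp only [hT, homHess, hn1, Option.elim, Matrix.smul_apply, smul_eq_mul] <;>
        try ring1
      · rw [fdiff_comm j k]
      · rw [fdiff_comm j k]
    · rintro (_ | i) (_ | j) (_ | k) <;>
        simp only [hT, homHess, hn1, Option.elim, Matrix.smul_apply, smul_eq_mul]
      · exact mul_nonneg hc2.le (mul_nonneg (mul_nonneg (by linarith) (by linarith)) hV.le)
      · exact mul_nonneg hc2.le (mul_nonneg (by linarith) (ha k).le)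
      · exact mul_nonneg hc2.le (mul_nonneg (by linarith) (ha j).le)
      · exact mul_nonneg hc2.le (ha2 j k)
      · exact mul_nonneg (mul_nonneg (by linarith) (by linarith)) (ha i).le
      · exact mul_nonneg (by linarith) (ha2 k i)
      · exact mul_nonneg (by linarith) (ha2 j i)
      · exact ha3 j k i
    · rintro (_ | k) <;>
        simp only [hT, homHess, hn1, Option.elim, Matrix.smul_apply, smul_eq_mul]
      · exact mul_pos hc2 (mul_pos (mul_pos (by linarith) (by linarith)) hV)
      · exact mul_pos hc2 (mul_pos (by linarith) (ha k))
    · rintro (_ | k) x hx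
      · simp only [hT, Option.elim, Matrix.smul_mulVec, dotProduct_smul, smul_eq_mul,
          Pi.smul_apply, homHess_mulVec_none] at hx ⊢
        refine mul_nonpos_of_nonneg_of_nonpos hc2.le (hF.homHess_volume_nonpos hK hy x ?_)
        have h6 := (mul_eq_zero.1 hx).resolve_left hc2.ne'
        exact (mul_eq_zero.1 h6).resolve_left (by linarith)
      · simp only [hT, Option.elim, homHess_mulVec_none] at hx ⊢
        refine hF.homHess_fdiff_nonpos (by omega) hK hy k x ?_
        exact (mul_eq_zero.1 hx).resolve_left (by rw [hn1]; linarith)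
    · rintro (_ | k) <;> simp

end bodies

section zonoGrowth

variable {n : ℕ} {ι : Type*} [Fintype ι]

/-- The rate of growth of the volume of `K` when the zonotope generated by `u` is added. -/
def zonoGrowth (u : ι → EuclideanSpace ℝ (Fin n)) (K : Set (EuclideanSpace ℝ (Fin n))) : ℝ :=
  ∑ i, segGrowth (u i) K

lemma zonoGrowth_nonneg (u : ι → EuclideanSpace ℝ (Fin n)) {K : Set (EuclideanSpace ℝ (Fin n))}
    (hK : IsOpenConvexBody K) : 0 ≤ zonoGrowth u K :=
  Finset.sum_nonneg fun i _ => segGrowth_nonneg hK (u i)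

lemma zonoGrowth_mono (u : ι → EuclideanSpace ℝ (Fin n)) {K L : Set (EuclideanSpace ℝ (Fin n))}
    (hK : IsOpenConvexBody K) (hL : IsOpenConvexBody L) (h : K ⊆ L) :
    zonoGrowth u K ≤ zonoGrowth u L :=
  Finset.sum_le_sum fun i _ => segGrowth_mono hK hL h (u i)

lemma segGrowth_vadd (u v : EuclideanSpace ℝ (Fin n)) (C : Set (EuclideanSpace ℝ (Fin n))) :
    segGrowth u (v +ᵥ C) = segGrowth u C := by
  simp only [segGrowth, vadd_add_assoc, measureReal_def, measure_vadd]

lemma zonoGrowth_vadd (u : ι → EuclideanSpace ℝ (Fin n)) (v : EuclideanSpace ℝ (Fin n))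
    (C : Set (EuclideanSpace ℝ (Fin n))) : zonoGrowth u (v +ᵥ C) = zonoGrowth u C := by
  simp only [zonoGrowth, segGrowth_vadd]

lemma zonoGrowth_smul (hn : 1 ≤ n) (u : ι → EuclideanSpace ℝ (Fin n))
    {C : Set (EuclideanSpace ℝ (Fin n))} (hC : IsOpenConvexBody C) {r : ℝ} (hr : 0 < r) :
    zonoGrowth u (r • C) = r ^ (n - 1) * zonoGrowth u C := by
  simp only [zonoGrowth, Finset.mul_sum]
  refine Finset.sum_congr rfl fun i _ => ?_
  have := segGrowth_smul hC (u i) hr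
  obtain ⟨m, rfl⟩ : ∃ m, n = m + 1 := ⟨n - 1, by omega⟩
  rw [pow_succ'] at this
  simp only [add_tsub_cancel_right]
  exact mul_left_cancel₀ hr.ne' (by rw [this]; ring)

lemma isOpenConvexBody_ball (x : EuclideanSpace ℝ (Fin n)) (r : ℝ) : IsOpenConvexBody (ball x r) :=
  ⟨isOpen_ball, isBounded_ball, convex_ball x r⟩

/-- Minkowski's inequality, for bodies enclosed between the ball and its sum with a zonotope. -/
lemma le_zonoGrowth_ball {u : ι → EuclideanSpace ℝ (Fin n)} {ρ : ℝ} (hρ : 0 < ρ)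
    (hu : ball 0 ρ ⊆ zono u 1) :
    n * ρ * volume.real (ball (0 : EuclideanSpace ℝ (Fin n)) 1) ≤ zonoGrowth u (ball 0 1) := by
  classical
  set ω := volume.real (ball (0 : EuclideanSpace ℝ (Fin n)) 1) with hω
  obtain ⟨F, hF, hF1, hF2⟩ := (isOpenConvexBody_ball (n := n) 0 1).exists_separatelyAffine u
  have h1 : HasDerivAt (fun t : ℝ => F (0 + t • (1 : ι → ℝ)) - (1 + t * ρ) ^ n * ω)
      (zonoGrowth u (ball 0 1) - n * ρ * ω) 0 := by
    refine ((hF.hasDerivAt 0 1 0).sub (((((hasDerivAt_id (0 : ℝ)).mul_const ρ).const_add 1).pow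
      n).mul_const ω)).congr_deriv ?_
    simp [zonoGrowth, hF2 0 le_rfl, zono_zero]
  by_contra hcon
  push Not at hcon
  have h2 : ∀ t : ℝ, 0 < t → 0 ≤ F (0 + t • (1 : ι → ℝ)) - (1 + t * ρ) ^ n * ω := by
    intro t ht
    have ht1 : (0 : ι → ℝ) ≤ 0 + t • (1 : ι → ℝ) := fun i => by simp [ht.le]
    have hr : 0 < 1 + t * ρ := by positivity
    rw [hF1 _ ht1, hω, ← real_smul_set _ hr.le, sub_nonneg]
    refine ((isOpenConvexBody_ball 0 1).add_zono u _).real_mono ?_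
    rw [zero_add, ← smul_zono u _ ht]
    refine Subset.trans (subset_of_eq ?_) (add_subset_add_left (smul_set_mono hu))
    rw [smul_unitBall hr.ne', _root_.smul_ball ht.ne', smul_zero, ball_add_ball one_pos (mul_pos (norm_pos_iff.2 ht.ne') hρ)]
    simp [abs_of_pos hr, abs_of_pos ht]
  have h3 := h1.tendsto_slope_zero_right
  have h4 := ge_of_tendsto h3 (b := (0 : ℝ)) (by
    filter_upwards [self_mem_nhdsWithin] with t (ht : 0 < t)
    have := h2 t ht
    have e0 : F (0 + (0 : ℝ) • (1 : ι → ℝ)) - (1 + 0 * ρ) ^ n * ω = 0 := by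
      simp [hF1 0 le_rfl, zono_zero, hω]
    rw [e0, zero_add t, sub_zero]
    exact smul_nonneg (inv_nonneg.2 ht.le) this)
  linarith

lemma concaveOn_rpow_of_mul_le {G G' G'' : ℝ → ℝ} {a : ℝ} (ha : 0 ≤ a)
    (h1 : ∀ t, HasDerivAt G (G' t) t) (h2 : ∀ t, HasDerivAt G' (G'' t) t)
    (hpos : ∀ t, 0 ≤ t → 0 < G t)
    (h : ∀ t, 0 < t → G t * G'' t ≤ (1 - a) * G' t ^ 2) :
    ConcaveOn ℝ (Ici 0) fun t => G t ^ a := by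
  have hd : ∀ t, 0 < t → HasDerivAt (fun t => G t ^ a) (G' t * a * G t ^ (a - 1)) t :=
    fun t ht => (h1 t).rpow_const (Or.inl (hpos t ht.le).ne')
  have hd2 : ∀ t, 0 < t → HasDerivAt (fun t => G' t * a * G t ^ (a - 1))
      (G'' t * a * G t ^ (a - 1) + G' t * a * (G' t * (a - 1) * G t ^ (a - 1 - 1))) t :=
    fun t ht => ((h2 t).mul_const a).mul ((h1 t).rpow_const (Or.inl (hpos t ht.le).ne'))
  refine concaveOn_of_hasDerivWithinAt2_nonpos (convex_Ici 0)
    (f' := fun t => G' t * a * G t ^ (a - 1))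
    (f'' := fun t => G'' t * a * G t ^ (a - 1) + G' t * a * (G' t * (a - 1) * G t ^ (a - 1 - 1)))
    ?_ ?_ ?_ ?_
  · intro t ht
    exact ((h1 t).continuousAt.rpow_const (Or.inl (hpos t ht).ne')).continuousWithinAt
  · intro t ht
    rw [interior_Ici] at ht ⊢
    exact (hd t ht).hasDerivWithinAt
  · intro t ht
    rw [interior_Ici] at ht ⊢
    exact (hd2 t ht).hasDerivWithinAt
  · intro t ht
    rw [interior_Ici] at ht
    have hG := hpos t (le_of_lt ht)
    have e : G t ^ (a - 1) = G t ^ (a - 1 - 1) * G t := by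
      rw [← Real.rpow_add_one hG.ne']; ring_nf
    have hG2 : 0 ≤ G t ^ (a - 1 - 1) * a := mul_nonneg (Real.rpow_nonneg hG.le _) ha
    have := mul_nonneg hG2 (sub_nonneg.2 (h t ht))
    rw [e]
    nlinarith

/-- A Brunn–Minkowski inequality for the mixed volume `zonoGrowth`. -/
lemma zonoGrowth_rpow_add_le [Nonempty ι] (hn : 2 ≤ n) {K : Set (EuclideanSpace ℝ (Fin n))}
    (hK : IsOpenConvexBody K) (hne : K.Nonempty)
    {u : ι → EuclideanSpace ℝ (Fin n)} (hu : ∀ i, u i ≠ 0) {ρ : ℝ} (hρ : ball 0 ρ ⊆ zono u 1)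
    {s : ℝ} (hs : 0 < s) :
    zonoGrowth u K ^ (1 / (n - 1 : ℝ)) + s * zonoGrowth u (ball 0 ρ) ^ (1 / (n - 1 : ℝ)) ≤
      zonoGrowth u (K + zono u (s • 1)) ^ (1 / (n - 1 : ℝ)) := by
  classical
  have hn' : (2 : ℝ) ≤ n := by exact_mod_cast hn
  have hn1 : (0 : ℝ) < n - 1 := by linarith
  obtain ⟨F, hF, hF1, hF2⟩ := hK.exists_separatelyAffine u
  have hF' : IsVolumePolynomial K u F := ⟨hF, hF1, hF2⟩
  set a : ℝ := 1 / (n - 1 : ℝ) with ha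
  have ha0 : 0 ≤ a := by positivity
  set L := zonoGrowth u (ball 0 ρ) ^ a with hL
  set G : ℝ → ℝ := fun t => ∑ k, fdiff k F (0 + t • (1 : ι → ℝ)) with hG
  have hGeq : ∀ t, 0 ≤ t → G t = zonoGrowth u (K + zono u (t • 1)) := by
    intro t ht
    simp only [hG, zonoGrowth, zero_add]
    exact Finset.sum_congr rfl fun i _ => hF2 _ (smul_nonneg ht zero_le_one) i
  have hconc : ConcaveOn ℝ (Ici 0) fun t => G t ^ a := by
    refine concaveOn_rpow_of_mul_le ha0
      (G' := fun t => ∑ k, ∑ i, fdiff i (fdiff k F) (0 + t • (1 : ι → ℝ)))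
      (G'' := fun t => ∑ k, ∑ i, ∑ j, fdiff i (fdiff j (fdiff k F)) (0 + t • (1 : ι → ℝ)))
      (fun t => ?_) (fun t => ?_) (fun t ht => ?_) (fun t ht => ?_)
    · refine (HasDerivAt.fun_sum fun k _ => (hF.fdiff k).hasDerivAt 0 1 t).congr_deriv ?_
      simp
    · refine (HasDerivAt.fun_sum fun k _ => HasDerivAt.fun_sum fun i _ =>
        ((hF.fdiff k).fdiff i).hasDerivAt 0 1 t).congr_deriv ?_
      refine Finset.sum_congr rfl fun k _ => ?_
      rw [Finset.sum_comm]
      simp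
    · rw [hGeq t ht]
      refine Finset.sum_pos (fun i _ => segGrowth_pos (hK.add_zono u _) ?_ (hu i))
        Finset.univ_nonempty
      exact hne.add ⟨0, zero_mem_zono u (smul_nonneg ht zero_le_one)⟩
    · have := hF'.alexandrov_fenchel hn hK hne hu (y := 0 + t • (1 : ι → ℝ))
        (fun i => by simpa using ht)
      have e : (1 - a) = (n - 2) / (n - 1) := by
        rw [ha]; field_simp; ring
      rw [e, div_mul_eq_mul_div, le_div_iff₀ hn1]
      simp only [hG]
      linarith
  have hlow : ∀ t, 0 < t → t * L ≤ G t ^ a := by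
    intro t ht
    obtain ⟨k, hk⟩ := hne
    have h1 : t ^ (n - 1) * zonoGrowth u (ball 0 ρ) ≤ G t := by
      rw [hGeq t ht.le, ← zonoGrowth_smul (by omega) u (isOpenConvexBody_ball 0 ρ) ht,
        ← zonoGrowth_vadd u k]
      refine zonoGrowth_mono u ?_ (hK.add_zono u _) ?_
      · have := (isOpenConvexBody_ball (n := n) 0 ρ).smul ht.ne'
        exact ⟨this.isOpen.vadd _, this.isBounded.vadd _, this.convex.vadd _⟩
      · rw [← smul_zono u _ ht]
        rintro _ ⟨z, hz, rfl⟩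
        exact add_mem_add hk (smul_set_mono hρ hz)
    have h2 : t * L = (t ^ (n - 1) * zonoGrowth u (ball 0 ρ)) ^ a := by
      rw [Real.mul_rpow (by positivity) (zonoGrowth_nonneg u (isOpenConvexBody_ball 0 ρ)),
        ← Real.rpow_natCast, ← Real.rpow_mul ht.le]
      have : ((n - 1 : ℕ) : ℝ) * a = 1 := by
        rw [Nat.cast_sub (by omega), ha]; simp; field_simp
      rw [this, Real.rpow_one]
    rw [h2]
    exact Real.rpow_le_rpow (mul_nonneg (by positivity)
      (zonoGrowth_nonneg u (isOpenConvexBody_ball 0 ρ))) h1 ha0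
  have h0 : zonoGrowth u K = G 0 := by rw [hGeq 0 le_rfl]; simp [zono_zero]
  rw [h0, ← hGeq s hs.le]
  have hL0 : 0 ≤ G 0 ^ a := by
    rw [← h0]; exact Real.rpow_nonneg (zonoGrowth_nonneg u hK) _
  have h3 : ∀ᶠ t in Filter.atTop, s * L - s * G 0 ^ a * t⁻¹ ≤ G s ^ a - G 0 ^ a := by
    filter_upwards [Filter.eventually_gt_atTop s] with t ht
    have ht0 : 0 < t := hs.trans ht
    have h4 := hconc.2 (self_mem_Ici : (0:ℝ) ∈ Ici 0) (show t ∈ Ici (0 : ℝ) from ht0.le)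
      (show 0 ≤ 1 - s / t from sub_nonneg.2 ((div_le_one ht0).2 ht.le))
      (show 0 ≤ s / t by positivity) (by ring)
    simp only [smul_eq_mul, mul_zero, zero_add, div_mul_cancel₀ _ ht0.ne'] at h4
    have h5 : s / t * (t * L) ≤ s / t * G t ^ a := by
      gcongr; exact hlow t ht0
    have h6 : s / t * (t * L) = s * L := by field_simp
    have h7 : s * G 0 ^ a * t⁻¹ = s / t * G 0 ^ a := by ring
    rw [h7]; linarith
  have h8 : Filter.Tendsto (fun t : ℝ => s * L - s * G 0 ^ a * t⁻¹) Filter.atTop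
      (nhds (s * L - s * G 0 ^ a * 0)) :=
    tendsto_const_nhds.sub (tendsto_inv_atTop_zero.const_mul _)
  have := le_of_tendsto h8 h3
  linarith

end zonoGrowth

section innerParallel
variable {n : ℕ}
local notation "E" => EuclideanSpace ℝ (Fin n)

theorem IsOpenConvexBody.exists_erosion {ι : Type*} {K : Set (EuclideanSpace ℝ (Fin n))}
    (hK : IsOpenConvexBody K) (u : ι → EuclideanSpace ℝ (Fin n)) {h : ℝ} (hh : 0 ≤ h)
    (T : Finset ι) :
    ∃ K', IsOpenConvexBody K' ∧ K' ⊆ K ∧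
      volume.real K - volume.real K' ≤ h * ∑ i ∈ T, segGrowth (u i) K ∧
      ∀ x ∈ K', ∀ τ : ι → ℝ, (∀ i, 0 ≤ τ i ∧ τ i ≤ h) → x + ∑ i ∈ T, τ i • u i ∈ K := by
  classical
  induction T using Finset.induction_on with
  | empty => exact ⟨K, hK, Subset.rfl, by simp, fun x hx τ _ => by simpa using hx⟩
  | insert a T ha ih =>
    obtain ⟨K', hK', hsub, hvol, hadd⟩ := ih
    have hopen : IsOpen {x | x + h • u a ∈ K'} :=
      hK'.isOpen.preimage (continuous_id.add continuous_const)
    have hconv : Convex ℝ {x | x + h • u a ∈ K'} := hK'.convex.translate_preimage_left _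
    have hbody : IsOpenConvexBody (K' ∩ {x | x + h • u a ∈ K'}) :=
      ⟨hK'.isOpen.inter hopen, hK'.isBounded.subset inter_subset_left, hK'.convex.inter hconv⟩
    refine ⟨K' ∩ {x | x + h • u a ∈ K'}, hbody, inter_subset_left.trans hsub, ?_, ?_⟩
    · have h1 := real_diff_vadd_le hK' (u a) hh
      have h2 : volume.real K' - volume.real (K' ∩ {x | x + h • u a ∈ K'}) =
          volume.real {x ∈ K' | x + h • u a ∉ K'} := by
        rw [← measureReal_sdiff inter_subset_left hbody.isOpen.measurableSet hK'.volume_ne_top]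
        congr 1
        ext x; simp
      have h3 := mul_le_mul_of_nonneg_left (segGrowth_mono hK' hK hsub (u a)) hh
      rw [Finset.sum_insert ha, mul_add]
      linarith
    · rintro x ⟨hx, hx'⟩ τ hτ
      rw [Finset.sum_insert ha, ← add_assoc]
      refine hadd _ ?_ τ hτ
      rcases hh.eq_or_lt with rfl | hpos
      · have := hτ a
        have : τ a = 0 := le_antisymm this.2 this.1
        simpa [this] using hx
      · have := hK'.convex hx hx' (show 0 ≤ 1 - τ a / h from
          sub_nonneg.2 ((div_le_one hpos).2 (hτ a).2))
          (show 0 ≤ τ a / h from div_nonneg (hτ a).1 hpos.le) (by ring)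
        convert this using 1
        rw [smul_add, smul_smul, div_mul_cancel₀ _ hpos.ne', ← add_assoc, ← add_smul]
        simp

/-- The inner parallel set of `Ω` at distance `s`. -/
def innerParallel (Ω : Set (EuclideanSpace ℝ (Fin n))) (s : ℝ) : Set (EuclideanSpace ℝ (Fin n)) :=
  {x | s < infDist x Ωᶜ}

theorem innerParallel_anti (Ω : Set (EuclideanSpace ℝ (Fin n))) {s t : ℝ} (h : s ≤ t) :
    innerParallel Ω t ⊆ innerParallel Ω s := fun _ hx => h.trans_lt hx

theorem isOpen_innerParallel (Ω : Set (EuclideanSpace ℝ (Fin n))) (s : ℝ) :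
    IsOpen (innerParallel Ω s) := isOpen_lt continuous_const (continuous_infDist_pt _)

namespace IsOpenConvexBody
variable {Ω : Set (EuclideanSpace ℝ (Fin n))}

theorem compl_nonempty (hn : 1 ≤ n) (hΩ : IsOpenConvexBody Ω) : Ωᶜ.Nonempty := by
  have : Nontrivial (EuclideanSpace ℝ (Fin n)) := by
    have : Nonempty (Fin n) := ⟨⟨0, hn⟩⟩
    infer_instance
  rw [nonempty_compl]
  rintro rfl
  exact NormedSpace.unbounded_univ ℝ _ hΩ.isBounded

theorem mem_innerParallel (hn : 1 ≤ n) (hΩ : IsOpenConvexBody Ω) {s : ℝ}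
    {x : EuclideanSpace ℝ (Fin n)} : x ∈ innerParallel Ω s ↔ closedBall x s ⊆ Ω := by
  constructor
  · intro hx y hy
    by_contra hy'
    have := infDist_le_dist_of_mem (x := x) (show y ∈ Ωᶜ from hy')
    rw [mem_closedBall, dist_comm] at hy
    exact absurd (lt_of_lt_of_le hx this) hy.not_gt
  · intro h
    obtain ⟨z, hz, hz'⟩ := hΩ.isOpen.isClosed_compl.exists_infDist_eq_dist
      (hΩ.compl_nonempty hn) x
    rw [innerParallel, mem_ofPred_eq, hz']
    by_contra hcon
    exact hz (h (by rw [mem_closedBall, dist_comm]; exact not_lt.1 hcon))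

theorem innerParallel_zero (hn : 1 ≤ n) (hΩ : IsOpenConvexBody Ω) : innerParallel Ω 0 = Ω := by
  ext x; rw [hΩ.mem_innerParallel hn]; simp

protected theorem innerParallel (hn : 1 ≤ n) (hΩ : IsOpenConvexBody Ω) {s : ℝ} (hs : 0 ≤ s) :
    IsOpenConvexBody (innerParallel Ω s) where
  isOpen := isOpen_innerParallel Ω s
  isBounded := hΩ.isBounded.subset
    ((innerParallel_anti Ω hs).trans (hΩ.innerParallel_zero hn).subset)
  convex := by
    intro x hx y hy a b ha hb hab
    rw [hΩ.mem_innerParallel hn] at *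
    intro z hz
    have key : z = a • (x + (z - (a • x + b • y))) + b • (y + (z - (a • x + b • y))) := by
      have : z - (a • x + b • y) = (a + b) • (z - (a • x + b • y)) := by rw [hab, one_smul]
      rw [smul_add, smul_add, add_add_add_comm, ← add_smul, hab, one_smul]; abel
    rw [key]
    have hz' : ‖z - (a • x + b • y)‖ ≤ s := by simpa [dist_eq_norm] using hz
    exact hΩ.convex (hx (by simpa [dist_eq_norm] using hz'))
      (hy (by simpa [dist_eq_norm] using hz')) ha hb hab

end IsOpenConvexBody

variable {Ω : Set (EuclideanSpace ℝ (Fin n))} {ι : Type*} [Fintype ι]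

theorem real_innerParallel_sub_le (hn : 1 ≤ n) (hΩ : IsOpenConvexBody Ω) (u : ι → E) {ρ : ℝ}
    (hρ : 0 < ρ) (hu : closedBall 0 ρ ⊆ zono u 1) {s h : ℝ} (hs : 0 ≤ s) (hh : 0 ≤ h) :
    ρ * (volume.real (innerParallel Ω s) - volume.real (innerParallel Ω (s + h))) ≤
      h * zonoGrowth u (innerParallel Ω s) := by
  have hK := hΩ.innerParallel hn hs
  obtain ⟨K', hK', hsub, hvol, hadd⟩ :=
    hK.exists_erosion u (show 0 ≤ h / ρ by positivity) Finset.univ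
  have h1 : K' ⊆ innerParallel Ω (s + h) := by
    intro x hx
    rw [hΩ.mem_innerParallel hn]
    intro z hz
    have hz' : ‖z - x‖ ≤ s + h := by simpa [dist_eq_norm] using hz
    -- split the displacement proportionally
    rcases (add_nonneg hs hh).eq_or_lt with h0 | h0
    · have : z = x := by
        rw [← h0] at hz'; exact sub_eq_zero.1 (norm_le_zero_iff.1 hz')
      rw [this]
      exact (hΩ.innerParallel_zero hn).subset (innerParallel_anti Ω hs (hsub hx))
    have h2 : (ρ / (s + h)) • (z - x) ∈ zono u 1 := hu (by
      rw [mem_closedBall_zero_iff, norm_smul, Real.norm_eq_abs, abs_of_pos (by positivity)]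
      calc ρ / (s + h) * ‖z - x‖ ≤ ρ / (s + h) * (s + h) := by gcongr
        _ = ρ := by field_simp)
    obtain ⟨τ, hτ, hτ'⟩ := h2
    have h3 := hadd x hx (fun i => h / ρ * τ i) (fun i =>
      ⟨mul_nonneg (by positivity) (hτ.1 i), mul_le_of_le_one_right (by positivity) (hτ.2 i)⟩)
    have h4 : ∑ i, (h / ρ * τ i) • u i = (h / (s + h)) • (z - x) := by
      simp only [mul_smul, ← Finset.smul_sum]
      simp only at hτ'
      rw [hτ', smul_smul]; congr 1; field_simp
    rw [h4] at h3
    refine (hΩ.mem_innerParallel hn).1 h3 ?_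
    rw [mem_closedBall, dist_eq_norm]
    have h5 : z - (x + (h / (s + h)) • (z - x)) = (s / (s + h)) • (z - x) := by
      have : s / (s + h) = 1 - h / (s + h) := by field_simp; ring
      rw [this, sub_smul, one_smul]; abel
    rw [h5, norm_smul, Real.norm_eq_abs, abs_of_nonneg (by positivity)]
    calc s / (s + h) * ‖z - x‖ ≤ s / (s + h) * (s + h) := by gcongr
      _ = s := by field_simp
  have h2 : volume.real K' ≤ volume.real (innerParallel Ω (s + h)) :=
    (hΩ.innerParallel hn (by positivity)).real_mono h1
  have h3 : ρ * (volume.real (innerParallel Ω s) - volume.real K') ≤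
      ρ * (h / ρ * zonoGrowth u (innerParallel Ω s)) := mul_le_mul_of_nonneg_left hvol hρ.le
  have h4 : ρ * (h / ρ * zonoGrowth u (innerParallel Ω s)) =
      h * zonoGrowth u (innerParallel Ω s) := by field_simp
  nlinarith

theorem zonoGrowth_innerParallel_rpow_le [Nonempty ι] (hn : 2 ≤ n) (hΩ : IsOpenConvexBody Ω)
    (u : ι → E) (hu0 : ∀ i, u i ≠ 0) {ρ : ℝ} (hρ : 0 < ρ) (hu : closedBall 0 ρ ⊆ zono u 1)
    (hu1 : zono u 1 ⊆ closedBall 0 1) {s : ℝ} (hs : 0 ≤ s)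
    (hne : (innerParallel Ω s).Nonempty) :
    zonoGrowth u (innerParallel Ω s) ^ (1 / (n - 1 : ℝ)) +
      s * (n * ρ ^ n * volume.real (ball (0 : E) 1)) ^ (1 / (n - 1 : ℝ)) ≤
      zonoGrowth u Ω ^ (1 / (n - 1 : ℝ)) := by
  have hn1 : 1 ≤ n := by omega
  have hn' : (0 : ℝ) ≤ 1 / (n - 1 : ℝ) := by
    have : (2 : ℝ) ≤ n := by exact_mod_cast hn
    exact div_nonneg zero_le_one (by linarith)
  have hK := hΩ.innerParallel hn1 hs
  rcases hs.eq_or_lt with rfl | hpos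
  · rw [hΩ.innerParallel_zero hn1]; simp
  have hb := ball_subset_closedBall.trans hu
  refine le_trans ?_ ((zonoGrowth_rpow_add_le hn hK hne hu0 hb hpos).trans ?_)
  · gcongr
    have h1 := le_zonoGrowth_ball hρ hb
    have h2 : ball (0 : E) ρ = ρ • ball (0 : E) 1 := by rw [smul_unitBall_of_pos hρ]
    rw [h2, zonoGrowth_smul hn1 u (isOpenConvexBody_ball 0 1) hρ]
    have h3 : ρ ^ n = ρ ^ (n - 1) * ρ := by rw [← pow_succ]; congr 1; omega
    rw [h3]
    calc n * (ρ ^ (n - 1) * ρ) * volume.real (ball (0 : E) 1)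
        = ρ ^ (n - 1) * (n * ρ * volume.real (ball (0 : E) 1)) := by ring
      _ ≤ _ := by gcongr
  · refine Real.rpow_le_rpow (zonoGrowth_nonneg u (hK.add_zono u _)) ?_ hn'
    refine zonoGrowth_mono u (hK.add_zono u _) hΩ ?_
    rintro _ ⟨x, hx, y, hy, rfl⟩
    rw [← smul_zono u _ hpos] at hy
    obtain ⟨w, hw, rfl⟩ := hy
    have hw' : ‖w‖ ≤ 1 := by simpa using hu1 hw
    refine (hΩ.mem_innerParallel hn1).1 hx ?_
    simp only [mem_closedBall, dist_self_add_left, norm_smul, Real.norm_eq_abs, abs_of_pos hpos]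
    exact mul_le_of_le_one_right hs hw'
end innerParallel

section innerParallelVolume
variable {n : ℕ}
local notation "E" => EuclideanSpace ℝ (Fin n)

/-- The anisotropic perimeters of `Ω`, with respect to zonotopes approximating the unit ball,
are asymptotically at most the perimeter of the ball of radius `R`. -/
def HasApproxPerimeterLE (Ω : Set (EuclideanSpace ℝ (Fin n))) (R : ℝ) : Prop :=
  ∀ ε : ℝ, 0 < ε → ε < 1 → ∃ (ι : Type) (_ : Fintype ι) (_ : Nonempty ι)
    (u : ι → EuclideanSpace ℝ (Fin n)),
    (∀ i, u i ≠ 0) ∧ closedBall 0 (1 - ε) ⊆ zono u 1 ∧ zono u 1 ⊆ closedBall 0 1 ∧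
    zonoGrowth u Ω ≤ (1 + ε) * (n * volume.real (ball (0 : EuclideanSpace ℝ (Fin n)) 1) *
      R ^ (n - 1))

variable {Ω : Set (EuclideanSpace ℝ (Fin n))} {R : ℝ}

theorem real_innerParallel_sub_le_of_approx (hn : 2 ≤ n) (hΩ : IsOpenConvexBody Ω) (hR : 0 < R)
    (hap : HasApproxPerimeterLE Ω R) {s h : ℝ} (hs : 0 ≤ s) (hh : 0 ≤ h) :
    volume.real (innerParallel Ω s) - volume.real (innerParallel Ω (s + h)) ≤
      h * (n * volume.real (ball (0 : E) 1) * (max (R - s) 0) ^ (n - 1)) := by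
  have hn1 : 1 ≤ n := by omega
  set ω := volume.real (ball (0 : E) 1) with hω
  have hω0 : 0 < ω := ENNReal.toReal_pos (measure_ball_pos _ _ one_pos).ne' measure_ball_lt_top.ne
  have hn0 : (0 : ℝ) < n := by exact_mod_cast (by omega : 0 < n)
  rcases (innerParallel Ω s).eq_empty_or_nonempty with he | hne
  · have : innerParallel Ω (s + h) = ∅ :=
      subset_empty_iff.1 (he ▸ innerParallel_anti Ω (by linarith))
    rw [he, this]; simp only [sub_self]; positivity
  set a : ℝ := 1 / (n - 1 : ℝ) with ha
  have hn2 : (2 : ℝ) ≤ n := by exact_mod_cast hn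
  have ha0 : 0 < a := by rw [ha]; exact one_div_pos.2 (by linarith)
  have han : a * ((n - 1 : ℕ) : ℝ) = 1 := by
    rw [ha, Nat.cast_sub hn1, Nat.cast_one]; field_simp [show (n : ℝ) - 1 ≠ 0 by linarith]
  -- the bound with error `ε`
  let g : ℝ → ℝ := fun ε => ((1 + ε) * (n * ω * R ^ (n - 1))) ^ a -
    s * (n * (1 - ε) ^ n * ω) ^ a
  have hg : Continuous g := by
    refine Continuous.sub ?_ (continuous_const.mul ?_)
    · exact Continuous.rpow_const (by fun_prop) fun _ => Or.inr ha0.le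
    · exact Continuous.rpow_const (by fun_prop) fun _ => Or.inr ha0.le
  have key : ∀ ε : ℝ, 0 < ε → ε < 1 → (1 - ε) * (volume.real (innerParallel Ω s) -
      volume.real (innerParallel Ω (s + h))) ≤ h * (max (g ε) 0) ^ (n - 1) := by
    intro ε hε hε1
    obtain ⟨ι, _, _, u, hu0, hu, hu1, hM⟩ := hap ε hε hε1
    have hρ : 0 < 1 - ε := by linarith
    refine (real_innerParallel_sub_le hn1 hΩ u hρ hu hs hh).trans ?_
    gcongr
    have h1 := zonoGrowth_innerParallel_rpow_le hn hΩ u hu0 hρ hu hu1 hs hne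
    have hM0 := zonoGrowth_nonneg u (hΩ.innerParallel hn1 hs)
    have h2 : zonoGrowth u Ω ^ a ≤ ((1 + ε) * (n * ω * R ^ (n - 1))) ^ a :=
      Real.rpow_le_rpow (zonoGrowth_nonneg u hΩ) hM ha0.le
    have h3 : zonoGrowth u (innerParallel Ω s) ^ a ≤ max (g ε) 0 :=
      le_max_of_le_left (by simp only [g]; linarith)
    calc zonoGrowth u (innerParallel Ω s)
        = (zonoGrowth u (innerParallel Ω s) ^ a) ^ (n - 1) := by
          rw [← Real.rpow_natCast, ← Real.rpow_mul hM0, han, Real.rpow_one]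
      _ ≤ _ := pow_le_pow_left₀ (Real.rpow_nonneg hM0 _) h3 _
  have hlim : Filter.Tendsto (fun ε : ℝ => h * (max (g ε) 0) ^ (n - 1)) (nhdsWithin 0 (Ioi 0))
      (nhds (h * (max (g 0) 0) ^ (n - 1))) :=
    ((continuous_const.mul ((hg.max continuous_const).pow _)).tendsto 0).mono_left
      nhdsWithin_le_nhds
  have hlim2 : Filter.Tendsto (fun ε : ℝ => (1 - ε) * (volume.real (innerParallel Ω s) -
      volume.real (innerParallel Ω (s + h)))) (nhdsWithin 0 (Ioi 0))
      (nhds ((1 - 0) * (volume.real (innerParallel Ω s) -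
      volume.real (innerParallel Ω (s + h))))) :=
    ((by fun_prop : Continuous fun ε : ℝ => (1 - ε) * (volume.real (innerParallel Ω s) -
      volume.real (innerParallel Ω (s + h)))).tendsto 0).mono_left nhdsWithin_le_nhds
  have h4 := le_of_tendsto_of_tendsto hlim2 hlim (by
    filter_upwards [Ioo_mem_nhdsGT one_pos] with ε hε using key ε hε.1 hε.2)
  rw [sub_zero, one_mul] at h4
  refine h4.trans_eq ?_
  have h5 : g 0 = (n * ω) ^ a * (R - s) := by
    have : (R ^ (n - 1)) ^ a = R := by
      rw [← Real.rpow_natCast, ← Real.rpow_mul hR.le, mul_comm, han, Real.rpow_one]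
    simp only [g, add_zero, one_mul, sub_zero, one_pow, mul_one]
    rw [Real.mul_rpow (by positivity) (by positivity), this]; ring
  have h6 : max (g 0) 0 = (n * ω) ^ a * max (R - s) 0 := by
    rw [h5, mul_max_of_nonneg _ _ (by positivity), mul_zero]
  rw [h6, mul_pow, ← Real.rpow_natCast (_ ^ a), ← Real.rpow_mul (by positivity), han,
    Real.rpow_one]

theorem mul_pow_le_add_pow_sub {y h : ℝ} (hy : 0 ≤ y) (hh : 0 ≤ h) (m : ℕ) :
    h * ((m + 1 : ℝ) * y ^ m) ≤ (y + h) ^ (m + 1) - y ^ (m + 1) := by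
  induction m with
  | zero => simp
  | succ m ih =>
    have h1 := mul_le_mul_of_nonneg_left ih hy
    have h2 : y ^ (m + 1) ≤ (y + h) ^ (m + 1) := pow_le_pow_left₀ hy (by linarith) _
    have h3 := mul_le_mul_of_nonneg_left h2 hh
    push_cast
    rw [pow_succ (y + h) (m + 1), pow_succ y (m + 1)]
    have : y * (h * ((m + 1 : ℝ) * y ^ m)) = h * ((m + 1 : ℝ) * y ^ (m + 1)) := by ring
    linarith

theorem max_pow_sub_le {n : ℕ} (hn : 2 ≤ n) {x h : ℝ} (hh : 0 ≤ h) :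
    h * (n * (max (x - h) 0) ^ (n - 1)) ≤ (max x 0) ^ n - (max (x - h) 0) ^ n := by
  rcases le_or_gt (x - h) 0 with h1 | h1
  · rw [max_eq_right h1, zero_pow (by omega), zero_pow (by omega)]
    simp only [mul_zero, sub_zero]
    positivity
  · rw [max_eq_left h1.le, max_eq_left (by linarith)]
    obtain ⟨m, rfl⟩ : ∃ m, n = m + 1 := ⟨n - 1, by omega⟩
    simpa using mul_pow_le_add_pow_sub h1.le hh m

theorem real_innerParallel_sub_le_pow (hn : 2 ≤ n) (hΩ : IsOpenConvexBody Ω) (hR : 0 < R)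
    (hap : HasApproxPerimeterLE Ω R) {a b : ℝ} (ha : 0 ≤ a) (hab : a ≤ b) :
    volume.real (innerParallel Ω a) - volume.real (innerParallel Ω b) ≤
      volume.real (ball (0 : E) 1) * ((max (R - a) 0) ^ n - (max (R - b) 0) ^ n) := by
  set ω := volume.real (ball (0 : E) 1) with hω
  set f : ℝ → ℝ := fun s => volume.real (innerParallel Ω s)
  set g : ℝ → ℝ := fun s => n * ω * (max (R - s) 0) ^ (n - 1)
  set G : ℝ → ℝ := fun s => ω * (max (R - s) 0) ^ n
  have step : ∀ s h : ℝ, 0 ≤ s → 0 ≤ h → f s - f (s + h) ≤ G s - G (s + h) +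
      h * (g s - g (s + h)) := by
    intro s h hs hh
    have h1 := real_innerParallel_sub_le_of_approx hn hΩ hR hap hs hh
    have h2 := mul_le_mul_of_nonneg_left (max_pow_sub_le hn (x := R - s) hh)
      (show 0 ≤ ω from measureReal_nonneg)
    rw [sub_sub] at h2
    simp only [f, g, G]
    linarith
  have tel : ∀ (N : ℕ) (h : ℝ), 0 ≤ h → f a - f (a + N * h) ≤ G a - G (a + N * h) +
      h * (g a - g (a + N * h)) := by
    intro N h hh
    induction N with
    | zero => simp
    | succ N ih =>
      have := step (a + N * h) h (by positivity) hh
      have e : a + ((N + 1 : ℕ) : ℝ) * h = a + N * h + h := by push_cast; ring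
      rw [e]; linarith
  have key : ∀ N : ℕ, f a - f b ≤ G a - G b + (b - a) / (N + 1 : ℝ) * (g a - g b) := by
    intro N
    have := tel (N + 1) ((b - a) / (N + 1 : ℝ)) (div_nonneg (by linarith) (by positivity))
    have e : a + ((N + 1 : ℕ) : ℝ) * ((b - a) / (N + 1 : ℝ)) = b := by
      push_cast; field_simp; ring
    rwa [e] at this
  have hlim : Filter.Tendsto (fun N : ℕ => G a - G b + (b - a) / (N + 1 : ℝ) * (g a - g b))
      Filter.atTop (nhds (G a - G b + (b - a) * 0 * (g a - g b))) := by
    refine tendsto_const_nhds.add (Filter.Tendsto.mul_const _ ?_)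
    simpa [div_eq_mul_inv] using
      (tendsto_one_div_add_atTop_nhds_zero_nat (𝕜 := ℝ)).const_mul (b - a)
  have := ge_of_tendsto' hlim key
  simp only [f, G] at this
  linarith

end innerParallelVolume

theorem StieltjesFunction.le_measure_of_Ioc_le {μ : Measure ℝ} {f : StieltjesFunction ℝ}
    (h : ∀ a b, a ≤ b → μ (Ioc a b) ≤ ENNReal.ofReal (f b - f a)) : μ ≤ f.measure := by
  have h1 : μ.toOuterMeasure ≤ f.outer := by
    rw [StieltjesFunction.outer, OuterMeasure.le_ofFunction]
    intro s
    have hb : (botSet : Set ℝ) = ∅ := by simp [botSet]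
    simp only [StieltjesFunction.length, not_isEmpty_of_nonempty, if_false]
    refine le_iInf fun a => le_iInf fun b => le_iInf fun hs => ?_
    rw [hb, sdiff_empty] at hs
    rcases le_total a b with hab | hab
    · exact (measure_mono hs).trans (h a b hab)
    · rw [Ioc_eq_empty hab.not_gt, subset_empty_iff] at hs
      simp [hs]
  refine Measure.le_iff'.2 fun s => ?_
  rw [StieltjesFunction.measure]
  exact h1 s

section layerComparison
variable {n : ℕ}
local notation "E" => EuclideanSpace ℝ (Fin n)

/-- The volume of the ball of radius `(R - s)₊`, with the sign making it monotone in `s ≥ 0`. -/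
def ballStieltjes (n : ℕ) (R : ℝ) : StieltjesFunction ℝ where
  toFun s := -(volume.real (ball (0 : EuclideanSpace ℝ (Fin n)) 1) *
    (max (R - max s 0) 0) ^ n)
  mono' := fun s t hst => by
    have : max (R - max t 0) 0 ≤ max (R - max s 0) 0 := by gcongr
    have := pow_le_pow_left₀ (le_max_right _ _) this n
    have := mul_le_mul_of_nonneg_left this
      (measureReal_nonneg (μ := volume) (s := ball (0 : EuclideanSpace ℝ (Fin n)) 1))
    simpa using this
  right_continuous' := fun x => by
    refine Continuous.continuousWithinAt ?_
    fun_prop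

theorem ballStieltjes_apply (n : ℕ) (R s : ℝ) : ballStieltjes n R s =
    -(volume.real (ball (0 : EuclideanSpace ℝ (Fin n)) 1) * (max (R - max s 0) 0) ^ n) := rfl

theorem map_sub_norm_restrict_ball (hn : 1 ≤ n) (R : ℝ) :
    (volume.restrict (ball (0 : E) R)).map (fun x => R - ‖x‖) = (ballStieltjes n R).measure := by
  have : Nontrivial (EuclideanSpace ℝ (Fin n)) := by
    have : Nonempty (Fin n) := ⟨⟨0, hn⟩⟩
    infer_instance
  have hm : Measurable (fun x : E => R - ‖x‖) := by fun_prop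
  have : IsFiniteMeasure (volume.restrict (ball (0 : E) R)) := ⟨by simp [measure_ball_lt_top]⟩
  refine Measure.ext_of_Ioc _ _ fun a b hab => ?_
  rw [Measure.map_apply hm measurableSet_Ioc,
    Measure.restrict_apply (hm measurableSet_Ioc), StieltjesFunction.measure_Ioc]
  have h1 : (fun x : E => R - ‖x‖) ⁻¹' Ioc a b ∩ ball 0 R =
      ball 0 (max (R - max a 0) 0) \ ball 0 (max (R - max b 0) 0) := by
    ext x
    have := norm_nonneg x
    simp only [mem_inter_iff, mem_preimage, mem_Ioc, mem_ball_zero_iff, Set.mem_sdiff, lt_max_iff,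
      not_or, not_lt]
    constructor
    · rintro ⟨⟨h1, h2⟩, h3⟩
      refine ⟨Or.inl ?_, ?_, this⟩
      · rcases max_cases a 0 with h | h <;> linarith [h.1]
      · have := le_max_left b 0; linarith
    · rintro ⟨h1 | h1, h2, -⟩
      · have e1 := le_max_left a 0
        have e2 := le_max_right a 0
        refine ⟨⟨by linarith, ?_⟩, by linarith⟩
        rcases max_cases b 0 with h | h <;> linarith [h.1]
      · linarith
  have hle : max (R - max b 0) 0 ≤ max (R - max a 0) 0 := by gcongr
  rw [h1, measure_sdiff (ball_subset_ball hle) measurableSet_ball.nullMeasurableSet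
    measure_ball_lt_top.ne, Measure.addHaar_ball _ _ (le_max_right _ _),
    Measure.addHaar_ball _ _ (le_max_right _ _), ballStieltjes_apply, ballStieltjes_apply,
    finrank_euclideanSpace_fin, measureReal_def,
    ← ENNReal.ofReal_toReal (measure_ball_lt_top (μ := volume) (x := (0 : E)) (r := 1)).ne,
    ← ENNReal.ofReal_mul (by positivity), ← ENNReal.ofReal_mul (by positivity),
    ← ENNReal.ofReal_sub _ (by positivity), ENNReal.toReal_ofReal ENNReal.toReal_nonneg]
  congr 1; ring

variable {Ω : Set (EuclideanSpace ℝ (Fin n))} {R : ℝ}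

theorem map_infDist_le (hn : 2 ≤ n) (hΩ : IsOpenConvexBody Ω) (hR : 0 < R)
    (hap : HasApproxPerimeterLE Ω R) :
    (volume.restrict Ω).map (fun x => infDist x Ωᶜ) ≤
      (volume.restrict (ball (0 : E) R)).map (fun x => R - ‖x‖) := by
  have hn1 : 1 ≤ n := by omega
  rw [map_sub_norm_restrict_ball hn1]
  refine StieltjesFunction.le_measure_of_Ioc_le fun a b hab => ?_
  have hm : Measurable (fun x : E => infDist x Ωᶜ) := measurable_infDist
  rw [Measure.map_apply hm measurableSet_Ioc, Measure.restrict_apply (hm measurableSet_Ioc)]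
  have h1 : (fun x : E => infDist x Ωᶜ) ⁻¹' Ioc a b ∩ Ω =
      innerParallel Ω (max a 0) \ innerParallel Ω (max b 0) := by
    nth_rewrite 2 [← hΩ.innerParallel_zero hn1]
    ext x
    simp only [innerParallel, mem_inter_iff, mem_preimage, mem_Ioc, Set.mem_sdiff, mem_ofPred_eq,
      max_lt_iff]
    constructor
    · rintro ⟨⟨h1, h2⟩, h3⟩; exact ⟨⟨h1, h3⟩, fun h => h2.not_gt h.1⟩
    · rintro ⟨⟨h1, h2⟩, h3⟩
      exact ⟨⟨h1, not_lt.1 fun h => h3 ⟨h, h2⟩⟩, h2⟩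
  have hle : max a 0 ≤ max b 0 := by gcongr
  have h2 := real_innerParallel_sub_le_pow hn hΩ hR hap (le_max_right a 0) hle
  have hA := hΩ.innerParallel hn1 (le_max_right a 0)
  have hB := hΩ.innerParallel hn1 (le_max_right b 0)
  rw [h1, ← ENNReal.ofReal_toReal
    (measure_ne_top_of_subset sdiff_subset hA.volume_ne_top), ← measureReal_def,
    measureReal_sdiff (innerParallel_anti Ω hle) hB.isOpen.measurableSet hA.volume_ne_top]
  refine ENNReal.ofReal_le_ofReal (h2.trans_eq ?_)
  rw [ballStieltjes_apply, ballStieltjes_apply]; ring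

theorem lintegral_sub_infDist_le (hn : 2 ≤ n) (hΩ : IsOpenConvexBody Ω) (hR : 0 < R)
    (hap : HasApproxPerimeterLE Ω R) {w : ℝ → ℝ≥0∞} (hw : Measurable w) :
    ∫⁻ x in Ω, w (R - infDist x Ωᶜ) ≤ ∫⁻ x in ball (0 : E) R, w ‖x‖ := by
  have hm : Measurable (fun x : E => infDist x Ωᶜ) := measurable_infDist
  have hw' : Measurable fun t => w (R - t) := hw.comp (by fun_prop)
  have := lintegral_mono' (map_infDist_le hn hΩ hR hap) (le_refl fun t => w (R - t))
  rw [lintegral_map hw' hm, lintegral_map hw' (by fun_prop)] at this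
  simpa using this

end layerComparison

section zonoidApprox
variable {n : ℕ}
local notation "E" => EuclideanSpace ℝ (Fin n)

/-- The support function of the zonotope `zono u 1`. -/
def zonoSupport {ι : Type*} [Fintype ι] (u : ι → EuclideanSpace ℝ (Fin n))
    (ν : EuclideanSpace ℝ (Fin n)) : ℝ := ∑ i, max (inner ℝ (u i) ν) 0

theorem zonoSupport_smul {ι : Type*} [Fintype ι] (u : ι → E) (ν : E) {r : ℝ} (hr : 0 ≤ r) :
    zonoSupport u (r • ν) = r * zonoSupport u ν := by
  simp only [zonoSupport, Finset.mul_sum]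
  refine Finset.sum_congr rfl fun i _ => ?_
  rw [inner_smul_right, mul_max_of_nonneg _ _ hr, mul_zero]

theorem le_zonoSupport_of_unit {ι : Type*} [Fintype ι] {u : ι → E} {c : ℝ}
    (h : ∀ ν : E, ‖ν‖ = 1 → c ≤ zonoSupport u ν) (x : E) : c * ‖x‖ ≤ zonoSupport u x := by
  rcases eq_or_ne x 0 with rfl | hx
  · simp [zonoSupport]
  have h1 := h (‖x‖⁻¹ • x) (by rw [norm_smul, norm_inv, norm_norm, inv_mul_cancel₀ (by simpa)])
  have hx' := norm_pos_iff.2 hx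
  rw [zonoSupport_smul _ _ (by positivity)] at h1
  have h2 := mul_le_mul_of_nonneg_right h1 hx'.le
  have : ‖x‖⁻¹ * zonoSupport u x * ‖x‖ = zonoSupport u x := by field_simp
  linarith

theorem zonoSupport_le_of_unit {ι : Type*} [Fintype ι] {u : ι → E} {c : ℝ}
    (h : ∀ ν : E, ‖ν‖ = 1 → zonoSupport u ν ≤ c) (x : E) : zonoSupport u x ≤ c * ‖x‖ := by
  rcases eq_or_ne x 0 with rfl | hx
  · simp [zonoSupport]
  have h1 := h (‖x‖⁻¹ • x) (by rw [norm_smul, norm_inv, norm_norm, inv_mul_cancel₀ (by simpa)])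
  have hx' := norm_pos_iff.2 hx
  rw [zonoSupport_smul _ _ (by positivity)] at h1
  have h2 := mul_le_mul_of_nonneg_right h1 hx'.le
  have : ‖x‖⁻¹ * zonoSupport u x * ‖x‖ = zonoSupport u x := by field_simp
  linarith

theorem zono_subset_closedBall {ι : Type*} [Fintype ι] {u : ι → E}
    (h : ∀ ν : E, ‖ν‖ = 1 → zonoSupport u ν ≤ 1) : zono u 1 ⊆ closedBall 0 1 := by
  intro x hx
  obtain ⟨τ, hτ0, hτ1, hx'⟩ := mem_zono.1 hx
  rw [mem_closedBall_zero_iff]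
  have h1 : inner ℝ x x ≤ zonoSupport u x := by
    nth_rewrite 1 [← hx']
    rw [sum_inner]
    refine Finset.sum_le_sum fun i _ => ?_
    rw [inner_smul_left]
    have h0 : 0 ≤ max (inner ℝ (u i) x) 0 := le_max_right _ _
    calc (starRingEnd ℝ) (τ i) * inner ℝ (u i) x ≤ τ i * max (inner ℝ (u i) x) 0 :=
          mul_le_mul_of_nonneg_left (le_max_left _ _) (hτ0 i)
      _ ≤ 1 * max (inner ℝ (u i) x) 0 := mul_le_mul_of_nonneg_right (hτ1 i) h0
      _ = _ := one_mul _
  rw [real_inner_self_eq_norm_sq] at h1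
  have h2 := zonoSupport_le_of_unit h x
  by_contra hcon
  push Not at hcon
  nlinarith

theorem closedBall_subset_zono {ι : Type*} [Fintype ι] {u : ι → E} {c : ℝ}
    (h : ∀ ν : E, ‖ν‖ = 1 → c ≤ zonoSupport u ν) : closedBall 0 c ⊆ zono u 1 := by
  intro y hy
  by_contra hcon
  obtain ⟨f, s, hs, hs'⟩ := geometric_hahn_banach_closed_point (convex_zono u 1)
    (isCompact_zono u 1).isClosed hcon
  set w := (InnerProductSpace.toDual ℝ E).symm f with hw
  have hf : ∀ z, f z = inner ℝ z w := fun z => by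
    rw [real_inner_comm, hw, InnerProductSpace.toDual_symm_apply]
  have h1 : zonoSupport u w < s := by
    classical
    have := hs (∑ i, (if 0 ≤ inner ℝ (u i) w then (1 : ℝ) else 0) • u i)
      (mem_zono.2 ⟨fun i => if 0 ≤ inner ℝ (u i) w then (1 : ℝ) else 0,
        fun i => by dsimp only; split_ifs <;> simp,
        fun i => by dsimp only; split_ifs <;> simp, rfl⟩)
    refine lt_of_eq_of_lt ?_ this
    rw [hf, sum_inner]
    refine Finset.sum_congr rfl fun i _ => ?_
    split_ifs with hi
    · simp [hi]
    · simp [(not_le.1 hi).le]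
  have h2 : f y ≤ c * ‖w‖ := by
    rw [hf]
    refine (real_inner_le_norm y w).trans ?_
    gcongr
    simpa using hy
  linarith [le_zonoSupport_of_unit h w]

theorem exists_zonoSupport_near (hn : 1 ≤ n) {ε : ℝ} (hε : 0 < ε) (hε1 : ε < 1) :
    ∃ (ι : Type) (_ : Fintype ι) (_ : Nonempty ι) (u : ι → E), (∀ i, u i ≠ 0) ∧
      ∀ ν : E, ‖ν‖ = 1 → 1 - ε ≤ zonoSupport u ν ∧ zonoSupport u ν ≤ 1 := by
  classical
  have hne : Nonempty (Fin n) := ⟨⟨0, hn⟩⟩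
  set μ : Measure E := volume.restrict (ball 0 1) with hμ
  have : IsFiniteMeasure μ := ⟨by simp [hμ, measure_ball_lt_top]⟩
  let φ : E → E → ℝ := fun ν x => max (inner ℝ x ν) 0
  have hφc : ∀ ν, Continuous (φ ν) := fun ν => by fun_prop
  have hφl : ∀ ν x y : E, ‖ν‖ = 1 → |φ ν x - φ ν y| ≤ ‖x - y‖ := by
    intro ν x y hν
    refine (abs_max_sub_max_le_abs _ _ _).trans ?_
    rw [← inner_sub_left]
    simpa [hν] using abs_real_inner_le_norm (x - y) ν
  have hid : Integrable (fun x : E => x) μ := by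
    refine Measure.integrableOn_of_bounded (M := 1) measure_ball_lt_top.ne
      aestronglyMeasurable_id ?_
    filter_upwards [ae_restrict_mem measurableSet_ball] with x hx
    simpa using (mem_ball_zero_iff.1 hx).le
  have hφi : ∀ ν g, ‖ν‖ = 1 → Integrable g μ → Integrable (fun x => φ ν (g x)) μ := by
    intro ν g hν hg
    refine hg.norm.mono ((hφc ν).comp_aestronglyMeasurable hg.1) (.of_forall fun x => ?_)
    have := hφl ν (g x) 0 hν
    simpa [φ] using this
  obtain ⟨e₀, he₀⟩ : ∃ e : E, ‖e‖ = 1 := exists_norm_eq E zero_le_one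
  set κ := ∫ x, φ e₀ x ∂μ with hκ
  have hκν : ∀ ν : E, ‖ν‖ = 1 → ∫ x, φ ν x ∂μ = κ := by
    intro ν hν
    let T := (Submodule.span ℝ {e₀ - ν})ᗮ.reflection
    have hT : T e₀ = ν := Submodule.reflection_sub (by rw [he₀, hν])
    have h1 := T.measurePreserving.setIntegral_preimage_emb
      T.toHomeomorph.measurableEmbedding (φ ν) (ball 0 1)
    have h2 : T ⁻¹' ball 0 1 = ball 0 1 := by
      ext x; simp
    rw [h2] at h1
    rw [hκ, hμ, ← h1]
    refine integral_congr_ae (.of_forall fun x => ?_)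
    simp only [φ]
    rw [← hT, LinearIsometryEquiv.inner_map_map]
  have hκ0 : 0 < κ := by
    rw [hκ, integral_pos_iff_support_of_nonneg (f := φ e₀) (fun x => le_max_right _ _) (hφi e₀ _ he₀ hid),
      hμ, Measure.restrict_apply]
    · have h1 : IsOpen {x : E | 0 < inner ℝ x e₀} :=
        isOpen_lt continuous_const (by fun_prop)
      refine lt_of_lt_of_le ((h1.inter isOpen_ball).measure_pos volume ⟨(1 / 2 : ℝ) • e₀, ?_, ?_⟩)
        (measure_mono (inter_subset_inter_left (ball (0 : E) 1) ?_))
      · simp [inner_smul_left, he₀]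
      · rw [mem_ball_zero_iff, norm_smul, he₀]; norm_num
      · rintro x (hx : 0 < inner ℝ x e₀)
        rw [Function.mem_support]
        exact (lt_max_of_lt_left hx).ne'
    · exact (hφc e₀).measurable (measurableSet_singleton 0).compl
  set δ := κ * ε / 2 with hδ
  have hδ0 : 0 < δ := by positivity
  obtain ⟨g, hg, hgm⟩ := (memLp_one_iff_integrable.2 hid).exists_simpleFunc_eLpNorm_sub_lt
    ENNReal.one_ne_top (ε := ENNReal.ofReal δ) (by simpa using hδ0)
  have hgi : Integrable g μ := memLp_one_iff_integrable.1 hgm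
  have hgd : ∫ x, ‖x - g x‖ ∂μ ≤ δ := by
    rw [eLpNorm_one_eq_lintegral_enorm] at hg
    have h0 := integral_norm_eq_lintegral_enorm (hid.sub hgi).1
    simp only [Pi.sub_apply] at h0
    rw [h0]
    exact ENNReal.toReal_le_of_le_ofReal hδ0.le hg.le
  have hclose : ∀ ν : E, ‖ν‖ = 1 → |κ - ∫ x, φ ν (g x) ∂μ| ≤ δ := by
    intro ν hν
    rw [← hκν ν hν, ← integral_sub (hφi ν _ hν hid) (hφi ν _ hν hgi)]
    refine (abs_integral_le_integral_abs).trans (le_trans ?_ hgd)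
    exact integral_mono ((hφi ν _ hν hid).sub (hφi ν _ hν hgi)).abs (hid.sub hgi).norm
      fun x => hφl ν x (g x) hν
  have hsum : ∀ ν : E, ‖ν‖ = 1 → ∫ x, φ ν (g x) ∂μ =
      ∑ y ∈ g.range, μ.real (g ⁻¹' {y}) * φ ν y := by
    intro ν hν
    have h1 := g.map_integral (φ ν) hgi (by simp [φ])
    have h2 := SimpleFunc.integral_eq_integral (g.map (φ ν)) (hφi ν _ hν hgi)
    rw [h1] at h2
    simpa using h2.symm
  -- discard the vanishing vectors
  let c : E → E := fun y => (μ.real (g ⁻¹' {y}) / (κ + δ)) • y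
  let S : Finset E := g.range.filter fun y => c y ≠ 0
  have hS : ∀ ν : E, ‖ν‖ = 1 → zonoSupport (fun y : S => c y) ν =
      (∫ x, φ ν (g x) ∂μ) / (κ + δ) := by
    intro ν hν
    rw [hsum ν hν, zonoSupport, Finset.sum_coe_sort S (fun y => max (inner ℝ (c y) ν) 0),
      Finset.sum_filter_of_ne, Finset.sum_div]
    · refine Finset.sum_congr rfl fun y _ => ?_
      simp only [c, φ]
      rw [inner_smul_left, mul_div_right_comm, mul_max_of_nonneg _ _ (by positivity)]
      simp
    · intro y _ hy h0
      simp [h0] at hy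
  have hfin : ∀ ν : E, ‖ν‖ = 1 → 1 - ε ≤ zonoSupport (fun y : S => c y) ν ∧
      zonoSupport (fun y : S => c y) ν ≤ 1 := by
    intro ν hν
    have h1 := abs_le.1 (hclose ν hν)
    rw [hS ν hν, div_le_one (by positivity), le_div_iff₀ (by positivity)]
    refine ⟨?_, by linarith⟩
    have : (1 - ε) * (κ + δ) ≤ κ - δ := by
      rw [hδ]; nlinarith [mul_pos hκ0 hε, mul_pos (mul_pos hκ0 hε) hε]
    linarith
  refine ⟨S, inferInstance, ?_, fun y => c y, fun y => (Finset.mem_filter.1 y.2).2, hfin⟩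
  by_contra hemp
  rw [not_nonempty_iff] at hemp
  have h1 := (hfin e₀ he₀).1
  simp only [zonoSupport, Finset.univ_eq_empty, Finset.sum_empty] at h1
  linarith

end zonoidApprox

section prism
variable {n : ℕ}
local notation "E" => EuclideanSpace ℝ (Fin n)

theorem volume_image_add_smul {ν : E} (hν : ‖ν‖ = 1) {S : Set E}
    (hS : ∀ y ∈ S, inner ℝ ν y = 0) (T : Set ℝ) :
    volume ((fun q : E × ℝ => q.1 + q.2 • ν) '' (S ×ˢ T)) = volume T * μHE[n - 1] S := by
  have hν0 : ν ≠ 0 := by rintro rfl; simp at hν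
  set s := Submodule.span ℝ {ν} with hs
  let I : Set s := (LinearIsometryEquiv.toSpanUnitSingleton ν hν) '' T
  let S' : Set sᗮ := Subtype.val ⁻¹' S
  have hfr : Module.finrank ℝ sᗮ = n - 1 := by
    have h1 := Submodule.finrank_add_finrank_orthogonal s
    rw [finrank_span_singleton hν0, finrank_euclideanSpace_fin] at h1
    omega
  have h1 : volume I = volume T := by
    set e := LinearIsometryEquiv.toSpanUnitSingleton (𝕜 := ℝ) ν hν
    rw [← e.symm.measurePreserving.measure_preimage_equiv (f := e.symm.toHomeomorph.toMeasurableEquiv) T]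
    congr 1
    exact e.toEquiv.image_eq_preimage_symm T
  have h2 : volume S' = μHE[n - 1] S := by
    rw [← InnerProductSpace.euclideanHausdorffMeasure_eq_volume, hfr,
      ← isometry_subtype_coe.euclideanHausdorffMeasure_image]
    congr 1
    refine (Subtype.image_preimage_coe _ _).trans (inter_eq_right.2 ?_)
    intro y hy
    exact Submodule.mem_orthogonal_singleton_iff_inner_right.2 (hS y hy)
  have h3 : (fun q : E × ℝ => q.1 + q.2 • ν) '' (S ×ˢ T) =
      (s.measurableEquivProd (0 : E)) ⁻¹' (I ×ˢ S') := by
    rw [← MeasurableEquiv.image_symm]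
    ext x
    constructor
    · rintro ⟨⟨y, t⟩, ⟨hy, ht⟩, rfl⟩
      refine ⟨⟨⟨t • ν, Submodule.smul_mem _ _ (Submodule.mem_span_singleton_self ν)⟩,
        ⟨y, Submodule.mem_orthogonal_singleton_iff_inner_right.2 (hS y hy)⟩⟩,
        ⟨⟨t, ht, ?_⟩, hy⟩, ?_⟩
      · ext; simp
      · rw [Submodule.measurableEquivProd_symm_apply]; simp [add_comm]
    · rintro ⟨⟨a, b⟩, ⟨⟨t, ht, rfl⟩, hb⟩, rfl⟩
      refine ⟨⟨b, t⟩, ⟨hb, ht⟩, ?_⟩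
      rw [Submodule.measurableEquivProd_symm_apply]; simp [add_comm]
  have h4 := (s.measurePreserving_measurableEquivProd (0 : E)).measure_preimage_equiv (I ×ˢ S')
  rw [InnerProductSpace.euclideanHausdorffMeasure_eq_volume, ← h3, Measure.volume_eq_prod,
    Measure.prod_prod, h1, h2] at h4
  exact h4

end prism

section almostFlat
variable {n : ℕ}
local notation "E" => EuclideanSpace ℝ (Fin n)

theorem norm_sub_inner_smul_le {ν : E} (hν : ‖ν‖ = 1) (z : E) : ‖z - inner ℝ ν z • ν‖ ≤ ‖z‖ := by
  refine le_of_sq_le_sq ?_ (norm_nonneg z)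
  have h := norm_sub_sq_real z (inner ℝ ν z • ν)
  rw [inner_smul_right, norm_smul, hν, real_inner_comm ν z, mul_one, Real.norm_eq_abs, sq_abs] at h
  rw [h]
  nlinarith [sq_nonneg (inner ℝ ν z)]

theorem euclideanHausdorffMeasure_image_le_of_lipschitz {X Y : Type*} [MetricSpace X]
    [MeasurableSpace X] [BorelSpace X] [MetricSpace Y] [MeasurableSpace Y] [BorelSpace Y]
    {f : X → Y} {s : Set X} {K : ℝ≥0} (h : LipschitzOnWith K f s) (d : ℕ) :
    μHE[d] (f '' s) ≤ (K : ℝ≥0∞) ^ d * μHE[d] s := by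
  rw [Measure.euclideanHausdorffMeasure_def, Measure.euclideanHausdorffMeasure_def,
    Measure.smul_apply, Measure.smul_apply, ENNReal.smul_def, ENNReal.smul_def, smul_eq_mul,
    smul_eq_mul, mul_left_comm]
  gcongr
  simpa using h.hausdorffMeasure_image_le (Nat.cast_nonneg d)

/-- A set which is almost contained in a hyperplane `ν^⊥` sweeps a prism of volume at most about
its area times the height of the prism. -/
theorem eventually_volume_add_seg_le {ν : E} (hν : ‖ν‖ = 1) (u : E) {ε : ℝ} (hε : 0 < ε) :
    ∀ᶠ δ : ℝ in nhdsWithin 0 (Ioi 0), ∀ A : Set E,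
      (∀ a ∈ A, ∀ b ∈ A, |inner ℝ ν (a - b)| ≤ δ * ‖a - b‖) →
      volume (A + seg u 1) ≤ ENNReal.ofReal (|inner ℝ ν u| + ε) * μHE[n - 1] A := by
  let P : E → E := fun z => z - inner ℝ ν z • ν
  let φ : Module.Dual ℝ E := (innerSL ℝ ν).toLinearMap
  let T : E →L[ℝ] E := LinearMap.toContinuousLinearMap (LinearMap.transvection φ (u - ν))
  have hT : ∀ z, T z = P z + inner ℝ ν z • u := by
    intro z
    simp only [T, P, φ, LinearMap.coe_toContinuousLinearMap', LinearMap.transvection.apply,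
      ContinuousLinearMap.coe_coe, innerSL_apply_apply, smul_sub]
    abel
  have hdet : T.det = inner ℝ ν u := by
    simp only [T, LinearMap.det_toContinuousLinearMap, LinearMap.transvection.det, φ,
      ContinuousLinearMap.coe_coe, innerSL_apply_apply, inner_sub_right, real_inner_self_eq_norm_sq,
      hν]
    ring
  have hm : ENNReal.ofReal |T.det| < (Real.toNNReal (|inner ℝ ν u| + ε) : ℝ≥0∞) := by
    rw [hdet, ← ENNReal.ofReal, ENNReal.ofReal_lt_ofReal_iff (by positivity)]
    linarith
  obtain ⟨c, hc, hc0⟩ := ((addHaar_image_le_mul_of_det_lt (volume : Measure E) T hm).and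
    self_mem_nhdsWithin).exists
  have hc0' : (0 : ℝ) < c := hc0
  filter_upwards [Ioo_mem_nhdsGT (show (0 : ℝ) < min (c / 2) (1 / 2) by positivity)] with δ hδ A hA
  have hδ0 := hδ.1
  have hδ1 : δ ≤ c / 2 := hδ.2.le.trans (min_le_left _ _)
  have hδ2 : δ ≤ 1 / 2 := hδ.2.le.trans (min_le_right _ _)
  have hPsub : ∀ x y, P x - P y = P (x - y) := by
    intro x y; simp only [P, inner_sub_right, sub_smul]; abel
  have hPle : ∀ z, ‖P z‖ ≤ ‖z‖ := norm_sub_inner_smul_le hν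
  have hAP : ∀ a ∈ A, ∀ b ∈ A, ‖a - b‖ ≤ 2 * ‖P (a - b)‖ := by
    intro a ha b hb
    have h1 : a - b = P (a - b) + inner ℝ ν (a - b) • ν := by simp [P]
    have h2 : ‖a - b‖ ≤ ‖P (a - b)‖ + |inner ℝ ν (a - b)| := by
      nth_rewrite 1 [h1]
      refine (norm_add_le _ _).trans_eq ?_
      rw [norm_smul, hν, mul_one, Real.norm_eq_abs]
    have h3 := hA a ha b hb
    nlinarith [norm_nonneg (a - b)]
  have hinj : InjOn P A := by
    intro a ha b hb hab
    have h1 := hAP a ha b hb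
    rw [← hPsub, hab, sub_self, norm_zero, mul_zero] at h1
    exact sub_eq_zero.1 (norm_le_zero_iff.1 h1)
  set G : Set E := (fun q : E × ℝ => q.1 + q.2 • ν) '' ((P '' A) ×ˢ Icc 0 1) with hG
  have hPν : ∀ z, inner ℝ ν (P z) = 0 := by
    intro z
    simp only [P, inner_sub_right, inner_smul_right, real_inner_self_eq_norm_sq, hν]; ring
  have hPν' : ∀ (z : E) (t : ℝ), P (P z + t • ν) = P z := by
    intro z t
    simp only [P, inner_add_right, inner_sub_right, inner_smul_right, real_inner_self_eq_norm_sq,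
      hν, one_pow, mul_one, sub_self, zero_add]
    abel
  let f : E → E := fun x => Function.invFunOn P A (P x) + inner ℝ ν x • u
  have hf : ∀ a ∈ A, ∀ t : ℝ, f (P a + t • ν) = a + t • u := by
    intro a ha t
    simp only [f]
    rw [hPν', hinj.leftInvOn_invFunOn ha, inner_add_right, hPν, inner_smul_right,
      real_inner_self_eq_norm_sq, hν]
    simp
  have happ : ApproximatesLinearOn f T G c := by
    rintro _ ⟨⟨_, t⟩, ⟨⟨a, ha, rfl⟩, ht⟩, rfl⟩ _ ⟨⟨_, t'⟩, ⟨⟨b, hb, rfl⟩, ht'⟩, rfl⟩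
    simp only
    rw [hf a ha, hf b hb, map_sub, hT, hT, hPν', hPν', inner_add_right, inner_add_right, hPν, hPν]
    simp only [inner_smul_right, real_inner_self_eq_norm_sq, hν, one_pow, mul_one, zero_add]
    have e1 : a + t • u - (b + t' • u) - (P a + t • u - (P b + t' • u)) =
        inner ℝ ν (a - b) • ν := by
      simp only [P, inner_sub_right, sub_smul]; abel
    have e2 : P (a - b) = P (P a + t • ν - (P b + t' • ν)) := by
      rw [← hPsub (P a + t • ν), hPν', hPν', hPsub]
    rw [e1, norm_smul, hν, mul_one, Real.norm_eq_abs]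
    have h1 := hA a ha b hb
    have h2 := hAP a ha b hb
    have h3 := hPle (P a + t • ν - (P b + t' • ν))
    rw [← e2] at h3
    nlinarith [norm_nonneg (a - b), norm_nonneg (P (a - b))]
  have himage : A + seg u 1 ⊆ f '' G := by
    rintro _ ⟨a, ha, _, ⟨t, ht, rfl⟩, rfl⟩
    exact ⟨P a + t • ν, ⟨⟨P a, t⟩, ⟨⟨a, ha, rfl⟩, ht⟩, rfl⟩, hf a ha t⟩
  have hG' : volume G = μHE[n - 1] (P '' A) := by
    rw [hG, volume_image_add_smul hν (by rintro _ ⟨a, -, rfl⟩; exact hPν a)]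
    simp
  have hPA : μHE[n - 1] (P '' A) ≤ μHE[n - 1] A := by
    have hlip : LipschitzOnWith 1 P A := LipschitzOnWith.of_dist_le_mul fun x _ y _ => by
      rw [dist_eq_norm, dist_eq_norm, hPsub, NNReal.coe_one, one_mul]
      exact hPle _
    simpa using euclideanHausdorffMeasure_image_le_of_lipschitz hlip (n - 1)
  calc volume (A + seg u 1) ≤ volume (f '' G) := measure_mono himage
    _ ≤ Real.toNNReal (|inner ℝ ν u| + ε) * volume G := hc G f happ
    _ ≤ _ := by
      rw [hG', ENNReal.ofReal]
      gcongr

end almostFlat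

section surface
variable {n : ℕ}
local notation "E" => EuclideanSpace ℝ (Fin n)

/-- `ν` is a unit outer normal of `Ω` at `a`. -/
def IsOuterNormal (Ω : Set (EuclideanSpace ℝ (Fin n))) (a ν : EuclideanSpace ℝ (Fin n)) : Prop :=
  ‖ν‖ = 1 ∧ ∀ x ∈ Ω, inner ℝ ν (x - a) ≤ 0

variable {Ω : Set (EuclideanSpace ℝ (Fin n))}

theorem IsOuterNormal.inner_le_of_mem_closure {a ν b : E} (h : IsOuterNormal Ω a ν)
    (hb : b ∈ closure Ω) : inner ℝ ν (b - a) ≤ 0 := by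
  have hcl : IsClosed {x : E | inner ℝ ν (x - a) ≤ 0} :=
    isClosed_le (by fun_prop) continuous_const
  exact closure_minimal h.2 hcl hb

theorem IsOpenConvexBody.exists_isOuterNormal (hΩ : IsOpenConvexBody Ω) (hne : Ω.Nonempty) {a : E}
    (ha : a ∉ Ω) : ∃ ν, IsOuterNormal Ω a ν := by
  obtain ⟨f, hf⟩ := geometric_hahn_banach_open_point hΩ.convex hΩ.isOpen ha
  set w := (InnerProductSpace.toDual ℝ E).symm f with hw
  have hfw : ∀ z, f z = inner ℝ w z := fun z => by
    rw [hw, InnerProductSpace.toDual_symm_apply]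
  have hw0 : 0 < ‖w‖ := by
    rw [norm_pos_iff]
    intro h0
    obtain ⟨x, hx⟩ := hne
    have := hf x hx
    simp [hfw, h0] at this
  refine ⟨‖w‖⁻¹ • w, ?_, fun x hx => ?_⟩
  · rw [norm_smul, norm_inv, norm_norm, inv_mul_cancel₀ hw0.ne']
  · rw [real_inner_smul_left, inner_sub_right, ← hfw, ← hfw]
    have := hf x hx
    exact mul_nonpos_of_nonneg_of_nonpos (by positivity) (by linarith)

/-- The boundary points having an outer normal at distance at most `δ` of `ν`. -/
def normalPiece (Ω : Set (EuclideanSpace ℝ (Fin n))) (ν : EuclideanSpace ℝ (Fin n)) (δ : ℝ) :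
    Set (EuclideanSpace ℝ (Fin n)) :=
  {a ∈ frontier Ω | ∃ μ, IsOuterNormal Ω a μ ∧ ‖μ - ν‖ ≤ δ}

theorem isClosed_normalPiece (hΩ : IsBounded Ω) (ν : E) (δ : ℝ) :
    IsClosed (normalPiece Ω ν δ) := by
  have hK : IsCompact (frontier Ω ×ˢ sphere (0 : E) 1) :=
    (isCompact_of_isClosed_isBounded isClosed_frontier (hΩ.closure.subset
      frontier_subset_closure)).prod (isCompact_sphere 0 1)
  have hC : IsClosed {q : E × E | (∀ x ∈ Ω, inner ℝ q.2 (x - q.1) ≤ 0) ∧ ‖q.2 - ν‖ ≤ δ} := by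
    refine IsClosed.inter (s₂ := {q : E × E | ‖q.2 - ν‖ ≤ δ}) ?_
      (isClosed_le (by fun_prop) continuous_const)
    have h : {q : E × E | ∀ x ∈ Ω, inner ℝ q.2 (x - q.1) ≤ 0} =
        ⋂ x ∈ Ω, {q : E × E | inner ℝ q.2 (x - q.1) ≤ 0} := by ext; simp
    change IsClosed {q : E × E | ∀ x ∈ Ω, inner ℝ q.2 (x - q.1) ≤ 0}
    rw [h]
    exact isClosed_biInter fun x _ => isClosed_le (by fun_prop) continuous_const
  have h : normalPiece Ω ν δ = Prod.fst '' ((frontier Ω ×ˢ sphere (0 : E) 1) ∩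
      {q : E × E | (∀ x ∈ Ω, inner ℝ q.2 (x - q.1) ≤ 0) ∧ ‖q.2 - ν‖ ≤ δ}) := by
    ext a
    constructor
    · rintro ⟨ha, μ, ⟨hμ1, hμ2⟩, hμ3⟩
      exact ⟨(a, μ), ⟨⟨ha, by simpa using hμ1⟩, hμ2, hμ3⟩, rfl⟩
    · rintro ⟨⟨a, μ⟩, ⟨⟨ha, hμ⟩, hμ2, hμ3⟩, rfl⟩
      exact ⟨ha, μ, ⟨by simpa using hμ, hμ2⟩, hμ3⟩
  rw [h]
  exact ((hK.inter_right hC).image continuous_fst).isClosed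

theorem abs_inner_le_of_mem_normalPiece {ν : E} {δ : ℝ} {a b : E} (ha : a ∈ normalPiece Ω ν δ)
    (hb : b ∈ normalPiece Ω ν δ) : |inner ℝ ν (a - b)| ≤ δ * ‖a - b‖ := by
  have key : ∀ a b : E, a ∈ normalPiece Ω ν δ → b ∈ normalPiece Ω ν δ →
      inner ℝ ν (a - b) ≤ δ * ‖a - b‖ := by
    rintro a b ⟨ha, -⟩ ⟨-, μ, hμ, hμν⟩
    have h1 := hμ.inner_le_of_mem_closure (frontier_subset_closure ha)
    have h2 := real_inner_le_norm (ν - μ) (a - b)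
    rw [inner_sub_left, norm_sub_rev ν μ] at h2
    have h3 : ‖μ - ν‖ * ‖a - b‖ ≤ δ * ‖a - b‖ := by gcongr
    linarith
  refine abs_le.2 ⟨?_, key a b ha hb⟩
  have := key b a hb ha
  rw [norm_sub_rev b a, ← neg_sub a b, inner_neg_right] at this
  linarith

/-- The boundary points where the direction `u` points out of `Ω`. -/
def exitSet (Ω : Set (EuclideanSpace ℝ (Fin n))) (u : EuclideanSpace ℝ (Fin n)) :
    Set (EuclideanSpace ℝ (Fin n)) := {a | ∃ s : ℝ, 0 < s ∧ a - s • u ∈ Ω}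

theorem add_seg_sdiff_subset (hΩ : IsOpen Ω) (u : E) :
    (Ω + seg u 1) \ Ω ⊆ (frontier Ω ∩ exitSet Ω u) + seg u 1 := by
  rintro y ⟨hy, hyΩ⟩
  obtain ⟨x, hx, _, ⟨t, ht, rfl⟩, rfl⟩ := hy
  have hpre : IsPreconnected ((fun s : ℝ => x + s • u) '' Icc 0 t) :=
    isPreconnected_Icc.image _ (by fun_prop)
  obtain ⟨s, hs, hz⟩ : ∃ s ∈ Icc 0 t, x + s • u ∈ frontier Ω := by
    by_contra! hcon
    have hsub : (fun s : ℝ => x + s • u) '' Icc 0 t ⊆ Ω ∪ (closure Ω)ᶜ := by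
      rintro _ ⟨s, hs, rfl⟩
      have := hcon s hs
      rw [hΩ.frontier_eq] at this
      by_cases h : x + s • u ∈ Ω
      · exact Or.inl h
      · exact Or.inr fun h' => this ⟨h', h⟩
    obtain ⟨z, -, hz1, hz2⟩ := hpre Ω (closure Ω)ᶜ hΩ isClosed_closure.isOpen_compl hsub
      ⟨x, ⟨0, ⟨le_rfl, ht.1⟩, by simp⟩, hx⟩
      ⟨x + t • u, ⟨t, ⟨ht.1, le_rfl⟩, rfl⟩, (hsub ⟨t, ⟨ht.1, le_rfl⟩, rfl⟩).resolve_left hyΩ⟩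
    exact hz2 (subset_closure hz1)
  have hs0 : 0 < s := by
    refine lt_of_le_of_ne hs.1 ?_
    rintro rfl
    rw [zero_smul, add_zero, hΩ.frontier_eq] at hz
    exact hz.2 hx
  refine ⟨x + s • u, ⟨hz, s, hs0, by simpa using hx⟩, (t - s) • u,
    ⟨t - s, ⟨sub_nonneg.2 hs.2, by linarith [ht.2]⟩, rfl⟩, ?_⟩
  simp only [sub_smul]; abel

theorem neg_le_inner_of_mem {ν u : E} {δ : ℝ} {a : E} (ha : a ∈ normalPiece Ω ν δ)
    (hu : a ∈ exitSet Ω u) : -(δ * ‖u‖) ≤ inner ℝ ν u := by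
  obtain ⟨-, μ, hμ, hμν⟩ := ha
  obtain ⟨s, hs, hs'⟩ := hu
  have h1 := hμ.2 _ hs'
  rw [sub_sub_cancel_left, inner_neg_right, real_inner_smul_right] at h1
  have h2 : 0 ≤ inner ℝ μ u := by
    by_contra hcon
    push Not at hcon
    nlinarith
  have h3 := real_inner_le_norm (μ - ν) u
  rw [inner_sub_left] at h3
  have h4 : ‖μ - ν‖ * ‖u‖ ≤ δ * ‖u‖ := by gcongr
  linarith

theorem ofReal_zonoGrowth_le {ι : Type*} [Fintype ι] (hΩ : IsOpenConvexBody Ω)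
    (hne : Ω.Nonempty) (u : ι → E) (hu : ∀ ν : E, ‖ν‖ = 1 → zonoSupport u ν ≤ 1) {ε : ℝ}
    (hε : 0 < ε) :
    ENNReal.ofReal (zonoGrowth u Ω) ≤ ENNReal.ofReal (1 + ε) * μHE[n - 1] (frontier Ω) := by
  classical
  obtain ⟨k, hk⟩ : ∃ k : ℝ, k = (Fintype.card ι : ℝ) := ⟨_, rfl⟩
  have hk0 : 0 ≤ k := hk ▸ Nat.cast_nonneg _
  set ε₁ := ε / (2 * k + 1) with hε₁
  have hε₁0 : 0 < ε₁ := by positivity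
  have hkε : k * (2 * ε₁) ≤ ε := by
    rw [hε₁]
    have : k * (2 * (ε / (2 * k + 1))) = ε * ((2 * k) / (2 * k + 1)) := by ring
    rw [this]
    exact mul_le_of_le_one_right hε.le ((div_le_one (by positivity)).2 (by linarith))
  have hloc : ∀ ν : E, ‖ν‖ = 1 → ∃ δ : ℝ, 0 < δ ∧ ∀ i, δ * ‖u i‖ ≤ ε₁ ∧ ∀ A : Set E,
      (∀ a ∈ A, ∀ b ∈ A, |inner ℝ ν (a - b)| ≤ δ * ‖a - b‖) →
      volume (A + seg (u i) 1) ≤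
        ENNReal.ofReal (|inner ℝ ν (u i)| + ε₁) * μHE[n - 1] A := by
    intro ν hν
    have h1 : ∀ᶠ δ : ℝ in nhdsWithin 0 (Ioi 0), ∀ i, δ * ‖u i‖ ≤ ε₁ := by
      refine Filter.eventually_all.2 fun i => ?_
      have : Filter.Tendsto (fun δ : ℝ => δ * ‖u i‖) (nhdsWithin 0 (Ioi 0)) (nhds (0 * ‖u i‖)) :=
        ((by fun_prop : Continuous fun δ : ℝ => δ * ‖u i‖).tendsto 0).mono_left nhdsWithin_le_nhds
      rw [zero_mul] at this
      exact this.eventually (ge_mem_nhds hε₁0)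
    have h2 := Filter.eventually_all.2 fun i => eventually_volume_add_seg_le hν (u i) hε₁0
    obtain ⟨δ, ⟨h1, h2⟩, hδ⟩ := ((h1.and h2).and self_mem_nhdsWithin).exists
    exact ⟨δ, hδ, fun i => ⟨h1 i, h2 i⟩⟩
  choose! δ hδ0 hδ using hloc
  have hone : ∀ ν : E, ‖ν‖ = 1 → ∀ B ⊆ normalPiece Ω ν (δ ν),
      ∑ i, volume ((B ∩ exitSet Ω (u i)) + seg (u i) 1) ≤
        ENNReal.ofReal (1 + ε) * μHE[n - 1] B := by
    intro ν hν B hB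
    have h1 : ∀ i, volume ((B ∩ exitSet Ω (u i)) + seg (u i) 1) ≤
        ENNReal.ofReal (max (inner ℝ (u i) ν) 0 + 2 * ε₁) * μHE[n - 1] B := by
      intro i
      rcases (B ∩ exitSet Ω (u i)).eq_empty_or_nonempty with he | ⟨a, haB, hau⟩
      · rw [he, empty_add, measure_empty]; exact zero_le
      obtain ⟨h2, h3⟩ := hδ ν hν i
      refine (h3 _ fun a ha b hb =>
        abs_inner_le_of_mem_normalPiece (hB ha.1) (hB hb.1)).trans ?_
      refine mul_le_mul' (ENNReal.ofReal_le_ofReal ?_) (measure_mono inter_subset_left)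
      have h4 := neg_le_inner_of_mem (hB haB) hau
      rw [real_inner_comm ν (u i)]
      have h5 : |inner ℝ ν (u i)| ≤ max (inner ℝ ν (u i)) 0 + ε₁ := by
        rcases abs_cases (inner ℝ ν (u i)) with h | h
        · rw [h.1]; linarith [le_max_left (inner ℝ ν (u i)) 0]
        · rw [h.1]; linarith [le_max_right (inner ℝ ν (u i)) 0]
      linarith
    refine (Finset.sum_le_sum fun i _ => h1 i).trans ?_
    rw [← Finset.sum_mul, ← ENNReal.ofReal_sum_of_nonneg fun i _ =>
      add_nonneg (le_max_right _ _) (by positivity)]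
    refine mul_le_mul' (ENNReal.ofReal_le_ofReal ?_) le_rfl
    rw [Finset.sum_add_distrib]
    have h2 := hu ν hν
    simp only [zonoSupport] at h2
    simp only [Finset.sum_const, Finset.card_univ, nsmul_eq_mul, ← hk]
    linarith
  have hall : ∀ t : Finset E, (∀ ν ∈ t, ‖ν‖ = 1) → ∀ B : Set E, MeasurableSet B →
      (B ⊆ ⋃ ν ∈ t, normalPiece Ω ν (δ ν)) →
      ∑ i, volume ((B ∩ exitSet Ω (u i)) + seg (u i) 1) ≤
        ENNReal.ofReal (1 + ε) * μHE[n - 1] B := by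
    intro t
    induction t using Finset.induction_on with
    | empty =>
      intro _ B _ hB
      have : B = ∅ := subset_empty_iff.1 (by simpa using hB)
      simp [this]
    | insert ν t hνt ih =>
      intro ht B hBm hB
      have hpm := (isClosed_normalPiece hΩ.isBounded ν (δ ν)).measurableSet
      have h1 := hone ν (ht ν (Finset.mem_insert_self _ _)) (B ∩ normalPiece Ω ν (δ ν))
        inter_subset_right
      have h2 := ih (fun μ hμ => ht μ (Finset.mem_insert_of_mem hμ))
        (B \ normalPiece Ω ν (δ ν)) (hBm.diff hpm) (by
          rintro x ⟨hx, hx'⟩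
          have := hB hx
          rw [Finset.set_biUnion_insert] at this
          exact this.resolve_left hx')
      rw [← measure_inter_add_sdiff B hpm, mul_add]
      refine le_trans ?_ (add_le_add h1 h2)
      rw [← Finset.sum_add_distrib]
      refine Finset.sum_le_sum fun i _ => (measure_mono ?_).trans (measure_union_le _ _)
      rw [← union_add, ← union_inter_distrib_right, inter_union_sdiff]
  obtain ⟨t, ht, htc⟩ := (isCompact_sphere (0 : E) 1).elim_nhds_subcover
    (fun ν => ball ν (δ ν)) fun ν hν => ball_mem_nhds ν (hδ0 ν (by simpa using hν))
  have hcov : frontier Ω ⊆ ⋃ ν ∈ t, normalPiece Ω ν (δ ν) := by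
    intro a ha
    obtain ⟨μ, hμ⟩ := hΩ.exists_isOuterNormal hne (hΩ.isOpen.frontier_eq ▸ ha).2
    obtain ⟨ν, hν, hμν⟩ := mem_iUnion₂.1 (htc (show μ ∈ sphere (0 : E) 1 by simpa using hμ.1))
    exact mem_iUnion₂.2 ⟨ν, hν, ha, μ, hμ, by simpa [dist_eq_norm] using (mem_ball.1 hμν).le⟩
  refine le_trans ?_ (hall t (fun ν hν => by simpa using ht ν hν) _
    isClosed_frontier.measurableSet hcov)
  rw [zonoGrowth, ENNReal.ofReal_sum_of_nonneg fun i _ => segGrowth_nonneg hΩ (u i)]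
  refine Finset.sum_le_sum fun i _ => ?_
  have hadd := hΩ.add_seg (u i) (y := 1)
  rw [segGrowth, ← measureReal_sdiff (subset_add_seg Ω (u i) zero_le_one)
    hΩ.isOpen.measurableSet hadd.volume_ne_top, ofReal_measureReal
    (measure_ne_top_of_subset sdiff_subset hadd.volume_ne_top)]
  exact measure_mono (add_seg_sdiff_subset hΩ.isOpen (u i))

end surface

section sphereArea
variable {n : ℕ}
local notation "E" => EuclideanSpace ℝ (Fin n)

theorem measurableSet_Ioo_smul {s : Set (sphere (0 : E) 1)} (hs : MeasurableSet s) {r : ℝ}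
    (hr : 0 < r) : MeasurableSet (Ioo (0 : ℝ) r • (((↑) : sphere (0 : E) 1 → E) '' s)) := by
  lift r to Ioi (0 : ℝ) using hr
  have h : Ioo (0 : ℝ) r • (((↑) : sphere (0 : E) 1 → E) '' s) =
      (↑) '' (homeomorphUnitSphereProd E ⁻¹' s ×ˢ Iio r) := by
    rw [← image2_smul, image2_image_right, ← Homeomorph.image_symm, image_image,
      ← image_subtype_val_Ioi_Iio, image2_image_left, image2_swap, ← image_prod]
    rfl
  rw [h]
  exact (MeasurableEmbedding.subtype_coe (measurableSet_singleton _).compl).measurableSet_image.2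
    ((homeomorphUnitSphereProd E).measurable (hs.prod measurableSet_Iio))

/-- The volume of a thin conical shell is at most its height times the area of its base. -/
theorem volume_Ioo_smul_le {s : Set (sphere (0 : E) 1)} (hs : MeasurableSet s) {h : ℝ}
    (h0 : 0 < h) (h1 : h < 1) :
    volume (Ioo (1 - h) 1 • (((↑) : sphere (0 : E) 1 → E) '' s)) ≤
      ENNReal.ofReal h * (volume : Measure E).toSphere s := by
  rw [Measure.toSphere_apply' _ hs, finrank_euclideanSpace_fin]
  set A : Set E := ((↑) : sphere (0 : E) 1 → E) '' s with hA
  have hA1 : ∀ a ∈ A, ‖a‖ = 1 := by rintro _ ⟨a, -, rfl⟩; simp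
  set V := volume (Ioo (0 : ℝ) 1 • A) with hV
  have hVfin : V ≠ ⊤ := by
    refine ne_top_of_le_ne_top (measure_ball_lt_top (x := (0 : E)) (r := 1)).ne
      (measure_mono ?_)
    rintro _ ⟨r, hr, a, ha, rfl⟩
    simpa [norm_smul, hA1 a ha, abs_of_pos hr.1] using hr.2
  have hW : volume (Ioo (0 : ℝ) (1 - h) • A) = ENNReal.ofReal ((1 - h) ^ n) * V := by
    have : Ioo (0 : ℝ) (1 - h) = (1 - h) • Ioo (0 : ℝ) 1 := by
      simp [LinearOrderedField.smul_Ioo (sub_pos.2 h1)]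
    rw [this, smul_assoc, Measure.addHaar_smul_of_nonneg _ (sub_pos.2 h1).le,
      finrank_euclideanSpace_fin]
  have hdisj : Disjoint (Ioo (1 - h) 1 • A) (Ioo (0 : ℝ) (1 - h) • A) := by
    rw [Set.disjoint_left]
    rintro _ ⟨r, hr, a, ha, rfl⟩ ⟨r', hr', b, hb, hab⟩
    have := congrArg norm hab
    simp only [norm_smul, hA1 a ha, hA1 b hb, mul_one, Real.norm_eq_abs] at this
    rw [abs_of_pos hr'.1, abs_of_pos ((sub_pos.2 h1).trans hr.1)] at this
    linarith [hr.1, hr'.2]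
  have hle : volume (Ioo (1 - h) 1 • A) + ENNReal.ofReal ((1 - h) ^ n) * V ≤ V := by
    rw [← hW, ← measure_union hdisj (measurableSet_Ioo_smul hs (sub_pos.2 h1))]
    refine measure_mono (union_subset ?_ ?_)
    · exact Set.smul_subset_smul_right (Ioo_subset_Ioo_left (sub_pos.2 h1).le)
    · exact Set.smul_subset_smul_right (Ioo_subset_Ioo_right (by linarith))
  have hfin : volume (Ioo (1 - h) 1 • A) ≠ ⊤ :=
    ne_top_of_le_ne_top hVfin (le_self_add.trans hle)
  rw [← ENNReal.ofReal_toReal hVfin, ← ENNReal.ofReal_toReal hfin] at hle ⊢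
  have hp : 0 ≤ (1 - h) ^ n := pow_nonneg (sub_pos.2 h1).le n
  rw [← ENNReal.ofReal_mul hp, ← ENNReal.ofReal_add ENNReal.toReal_nonneg (by positivity),
    ENNReal.ofReal_le_ofReal_iff ENNReal.toReal_nonneg] at hle
  rw [← ENNReal.ofReal_natCast, ← ENNReal.ofReal_mul (Nat.cast_nonneg _), ← ENNReal.ofReal_mul h0.le]
  refine ENNReal.ofReal_le_ofReal ?_
  have hb := one_add_mul_le_pow (show (-2 : ℝ) ≤ -h by linarith) n
  have : (1 + -h) ^ n = (1 - h) ^ n := by ring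
  rw [this] at hb
  nlinarith [ENNReal.toReal_nonneg (a := V)]

theorem abs_inner_sub_le_of_unit {ν a b : E} {δ : ℝ} (ha : ‖a‖ = 1) (hb : ‖b‖ = 1)
    (haν : ‖a - ν‖ ≤ δ) (hbν : ‖b - ν‖ ≤ δ) : |inner ℝ ν (a - b)| ≤ δ * ‖a - b‖ := by
  have h1 : inner ℝ (a + b) (a - b) = 0 := by
    rw [inner_add_left, inner_sub_right, inner_sub_right, real_inner_self_eq_norm_sq,
      real_inner_self_eq_norm_sq, ha, hb, real_inner_comm]; ring
  have h2 : inner ℝ ν (a - b) = -(inner ℝ ((a - ν) + (b - ν)) (a - b)) / 2 := by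
    have : (a - ν) + (b - ν) = (a + b) - (2 : ℝ) • ν := by rw [two_smul]; abel
    rw [this, inner_sub_left, h1, real_inner_smul_left]; ring
  have h3 := abs_real_inner_le_norm ((a - ν) + (b - ν)) (a - b)
  have h4 : ‖(a - ν) + (b - ν)‖ ≤ 2 * δ := (norm_add_le _ _).trans (by linarith)
  rw [h2, abs_div, abs_neg, abs_two]
  nlinarith [norm_nonneg (a - b)]

theorem exists_euclideanHausdorffMeasure_cap_le {ε : ℝ} (hε : 0 < ε) :
    ∃ δ : ℝ, 0 < δ ∧ ∀ ν : E, ‖ν‖ = 1 → ∀ s : Set (sphere (0 : E) 1), MeasurableSet s →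
      (∀ a ∈ s, ‖(a : E) - ν‖ ≤ δ) →
      μHE[n - 1] (((↑) : sphere (0 : E) 1 → E) '' s) ≤
        ENNReal.ofReal (1 + ε) * (ENNReal.ofReal (1 + ε) * (volume : Measure E).toSphere s) := by
  have hm : ENNReal.ofReal |(ContinuousLinearMap.id ℝ E).det| <
      (Real.toNNReal (1 + ε) : ℝ≥0∞) := by
    have : (ContinuousLinearMap.id ℝ E).det = 1 := by simp [ContinuousLinearMap.det]
    rw [this, ← ENNReal.ofReal, ENNReal.ofReal_lt_ofReal_iff (by positivity)]
    simpa using hε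
  obtain ⟨c, hc, hc0⟩ := ((addHaar_image_le_mul_of_det_lt (volume : Measure E) _ hm).and
    self_mem_nhdsWithin).exists
  have hc0' : (0 : ℝ) < c := hc0
  have hlim : ∀ᶠ δ : ℝ in nhdsWithin 0 (Ioi 0), ((1 - δ)⁻¹) ^ (n - 1) ≤ 1 + ε := by
    have h1 : ContinuousAt (fun δ : ℝ => ((1 - δ)⁻¹) ^ (n - 1)) 0 := by
      refine ContinuousAt.pow (ContinuousAt.inv₀ (by fun_prop) (by norm_num)) _
    have h2 : Filter.Tendsto (fun δ : ℝ => ((1 - δ)⁻¹) ^ (n - 1)) (nhdsWithin 0 (Ioi 0)) (nhds 1) := by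
      have := h1.tendsto.mono_left (nhdsWithin_le_nhds (s := Ioi 0))
      simpa using this
    exact h2.eventually (ge_mem_nhds (by linarith))
  obtain ⟨δ, hδK, hδ⟩ := (hlim.and
    (Ioo_mem_nhdsGT (show (0 : ℝ) < min (c / 9) (1 / 2) by positivity))).exists
  have hδ0 := hδ.1
  have hδ1 : δ ≤ c / 9 := hδ.2.le.trans (min_le_left _ _)
  have hδ2 : δ ≤ 1 / 2 := hδ.2.le.trans (min_le_right _ _)
  refine ⟨δ, hδ0, fun ν hν s hs hsδ => ?_⟩
  set A : Set E := ((↑) : sphere (0 : E) 1 → E) '' s with hA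
  have hA1 : ∀ a ∈ A, ‖a‖ = 1 := by rintro _ ⟨a, -, rfl⟩; simp
  have hAν : ∀ a ∈ A, ‖a - ν‖ ≤ δ := by rintro _ ⟨a, ha, rfl⟩; exact hsδ a ha
  let P : E → E := fun z => z - inner ℝ ν z • ν
  have hPsub : ∀ x y, P x - P y = P (x - y) := by
    intro x y; simp only [P, inner_sub_right, sub_smul]; abel
  have hPν : ∀ z, inner ℝ ν (P z) = 0 := by
    intro z
    simp only [P, inner_sub_right, inner_smul_right, real_inner_self_eq_norm_sq, hν]; ring
  have hin : ∀ a ∈ A, ∀ b ∈ A, |inner ℝ ν (a - b)| ≤ δ * ‖a - b‖ := fun a ha b hb =>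
    abs_inner_sub_le_of_unit (hA1 a ha) (hA1 b hb) (hAν a ha) (hAν b hb)
  have hAP : ∀ a ∈ A, ∀ b ∈ A, ‖a - b‖ ≤ (1 - δ)⁻¹ * ‖P (a - b)‖ := by
    intro a ha b hb
    have h1 : a - b = P (a - b) + inner ℝ ν (a - b) • ν := by simp [P]
    have h2 : ‖a - b‖ ≤ ‖P (a - b)‖ + |inner ℝ ν (a - b)| := by
      nth_rewrite 1 [h1]
      refine (norm_add_le _ _).trans_eq ?_
      rw [norm_smul, hν, mul_one, Real.norm_eq_abs]
    have h3 := hin a ha b hb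
    rw [inv_mul_eq_div, le_div_iff₀ (by linarith)]
    linarith
  have hinj : InjOn P A := by
    intro a ha b hb hab
    have h1 := hAP a ha b hb
    rw [← hPsub, hab, sub_self, norm_zero, mul_zero] at h1
    exact sub_eq_zero.1 (norm_le_zero_iff.1 h1)
  have hlip : LipschitzOnWith (Real.toNNReal (1 - δ)⁻¹) (Function.invFunOn P A) (P '' A) := by
    refine LipschitzOnWith.of_dist_le_mul ?_
    rintro _ ⟨a, ha, rfl⟩ _ ⟨b, hb, rfl⟩
    rw [hinj.leftInvOn_invFunOn ha, hinj.leftInvOn_invFunOn hb, dist_eq_norm, dist_eq_norm, hPsub,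
      Real.coe_toNNReal _ (inv_nonneg.2 (by linarith))]
    exact hAP a ha b hb
  have hAimg : Function.invFunOn P A '' (P '' A) = A := by
    rw [image_image]
    refine (image_congr fun a ha => hinj.leftInvOn_invFunOn ha).trans (image_id' A)
  have hflat : μHE[n - 1] A ≤ ENNReal.ofReal (1 + ε) * μHE[n - 1] (P '' A) := by
    have h1 := euclideanHausdorffMeasure_image_le_of_lipschitz hlip (n - 1)
    rw [hAimg] at h1
    refine h1.trans (mul_le_mul' ?_ le_rfl)
    rw [← ENNReal.ofReal, ← ENNReal.ofReal_pow (inv_nonneg.2 (by linarith))]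
    exact ENNReal.ofReal_le_ofReal hδK
  refine hflat.trans (mul_le_mul' le_rfl ?_)
  let ψ : E → E := fun x => P (‖x‖⁻¹ • x) + ‖x‖ • ν
  have hψ : ∀ a ∈ A, ∀ r ∈ Ioo (1 - δ) 1, ψ (r • a) = P a + r • ν := by
    intro a ha r hr
    have hr0 : 0 < r := by linarith [hr.1]
    simp only [ψ]
    rw [norm_smul, hA1 a ha, mul_one, Real.norm_eq_abs, abs_of_pos hr0, smul_smul,
      inv_mul_cancel₀ hr0.ne', one_smul]
  have himg : ψ '' (Ioo (1 - δ) 1 • A) =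
      (fun q : E × ℝ => q.1 + q.2 • ν) '' ((P '' A) ×ˢ Ioo (1 - δ) 1) := by
    ext y
    constructor
    · rintro ⟨_, ⟨r, hr, a, ha, rfl⟩, rfl⟩
      exact ⟨⟨P a, r⟩, ⟨⟨a, ha, rfl⟩, hr⟩, (hψ a ha r hr).symm⟩
    · rintro ⟨⟨_, r⟩, ⟨⟨a, ha, rfl⟩, hr⟩, rfl⟩
      exact ⟨r • a, ⟨r, hr, a, ha, rfl⟩, hψ a ha r hr⟩
  have happ : ApproximatesLinearOn ψ (ContinuousLinearMap.id ℝ E) (Ioo (1 - δ) 1 • A) c := by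
    rintro _ ⟨r, hr, a, ha, rfl⟩ _ ⟨t, ht, b, hb, rfl⟩
    simp only
    rw [hψ a ha r hr, hψ b hb t ht, ContinuousLinearMap.id_apply]
    have hr0 : 0 < r := by linarith [hr.1]
    have ht0 : 0 < t := by linarith [ht.1]
    have e1 : P a + r • ν - (P b + t • ν) - (r • a - t • b) =
        (1 - r) • (a - b) - inner ℝ ν (a - b) • ν + (r - t) • (ν - b) := by
      have : P a + r • ν - (P b + t • ν) = P (a - b) + (r - t) • ν := by
        rw [← hPsub, sub_smul]; abel
      rw [this]
      simp only [P]
      module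
    have h1 : |r - t| ≤ ‖r • a - t • b‖ := by
      have := abs_norm_sub_norm_le (r • a) (t • b)
      rwa [norm_smul, norm_smul, hA1 a ha, hA1 b hb, mul_one, mul_one, Real.norm_eq_abs,
        Real.norm_eq_abs, abs_of_pos hr0, abs_of_pos ht0] at this
    have h2 : r * ‖a - b‖ ≤ ‖r • a - t • b‖ + |r - t| := by
      have e2 : r • (a - b) = (r • a - t • b) - (r - t) • b := by module
      have := norm_sub_le (r • a - t • b) ((r - t) • b)
      rw [← e2, norm_smul, norm_smul, hA1 b hb, mul_one, Real.norm_eq_abs, Real.norm_eq_abs,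
        abs_of_pos hr0] at this
      exact this
    have h3 : ‖a - b‖ ≤ 4 * ‖r • a - t • b‖ := by
      have : (1 / 2) * ‖a - b‖ ≤ r * ‖a - b‖ := by gcongr; linarith [hr.1]
      linarith
    rw [e1]
    have h4 : ‖(1 - r) • (a - b)‖ ≤ δ * ‖a - b‖ := by
      rw [norm_smul, Real.norm_eq_abs, abs_of_pos (by linarith [hr.2])]
      gcongr; linarith [hr.1]
    have h5 : ‖inner ℝ ν (a - b) • ν‖ ≤ δ * ‖a - b‖ := by
      rw [norm_smul, hν, mul_one, Real.norm_eq_abs]; exact hin a ha b hb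
    have h6 : ‖(r - t) • (ν - b)‖ ≤ δ * |r - t| := by
      rw [norm_smul, Real.norm_eq_abs, norm_sub_rev, mul_comm]
      gcongr; exact hAν b hb
    have h7 := norm_add_le ((1 - r) • (a - b) - inner ℝ ν (a - b) • ν) ((r - t) • (ν - b))
    have h8 := norm_sub_le ((1 - r) • (a - b)) (inner ℝ ν (a - b) • ν)
    have h9 : δ * ‖a - b‖ ≤ δ * (4 * ‖r • a - t • b‖) := by gcongr
    have h10 : δ * |r - t| ≤ δ * ‖r • a - t • b‖ := by gcongr
    have h11 : 9 * δ * ‖r • a - t • b‖ ≤ c * ‖r • a - t • b‖ := by gcongr; linarith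
    linarith
  have hvol := hc _ ψ happ
  rw [himg, volume_image_add_smul hν (by rintro _ ⟨a, -, rfl⟩; exact hPν a), Real.volume_Ioo] at hvol
  have h1 := hvol.trans (mul_le_mul' le_rfl (volume_Ioo_smul_le hs hδ0 (by linarith)))
  rw [sub_sub_cancel, mul_left_comm] at h1
  exact (ENNReal.mul_le_mul_iff_right (by simpa using hδ0) ENNReal.ofReal_ne_top).1 h1

theorem euclideanHausdorffMeasure_image_le_toSphere {s : Set (sphere (0 : E) 1)}
    (hs : MeasurableSet s) :
    μHE[n - 1] (((↑) : sphere (0 : E) 1 → E) '' s) ≤ (volume : Measure E).toSphere s := by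
  have hε : ∀ ε : ℝ, 0 < ε → μHE[n - 1] (((↑) : sphere (0 : E) 1 → E) '' s) ≤
      ENNReal.ofReal (1 + ε) * (ENNReal.ofReal (1 + ε) * (volume : Measure E).toSphere s) := by
    intro ε hε
    obtain ⟨δ, hδ, hcap⟩ := exists_euclideanHausdorffMeasure_cap_le (n := n) hε
    have hall : ∀ t : Finset (sphere (0 : E) 1), ∀ s : Set (sphere (0 : E) 1), MeasurableSet s →
        (s ⊆ ⋃ ν ∈ t, closedBall ν δ) → μHE[n - 1] (((↑) : sphere (0 : E) 1 → E) '' s) ≤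
          ENNReal.ofReal (1 + ε) * (ENNReal.ofReal (1 + ε) * (volume : Measure E).toSphere s) := by
      classical
      intro t
      induction t using Finset.induction_on with
      | empty =>
        intro s _ hs
        have : s = ∅ := subset_empty_iff.1 (by simpa using hs)
        simp [this]
      | insert ν t hνt ih =>
        intro s hsm hs
        have hbm : MeasurableSet (closedBall ν δ) := isClosed_closedBall.measurableSet
        have h1 := hcap ν (by simp) (s ∩ closedBall ν δ) (hsm.inter hbm) (by
          rintro a ⟨-, ha⟩
          simpa [Subtype.dist_eq, dist_eq_norm] using ha)
        have h2 := ih (s \ closedBall ν δ) (hsm.diff hbm) (by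
          rintro x ⟨hx, hx'⟩
          have := hs hx
          rw [Finset.set_biUnion_insert] at this
          exact this.resolve_left hx')
        rw [← measure_inter_add_sdiff s hbm, mul_add, mul_add]
        refine le_trans ?_ (add_le_add h1 h2)
        refine le_trans (measure_mono ?_) (measure_union_le _ _)
        rw [← image_union, inter_union_sdiff]
    obtain ⟨t, -, ht⟩ := (isCompact_univ (X := sphere (0 : E) 1)).elim_nhds_subcover
      (fun ν => closedBall ν δ) fun ν _ => closedBall_mem_nhds ν hδ
    exact hall t s hs ((subset_univ s).trans ht)
  have hlim : Filter.Tendsto (fun ε : ℝ => ENNReal.ofReal (1 + ε) *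
      (ENNReal.ofReal (1 + ε) * (volume : Measure E).toSphere s)) (nhdsWithin 0 (Ioi 0))
      (nhds (ENNReal.ofReal (1 + 0) *
      (ENNReal.ofReal (1 + 0) * (volume : Measure E).toSphere s))) := by
    have h1 : Filter.Tendsto (fun ε : ℝ => ENNReal.ofReal (1 + ε)) (nhdsWithin 0 (Ioi 0))
        (nhds (ENNReal.ofReal (1 + 0))) := by
      refine Filter.Tendsto.mono_left ?_ nhdsWithin_le_nhds
      exact (ENNReal.continuous_ofReal.comp (by fun_prop : Continuous fun ε : ℝ => 1 + ε)).tendsto 0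
    refine ENNReal.Tendsto.mul h1 (Or.inr ?_) (ENNReal.Tendsto.mul_const h1 (Or.inr ?_))
      (Or.inr ENNReal.ofReal_ne_top)
    · exact ENNReal.mul_ne_top ENNReal.ofReal_ne_top (measure_ne_top _ _)
    · exact measure_ne_top _ _
  have := ge_of_tendsto hlim (Filter.eventually_of_mem self_mem_nhdsWithin hε)
  simpa using this

end sphereArea

section perimeter
variable {n : ℕ}
local notation "E" => EuclideanSpace ℝ (Fin n)

theorem lintegral_sphere_le {R : ℝ} (hR : 0 < R) {f : E → ℝ≥0∞} (hf : Measurable f) :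
    ∫⁻ x in sphere (0 : E) R, f x ∂μHE[n - 1] ≤
      ENNReal.ofReal (R ^ (n - 1)) *
        ∫⁻ θ : sphere (0 : E) 1, f (R • (θ : E)) ∂(volume : Measure E).toSphere := by
  have hg : Measurable fun θ : sphere (0 : E) 1 => R • (θ : E) := by fun_prop
  rw [← lintegral_map hf hg, ← smul_eq_mul, ← lintegral_smul_measure]
  refine lintegral_mono' (Measure.le_iff.2 fun B hB => ?_) le_rfl
  rw [Measure.restrict_apply hB, Measure.smul_apply, Measure.map_apply hg hB, smul_eq_mul]
  have h1 : B ∩ sphere (0 : E) R =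
      R • (((↑) : sphere (0 : E) 1 → E) '' ((fun θ : sphere (0 : E) 1 => R • (θ : E)) ⁻¹' B)) := by
    ext x
    constructor
    · rintro ⟨hxB, hx⟩
      have hxR : ‖x‖ = R := by simpa using hx
      refine ⟨R⁻¹ • x, ⟨⟨R⁻¹ • x, ?_⟩, ?_, rfl⟩, ?_⟩
      · simp [norm_smul, hxR, abs_of_pos hR, hR.ne']
      · simpa [smul_smul, hR.ne'] using hxB
      · simp [smul_smul, hR.ne']
    · rintro ⟨_, ⟨θ, hθ, rfl⟩, rfl⟩
      exact ⟨hθ, by simp [norm_smul, abs_of_pos hR]⟩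
  rw [h1, Measure.euclideanHausdorffMeasure_smul₀ _ hR.ne', ENNReal.smul_def, smul_eq_mul,
    ENNReal.ofReal_pow hR.le, ENNReal.coe_pow]
  have h2 : (‖R‖₊ : ℝ≥0∞) = ENNReal.ofReal R := by
    rw [← enorm_eq_nnnorm, Real.enorm_eq_ofReal hR.le]
  rw [h2]
  gcongr
  exact euclideanHausdorffMeasure_image_le_toSphere (hg hB)

theorem euclideanHausdorffMeasure_sphere_le {R : ℝ} (hR : 0 < R) :
    μHE[n - 1] (sphere (0 : E) R) ≤
      ENNReal.ofReal (n * volume.real (ball (0 : E) 1) * R ^ (n - 1)) := by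
  have h := lintegral_sphere_le (n := n) hR (f := fun _ => 1) measurable_const
  rw [setLIntegral_one, lintegral_one, Measure.toSphere_apply_univ, finrank_euclideanSpace_fin] at h
  refine h.trans_eq ?_
  rw [mul_comm, ENNReal.ofReal_mul (by positivity), ENNReal.ofReal_mul (by positivity),
    ENNReal.ofReal_natCast, ofReal_measureReal measure_ball_lt_top.ne]

theorem exists_zono_near (hn : 1 ≤ n) {ε : ℝ} (hε : 0 < ε) (hε1 : ε < 1) :
    ∃ (ι : Type) (_ : Fintype ι) (_ : Nonempty ι) (u : ι → E), (∀ i, u i ≠ 0) ∧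
      closedBall 0 (1 - ε) ⊆ zono u 1 ∧ zono u 1 ⊆ closedBall 0 1 ∧
      ∀ ν : E, ‖ν‖ = 1 → zonoSupport u ν ≤ 1 := by
  obtain ⟨ι, _, _, u, hu0, hu⟩ := exists_zonoSupport_near (n := n) hn hε hε1
  exact ⟨ι, _, ‹_›, u, hu0, closedBall_subset_zono fun ν hν => (hu ν hν).1,
    zono_subset_closedBall fun ν hν => (hu ν hν).2, fun ν hν => (hu ν hν).2⟩

theorem le_euclideanHausdorffMeasure_sphere (hn : 1 ≤ n) {R : ℝ} (hR : 0 < R) :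
    ENNReal.ofReal (n * volume.real (ball (0 : E) 1) * R ^ (n - 1)) ≤
      μHE[n - 1] (sphere (0 : E) R) := by
  have : Nonempty (Fin n) := ⟨⟨0, hn⟩⟩
  set ω := volume.real (ball (0 : E) 1) with hω
  have hfin : μHE[n - 1] (sphere (0 : E) R) ≠ ⊤ :=
    ne_top_of_le_ne_top ENNReal.ofReal_ne_top (euclideanHausdorffMeasure_sphere_le hR)
  set μR := (μHE[n - 1] (sphere (0 : E) R)).toReal with hμR
  have hμ : μHE[n - 1] (sphere (0 : E) R) = ENNReal.ofReal μR := (ENNReal.ofReal_toReal hfin).symm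
  have hfr : frontier (ball (0 : E) R) = sphere 0 R := frontier_ball 0 hR.ne'
  have key : ∀ ε : ℝ, 0 < ε → ε < 1 → n * (1 - ε) * ω * R ^ (n - 1) ≤ (1 + ε) * μR := by
    intro ε hε hε1
    obtain ⟨ι, _, _, u, -, h1, -, h2⟩ := exists_zono_near (n := n) hn hε hε1
    have h3 := le_zonoGrowth_ball (sub_pos.2 hε1) (ball_subset_closedBall.trans h1)
    have h4 := ofReal_zonoGrowth_le (isOpenConvexBody_ball (0 : E) R) (nonempty_ball.2 hR) u h2 hε
    rw [hfr, hμ, ← ENNReal.ofReal_mul (by positivity),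
      ENNReal.ofReal_le_ofReal_iff (mul_nonneg (by positivity) ENNReal.toReal_nonneg)] at h4
    have h5 : ball (0 : E) R = R • ball (0 : E) 1 := by
      rw [_root_.smul_ball hR.ne']; simp [abs_of_pos hR]
    rw [h5, zonoGrowth_smul hn u (isOpenConvexBody_ball 0 1) hR] at h4
    refine le_trans ?_ h4
    rw [mul_comm]
    gcongr
  rw [hμ]
  refine ENNReal.ofReal_le_ofReal ?_
  have hl : Filter.Tendsto (fun ε : ℝ => n * (1 - ε) * ω * R ^ (n - 1)) (nhdsWithin 0 (Ioi 0))
      (nhds (n * (1 - 0) * ω * R ^ (n - 1))) :=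
    ((by fun_prop : Continuous fun ε : ℝ => n * (1 - ε) * ω * R ^ (n - 1)).tendsto 0).mono_left
      nhdsWithin_le_nhds
  have hr : Filter.Tendsto (fun ε : ℝ => (1 + ε) * μR) (nhdsWithin 0 (Ioi 0))
      (nhds ((1 + 0) * μR)) :=
    ((by fun_prop : Continuous fun ε : ℝ => (1 + ε) * μR).tendsto 0).mono_left nhdsWithin_le_nhds
  have := le_of_tendsto_of_tendsto hl hr (by
    filter_upwards [Ioo_mem_nhdsGT (zero_lt_one (α := ℝ))] with ε hε using key ε hε.1 hε.2)
  simpa using this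

theorem euclideanHausdorffMeasure_sphere (hn : 1 ≤ n) {R : ℝ} (hR : 0 < R) :
    μHE[n - 1] (sphere (0 : E) R) =
      ENNReal.ofReal (n * volume.real (ball (0 : E) 1) * R ^ (n - 1)) :=
  (euclideanHausdorffMeasure_sphere_le hR).antisymm (le_euclideanHausdorffMeasure_sphere hn hR)

theorem hasApproxPerimeterLE_of_frontier_le (hn : 1 ≤ n) {Ω : Set E} (hΩ : IsOpenConvexBody Ω)
    (hne : Ω.Nonempty) {R : ℝ} (hR : 0 < R)
    (h : μHE[n - 1] (frontier Ω) ≤ μHE[n - 1] (sphere (0 : E) R)) :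
    HasApproxPerimeterLE Ω R := by
  intro ε hε hε1
  obtain ⟨ι, i1, i2, u, h0, h1, h2, h3⟩ := exists_zono_near (n := n) hn hε hε1
  refine ⟨ι, i1, i2, u, h0, h1, h2, ?_⟩
  have h4 := (ofReal_zonoGrowth_le hΩ hne u h3 hε).trans (mul_le_mul' le_rfl h)
  rw [euclideanHausdorffMeasure_sphere hn hR, ← ENNReal.ofReal_mul (by positivity),
    ENNReal.ofReal_le_ofReal_iff (by positivity)] at h4
  exact h4

/-- The Hausdorff measure of codimension one as a multiple of the Euclidean one. -/
theorem exists_hausdorffMeasure_eq_smul (hn : 1 ≤ n) :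
    ∃ c : ℝ≥0, c ≠ 0 ∧ (μH[(n : ℝ) - 1] : Measure E) = c • (μHE[n - 1] : Measure E) := by
  have hc := Measure.addHaarScalarFactor_volume_hausdorffMeasure_ne_zero
  rw [show (n : ℝ) - 1 = ((n - 1 : ℕ) : ℝ) by push_cast [hn]; ring]
  refine ⟨_, inv_ne_zero (hc (n - 1)), ?_⟩
  rw [Measure.euclideanHausdorffMeasure_def, smul_smul, inv_mul_cancel₀ (hc (n - 1)), one_smul]

end perimeter

section polar
variable {n : ℕ}
local notation "E" => EuclideanSpace ℝ (Fin n)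

theorem lintegral_polar (hn : 1 ≤ n) {f : E → ℝ≥0∞} (hf : Measurable f) :
    ∫⁻ x, f x = ∫⁻ θ : sphere (0 : E) 1, (∫⁻ r in Ioi (0 : ℝ), ENNReal.ofReal (r ^ (n - 1)) *
      f (r • (θ : E))) ∂(volume : Measure E).toSphere := by
  have : Nonempty (Fin n) := ⟨⟨0, hn⟩⟩
  have hmp := (volume : Measure E).measurePreserving_homeomorphUnitSphereProd
  rw [finrank_euclideanSpace_fin] at hmp
  have hg : Measurable fun q : sphere (0 : E) 1 × Ioi (0 : ℝ) => f ((q.2 : ℝ) • (q.1 : E)) :=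
    hf.comp (by fun_prop)
  calc ∫⁻ x, f x = ∫⁻ x in ({0}ᶜ : Set E), f x := by
        rw [restrict_compl_singleton]
    _ = ∫⁻ x : ({0}ᶜ : Set E), f x ∂(volume : Measure E).comap (↑) :=
        (lintegral_subtype_comap (measurableSet_singleton _).compl f).symm
    _ = ∫⁻ x : ({0}ᶜ : Set E), (fun q : sphere (0 : E) 1 × Ioi (0 : ℝ) =>
          f ((q.2 : ℝ) • (q.1 : E))) (homeomorphUnitSphereProd E x)
          ∂(volume : Measure E).comap (↑) := by
        refine lintegral_congr fun x => ?_
        have hx : ‖(x : E)‖ ≠ 0 := norm_ne_zero_iff.2 x.2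
        simp [smul_smul, hx]
    _ = _ := by
        rw [hmp.lintegral_comp hg, lintegral_prod _ hg.aemeasurable]
        refine lintegral_congr fun θ => ?_
        rw [Measure.volumeIoiPow, lintegral_withDensity_eq_lintegral_mul _ (by fun_prop)
          (show Measurable fun r : Ioi (0 : ℝ) => f ((r : ℝ) • (θ : E)) from
            hf.comp (by fun_prop))]
        exact lintegral_subtype_comap measurableSet_Ioi
          (fun r : ℝ => ENNReal.ofReal (r ^ (n - 1)) * f (r • (θ : E)))

theorem setLIntegral_ball_polar (hn : 1 ≤ n) {f : E → ℝ≥0∞} (hf : Measurable f) (R : ℝ) :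
    ∫⁻ x in ball (0 : E) R, f x = ∫⁻ θ : sphere (0 : E) 1, (∫⁻ r in Ioo (0 : ℝ) R,
      ENNReal.ofReal (r ^ (n - 1)) * f (r • (θ : E))) ∂(volume : Measure E).toSphere := by
  rw [← lintegral_indicator measurableSet_ball,
    lintegral_polar hn (hf.indicator measurableSet_ball)]
  refine lintegral_congr fun θ => ?_
  rw [← Ioi_inter_Iio, inter_comm, ← Measure.restrict_restrict measurableSet_Iio,
    ← lintegral_indicator measurableSet_Iio]
  refine setLIntegral_congr_fun measurableSet_Ioi fun r hr => ?_
  have hr0 : (0 : ℝ) < r := hr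
  have hnorm : ‖r • (θ : E)‖ = r := by simp [norm_smul, abs_of_pos hr0]
  by_cases h : r < R
  · rw [indicator_of_mem (by simpa [hnorm] using h), indicator_of_mem (by simpa using h)]
  · rw [indicator_of_notMem (by simpa [hnorm] using h), indicator_of_notMem (by simpa using h),
      mul_zero]

theorem setLIntegral_ball_norm (hn : 1 ≤ n) {w : ℝ → ℝ≥0∞} (hw : Measurable w) (R : ℝ) :
    ∫⁻ x in ball (0 : E) R, w ‖x‖ = ENNReal.ofReal (n * volume.real (ball (0 : E) 1)) *
      ∫⁻ r in Ioo (0 : ℝ) R, ENNReal.ofReal (r ^ (n - 1)) * w r := by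
  rw [setLIntegral_ball_polar hn (f := fun x => w ‖x‖) (hw.comp measurable_norm) R]
  have h : ∀ θ : sphere (0 : E) 1, ∫⁻ r in Ioo (0 : ℝ) R,
      ENNReal.ofReal (r ^ (n - 1)) * w ‖r • (θ : E)‖ =
      ∫⁻ r in Ioo (0 : ℝ) R, ENNReal.ofReal (r ^ (n - 1)) * w r := fun θ =>
    setLIntegral_congr_fun measurableSet_Ioo fun r hr => by
      simp [norm_smul, abs_of_pos hr.1]
  simp_rw [h]
  rw [lintegral_const, Measure.toSphere_apply_univ, finrank_euclideanSpace_fin, mul_comm,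
    ENNReal.ofReal_mul (by positivity), ENNReal.ofReal_natCast,
    ofReal_measureReal measure_ball_lt_top.ne]

/-- Almost every ray meets a null set in a null set. -/
theorem ae_ray_notMem (hn : 1 ≤ n) {N : Set E} (hNm : MeasurableSet N) (hN : volume N = 0) :
    ∀ᵐ θ : sphere (0 : E) 1 ∂(volume : Measure E).toSphere,
      ∀ᵐ r : ℝ ∂volume.restrict (Ioi 0), r • (θ : E) ∉ N := by
  have h := lintegral_polar hn (measurable_one.indicator hNm : Measurable (N.indicator 1))
  rw [lintegral_indicator_one hNm, hN, eq_comm, lintegral_eq_zero_iff] at h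
  · filter_upwards [h] with θ hθ
    rw [Pi.zero_apply, lintegral_eq_zero_iff (by
      refine (by fun_prop : Measurable fun r : ℝ => ENNReal.ofReal (r ^ (n - 1))).mul ?_
      exact (measurable_one.indicator hNm).comp (by fun_prop))] at hθ
    filter_upwards [hθ, self_mem_ae_restrict measurableSet_Ioi] with r hr hr0 hmem
    have hr0' : (0 : ℝ) < r := hr0
    simp only [Pi.zero_apply, mul_eq_zero, ENNReal.ofReal_eq_zero, indicator_of_mem hmem,
      Pi.one_apply, one_ne_zero, or_false] at hr
    exact absurd (pow_pos hr0' (n - 1)) (not_lt.2 hr)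
  · refine Measurable.lintegral_prod_right' (f := fun q : sphere (0 : E) 1 × ℝ =>
      ENNReal.ofReal (q.2 ^ (n - 1)) * N.indicator 1 (q.2 • (q.1 : E))) ?_
    exact (by fun_prop : Measurable fun q : sphere (0 : E) 1 × ℝ =>
      ENNReal.ofReal (q.2 ^ (n - 1))).mul ((measurable_one.indicator hNm).comp (by fun_prop))

end polar

section comparison
variable {n : ℕ}
local notation "E" => EuclideanSpace ℝ (Fin n)

/-- The density `‖∇v‖ ^ p + a |v| ^ p` of the energy. -/
def energyDensity (p a : ℝ) (v : EuclideanSpace ℝ (Fin n) → ℝ)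
    (x : EuclideanSpace ℝ (Fin n)) : ℝ≥0∞ :=
  ENNReal.ofReal (‖fderiv ℝ v x‖ ^ p + a * |v x| ^ p)

theorem measurable_energyDensity {p a : ℝ} {v : E → ℝ} (hv : Continuous v) :
    Measurable (energyDensity p a v) := by
  have h1 : Measurable fun x => ‖fderiv ℝ v x‖ ^ p := (measurable_fderiv ℝ v).norm.pow_const p
  have h2 : Measurable fun x => |v x| ^ p := hv.measurable.abs.pow_const p
  exact (h1.add (h2.const_mul a)).ennreal_ofReal

/-- Some ray carries no more energy than its boundary contribution. -/
theorem exists_ray_energy_le (hn : 1 ≤ n) {p a b R : ℝ} (hp : 0 < p) (hR : 0 < R) (ha : 0 < a)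
    {v : E → ℝ} {K : ℝ≥0} (hv : LipschitzWith K v) (hpos : ∃ x ∈ ball (0 : E) R, v x ≠ 0)
    (hle : ∫⁻ x in ball (0 : E) R, energyDensity p a v x ≤
      ENNReal.ofReal b * ∫⁻ x in sphere (0 : E) R, ENNReal.ofReal (|v x| ^ p) ∂μHE[n - 1]) :
    ∃ θ : E, ‖θ‖ = 1 ∧ (∀ᵐ r : ℝ ∂volume.restrict (Ioi 0), DifferentiableAt ℝ v (r • θ)) ∧
      (∫⁻ r in Ioo (0 : ℝ) R, ENNReal.ofReal (r ^ (n - 1)) * energyDensity p a v (r • θ) ≤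
        ENNReal.ofReal b * (ENNReal.ofReal (R ^ (n - 1)) * ENNReal.ofReal (|v (R • θ)| ^ p))) ∧
      v (R • θ) ≠ 0 := by
  set σ := (volume : Measure E).toSphere
  set G : sphere (0 : E) 1 → ℝ≥0∞ := fun θ => ∫⁻ r in Ioo (0 : ℝ) R,
    ENNReal.ofReal (r ^ (n - 1)) * energyDensity p a v (r • (θ : E)) with hG
  set H : sphere (0 : E) 1 → ℝ≥0∞ := fun θ =>
    ENNReal.ofReal b * (ENNReal.ofReal (R ^ (n - 1)) * ENNReal.ofReal (|v (R • (θ : E))| ^ p))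
    with hH
  have hvc := hv.continuous
  have hgm := measurable_energyDensity (p := p) (a := a) hvc
  have hvm : Measurable fun x : E => ENNReal.ofReal (|v x| ^ p) :=
    (hvc.measurable.abs.pow_const p).ennreal_ofReal
  have hHm : Measurable H := ((hvm.comp (by fun_prop : Measurable fun θ : sphere (0 : E) 1 =>
    R • (θ : E))).const_mul _).const_mul _
  have hGm : Measurable G := by
    refine Measurable.lintegral_prod_right' (f := fun q : sphere (0 : E) 1 × ℝ =>
      ENNReal.ofReal (q.2 ^ (n - 1)) * energyDensity p a v (q.2 • (q.1 : E))) ?_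
    exact (by fun_prop : Measurable fun q : sphere (0 : E) 1 × ℝ =>
      ENNReal.ofReal (q.2 ^ (n - 1))).mul (hgm.comp (by fun_prop))
  have hGH : ∫⁻ θ, G θ ∂σ ≤ ∫⁻ θ, H θ ∂σ := by
    rw [← setLIntegral_ball_polar hn hgm R]
    refine hle.trans ?_
    have hm2 : Measurable fun θ : sphere (0 : E) 1 => ENNReal.ofReal (|v (R • (θ : E))| ^ p) :=
      hvm.comp (by fun_prop)
    rw [hH, lintegral_const_mul _ (hm2.const_mul _), lintegral_const_mul _ hm2]
    gcongr
    exact lintegral_sphere_le hR hvm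
  obtain ⟨M, hM⟩ : ∃ M : ℝ, ∀ x ∈ closedBall (0 : E) R, |v x| ^ p ≤ M := by
    have hc : Continuous fun x : E => |v x| ^ p := hvc.abs.rpow_const fun _ => Or.inr hp.le
    obtain ⟨M, hM⟩ := (isCompact_closedBall (0 : E) R).bddAbove_image hc.continuousOn
    exact ⟨M, fun x hx => hM ⟨x, hx, rfl⟩⟩
  have hHfin : ∫⁻ θ, H θ ∂σ ≠ ⊤ := by
    refine ne_top_of_le_ne_top ?_ (lintegral_mono (g := fun _ => ENNReal.ofReal b *
      (ENNReal.ofReal (R ^ (n - 1)) * ENNReal.ofReal M)) fun θ => ?_)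
    · rw [lintegral_const]
      exact ENNReal.mul_ne_top (ENNReal.mul_ne_top ENNReal.ofReal_ne_top
        (ENNReal.mul_ne_top ENNReal.ofReal_ne_top ENNReal.ofReal_ne_top)) (measure_ne_top _ _)
    · simp only [hH]
      gcongr
      exact hM _ (by simp [norm_smul, abs_of_pos hR])
  have hN : volume {x : E | ¬ DifferentiableAt ℝ v x} = 0 := hv.ae_differentiableAt
  have hNm : MeasurableSet {x : E | ¬ DifferentiableAt ℝ v x} :=
    (measurableSet_of_differentiableAt ℝ v).compl
  have hray := ae_ray_notMem hn hNm hN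
  by_contra! hcon
  have hdich : ∀ᵐ θ ∂σ, H θ < G θ ∨ v (R • (θ : E)) = 0 := by
    filter_upwards [hray] with θ hθ
    by_contra! hc
    exact hc.2 (hcon θ (by simp) (hθ.mono fun r hr => by simpa using hr) hc.1)
  have hH0 : ∀ θ : sphere (0 : E) 1, v (R • (θ : E)) = 0 → H θ = 0 := fun θ hθ => by
    simp [hH, hθ, Real.zero_rpow hp.ne']
  have hHG : H ≤ᵐ[σ] G := hdich.mono fun θ hθ => hθ.elim le_of_lt fun h => by
    rw [hH0 θ h]; exact zero_le
  have heq := ae_eq_of_ae_le_of_lintegral_le hHG hHfin hGm.aemeasurable hGH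
  have hG0 : ∫⁻ θ, G θ ∂σ = 0 := by
    rw [lintegral_eq_zero_iff hGm]
    filter_upwards [hdich, heq] with θ h1 h2
    have h3 := h1.resolve_left (by rw [h2]; exact lt_irrefl _)
    rw [← h2, hH0 θ h3, Pi.zero_apply]
  rw [← setLIntegral_ball_polar hn hgm R, setLIntegral_eq_zero_iff measurableSet_ball hgm] at hG0
  have hopen : IsOpen (ball (0 : E) R ∩ {x | v x ≠ 0}) :=
    isOpen_ball.inter (isOpen_ne_fun hvc continuous_const)
  obtain ⟨x, hx⟩ := hpos
  refine (hopen.measure_pos volume ⟨x, hx⟩).ne' (measure_mono_null ?_ (ae_iff.1 hG0))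
  rintro y ⟨hy, hy0⟩ hcon
  have h1 := hcon hy
  rw [energyDensity, ENNReal.ofReal_eq_zero] at h1
  have h2 : 0 < a * |v y| ^ p := mul_pos ha (Real.rpow_pos_of_pos (abs_pos.2 hy0) p)
  have h3 : 0 ≤ ‖fderiv ℝ v y‖ ^ p := by positivity
  linarith

/-- Transplantation of a function along a ray of the ball to the level sets of the distance to the
boundary of a convex body. -/
theorem exists_transplant (hn : 2 ≤ n) {p a b R : ℝ} (hp : 0 < p) (hR : 0 < R) (ha : 0 < a)
    {Ω : Set E} (hΩ : IsOpenConvexBody Ω) (hne : Ω.Nonempty)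
    (hper : μHE[n - 1] (frontier Ω) = μHE[n - 1] (sphere (0 : E) R))
    {v : E → ℝ} {K : ℝ≥0} (hv : LipschitzWith K v) (hpos : ∃ x ∈ ball (0 : E) R, v x ≠ 0)
    (hle : ∫⁻ x in ball (0 : E) R, energyDensity p a v x ≤
      ENNReal.ofReal b * ∫⁻ x in sphere (0 : E) R, ENNReal.ofReal (|v x| ^ p) ∂μHE[n - 1]) :
    ∃ u : E → ℝ, (∃ K' : ℝ≥0, LipschitzWith K' u) ∧ (∃ x ∈ Ω, u x ≠ 0) ∧
      ∫⁻ x in Ω, energyDensity p a u x ≤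
        ENNReal.ofReal b * ∫⁻ x in frontier Ω, ENNReal.ofReal (|u x| ^ p) ∂μHE[n - 1] := by
  have hn1 : 1 ≤ n := by omega
  have hap := hasApproxPerimeterLE_of_frontier_le hn1 hΩ hne hR hper.le
  obtain ⟨θ, hθ, hdiff, hE, hvR⟩ := exists_ray_energy_le hn1 hp hR ha hv hpos hle
  set u : E → ℝ := fun x => v ((R - infDist x Ωᶜ) • θ) with hu
  have hd : LipschitzWith 1 fun x : E => infDist x Ωᶜ := lipschitz_infDist_pt _
  have huL : LipschitzWith K u := by
    refine LipschitzWith.of_dist_le_mul fun x y => (hv.dist_le_mul _ _).trans ?_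
    gcongr
    rw [dist_eq_norm, ← sub_smul, norm_smul, hθ, mul_one, sub_sub_sub_cancel_left]
    have := hd.dist_le_mul y x
    rwa [NNReal.coe_one, one_mul, Real.dist_eq, dist_comm] at this
  have hfr : ∀ x ∈ frontier Ω, u x = v (R • θ) := by
    intro x hx
    have h1 : infDist x Ωᶜ = 0 := infDist_zero_of_mem (hΩ.isOpen.frontier_eq ▸ hx).2
    simp only [hu, h1, sub_zero]
  have hgm := measurable_energyDensity (p := p) (a := a) hv.continuous
  have hbad : ∀ᵐ x ∂volume.restrict Ω, DifferentiableAt ℝ v ((R - infDist x Ωᶜ) • θ) := by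
    have hNm : MeasurableSet {r : ℝ | ¬ DifferentiableAt ℝ v (r • θ)} :=
      (measurableSet_of_differentiableAt ℝ v).compl.preimage
        (by fun_prop : Measurable fun r : ℝ => r • θ)
    have hwm : Measurable ({r : ℝ | ¬ DifferentiableAt ℝ v (r • θ)}.indicator
      (1 : ℝ → ℝ≥0∞)) := measurable_one.indicator hNm
    have h1 := lintegral_sub_infDist_le hn hΩ hR hap hwm
    rw [setLIntegral_ball_norm hn1 hwm R] at h1
    have h2 : ∫⁻ r in Ioo (0 : ℝ) R, ENNReal.ofReal (r ^ (n - 1)) *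
        {r : ℝ | ¬ DifferentiableAt ℝ v (r • θ)}.indicator 1 r = 0 := by
      refine lintegral_eq_zero_of_ae_eq_zero ?_
      filter_upwards [ae_restrict_of_ae_restrict_of_subset Ioo_subset_Ioi_self hdiff] with r hr
      rw [indicator_of_notMem (by simpa using hr), mul_zero, Pi.zero_apply]
    have hwd : Measurable fun x : E => {r : ℝ | ¬ DifferentiableAt ℝ v (r • θ)}.indicator
        (1 : ℝ → ℝ≥0∞) (R - infDist x Ωᶜ) :=
      hwm.comp (measurable_const.sub measurable_infDist)
    rw [h2, mul_zero, nonpos_iff_eq_zero, lintegral_eq_zero_iff hwd] at h1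
    filter_upwards [h1] with x hx
    by_contra hcon
    rw [indicator_of_mem (by exact hcon)] at hx
    simp at hx
  have hpt : ∀ᵐ x ∂volume.restrict Ω,
      energyDensity p a u x ≤ energyDensity p a v ((R - infDist x Ωᶜ) • θ) := by
    filter_upwards [hbad, ae_restrict_of_ae hd.ae_differentiableAt] with x hx hdx
    have h1 : HasFDerivAt (fun x : E => (R - infDist x Ωᶜ) • θ)
        ((-fderiv ℝ (fun x : E => infDist x Ωᶜ) x).smulRight θ) x := by
      have := (hdx.hasFDerivAt.const_sub R).smul_const θ
      exact this
    have h2 := hx.hasFDerivAt.comp x h1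
    have h3 : ‖fderiv ℝ u x‖ ≤ ‖fderiv ℝ v ((R - infDist x Ωᶜ) • θ)‖ := by
      have h4 : fderiv ℝ u x = (fderiv ℝ v ((R - infDist x Ωᶜ) • θ)).comp
        ((-fderiv ℝ (fun x : E => infDist x Ωᶜ) x).smulRight θ) := h2.fderiv
      rw [h4]
      refine (ContinuousLinearMap.opNorm_comp_le _ _).trans
        (mul_le_of_le_one_right (norm_nonneg _) ?_)
      rw [ContinuousLinearMap.norm_smulRight_apply, hθ, mul_one, norm_neg]
      simpa using norm_fderiv_le_of_lipschitz ℝ hd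
    refine ENNReal.ofReal_le_ofReal (add_le_add ?_ le_rfl)
    exact Real.rpow_le_rpow (norm_nonneg _) h3 hp.le
  refine ⟨u, ⟨K, huL⟩, ?_, ?_⟩
  · have hfne : (frontier Ω).Nonempty := by
      exact nonempty_frontier_iff.2 ⟨hne, nonempty_compl.1 (hΩ.compl_nonempty hn1)⟩
    obtain ⟨z, hz⟩ := hfne
    have hopen : IsOpen {x | u x ≠ 0} := isOpen_ne_fun huL.continuous continuous_const
    obtain ⟨x, hx, hxΩ⟩ := mem_closure_iff.1 (frontier_subset_closure hz) _ hopen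
      (by simpa [hfr z hz] using hvR)
    exact ⟨x, hxΩ, hx⟩
  · set w : ℝ → ℝ≥0∞ := fun r => energyDensity p a v (r • θ) with hw
    have hwm : Measurable w := hgm.comp (by fun_prop)
    have h1 := lintegral_sub_infDist_le hn hΩ hR hap hwm
    rw [setLIntegral_ball_norm hn1 hwm R] at h1
    refine ((lintegral_mono_ae hpt).trans h1).trans ((mul_le_mul' le_rfl hE).trans_eq ?_)
    rw [setLIntegral_congr_fun isClosed_frontier.measurableSet
      (g := fun _ => ENNReal.ofReal (|v (R • θ)| ^ p)) fun x hx => by simp only [hfr x hx],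
      setLIntegral_const, hper, euclideanHausdorffMeasure_sphere hn1 hR,
      ENNReal.ofReal_mul (p := n * volume.real (ball (0 : E) 1)) (by positivity)]
    ring

end comparison

section trace

/-- The value of a Lipschitz function at the end of an interval is controlled by its `W^{1,p}` norm
on the interval. -/
theorem ofReal_mul_enorm_rpow_le {p h : ℝ} (hp : 1 ≤ p) (hh : 0 < h) {φ : ℝ → ℝ} {K : ℝ≥0}
    (hφ : LipschitzWith K φ) (ρ : ℝ) :
    ENNReal.ofReal h * ‖φ ρ‖ₑ ^ p ≤ 2 ^ (p - 1) * ((∫⁻ r in Ioo (ρ - h) ρ, ‖φ r‖ₑ ^ p) +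
      ENNReal.ofReal h ^ p * ∫⁻ r in Ioo (ρ - h) ρ, ‖deriv φ r‖ₑ ^ p) := by
  have hp0 : 0 < p := zero_lt_one.trans_le hp
  set D := ∫⁻ r in Ioo (ρ - h) ρ, ‖deriv φ r‖ₑ ^ p with hD
  have hvol : volume (Ioo (ρ - h) ρ) = ENNReal.ofReal h := by simp
  have hdm : Measurable (deriv φ) := measurable_deriv φ
  have hh0 : ENNReal.ofReal h ≠ 0 := by simpa using hh
  have holder : (∫⁻ r in Ioo (ρ - h) ρ, ‖deriv φ r‖ₑ) ^ p ≤ D * ENNReal.ofReal h ^ (p - 1) := by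
    have h1 := eLpNorm'_le_eLpNorm'_mul_rpow_measure_univ (μ := volume.restrict (Ioo (ρ - h) ρ))
      zero_lt_one hp hdm.aestronglyMeasurable
    rw [eLpNorm', eLpNorm', Measure.restrict_apply_univ, hvol] at h1
    simp only [ENNReal.rpow_one, one_div, inv_one] at h1
    refine (ENNReal.rpow_le_rpow h1 hp0.le).trans_eq ?_
    rw [ENNReal.mul_rpow_of_nonneg _ _ hp0.le, ← ENNReal.rpow_mul, ← ENNReal.rpow_mul,
      inv_mul_cancel₀ hp0.ne', ENNReal.rpow_one]
    congr 2
    field_simp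
  have point : ∀ r ∈ Ioo (ρ - h) ρ,
      ‖φ ρ‖ₑ ^ p ≤ 2 ^ (p - 1) * (‖φ r‖ₑ ^ p + D * ENNReal.ofReal h ^ (p - 1)) := by
    intro r hr
    have hftc : ∫ x in r..ρ, deriv φ x = φ ρ - φ r :=
      (hφ.lipschitzOnWith.absolutelyContinuousOnInterval).integral_deriv_eq_sub
    have h2 : ‖φ ρ - φ r‖ₑ ≤ ∫⁻ r in Ioo (ρ - h) ρ, ‖deriv φ r‖ₑ := by
      rw [← hftc, intervalIntegral.integral_of_le hr.2.le]
      refine (enorm_integral_le_lintegral_enorm _).trans ?_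
      rw [setLIntegral_congr Ioo_ae_eq_Ioc.symm]
      exact lintegral_mono_set (Ioo_subset_Ioo_left hr.1.le)
    calc ‖φ ρ‖ₑ ^ p = ‖φ r + (φ ρ - φ r)‖ₑ ^ p := by rw [add_sub_cancel]
      _ ≤ (‖φ r‖ₑ + ∫⁻ r in Ioo (ρ - h) ρ, ‖deriv φ r‖ₑ) ^ p := by
          gcongr
          exact (enorm_add_le _ _).trans (by gcongr)
      _ ≤ _ := (ENNReal.rpow_add_le_mul_rpow_add_rpow _ _ hp).trans (by gcongr)
  calc ENNReal.ofReal h * ‖φ ρ‖ₑ ^ p = ∫⁻ _ in Ioo (ρ - h) ρ, ‖φ ρ‖ₑ ^ p := by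
        rw [setLIntegral_const, hvol, mul_comm]
    _ ≤ ∫⁻ r in Ioo (ρ - h) ρ, 2 ^ (p - 1) * (‖φ r‖ₑ ^ p + D * ENNReal.ofReal h ^ (p - 1)) :=
        setLIntegral_mono' measurableSet_Ioo point
    _ = 2 ^ (p - 1) * ((∫⁻ r in Ioo (ρ - h) ρ, ‖φ r‖ₑ ^ p) +
          D * ENNReal.ofReal h ^ (p - 1) * ENNReal.ofReal h) := by
        rw [lintegral_const_mul' _ _ (by finiteness), lintegral_add_right _ measurable_const,
          setLIntegral_const, hvol]
    _ = _ := by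
        have : ENNReal.ofReal h ^ p = ENNReal.ofReal h ^ (p - 1) * ENNReal.ofReal h := by
          conv_rhs => rw [← ENNReal.rpow_one (ENNReal.ofReal h), ← ENNReal.rpow_mul, one_mul]
          rw [← ENNReal.rpow_add _ _ hh0 ENNReal.ofReal_ne_top, sub_add_cancel]
        rw [this]
        ring

variable {n : ℕ}
local notation "E" => EuclideanSpace ℝ (Fin n)

/-- The radial projection of the unit sphere to the boundary of a convex body is Lipschitz. -/
theorem exists_lipschitzOnWith_radial {Ω : Set E} (hc : Convex ℝ Ω) {δ D : ℝ} (hδ : 0 < δ)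
    (hD : 0 < D) (hball : ball 0 δ ⊆ Ω) (hsub : Ω ⊆ closedBall 0 D) :
    ∃ L : ℝ≥0, LipschitzOnWith L (fun x => (gauge Ω x)⁻¹ • x) (sphere (0 : E) 1) := by
  have h0 : Ω ∈ nhds (0 : E) := Filter.mem_of_superset (ball_mem_nhds 0 hδ) hball
  have habs : Absorbent ℝ Ω := absorbent_nhds_zero h0
  have hlip := hc.lipschitzWith_gauge (r := ⟨δ, hδ.le⟩) hδ hball
  have hge : ∀ x ∈ sphere (0 : E) 1, D⁻¹ ≤ gauge Ω x := fun x hx => by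
    have := le_gauge_of_subset_closedBall (x := x) habs hD.le hsub
    have hx1 : ‖x‖ = 1 := by simpa using hx
    rwa [hx1, one_div] at this
  have hDi : 0 < D⁻¹ := inv_pos.2 hD
  refine ⟨⟨D * D * δ⁻¹ + D, by positivity⟩, LipschitzOnWith.of_dist_le_mul fun x hx y hy => ?_⟩
  have hgx := hge x hx
  have hgy := hge y hy
  have hx0 := hDi.trans_le hgx
  have hy0 := hDi.trans_le hgy
  have hx1 : ‖x‖ = 1 := by simpa using hx
  have hix : (gauge Ω x)⁻¹ ≤ D := inv_le_of_inv_le₀ hD hgx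
  have hiy : (gauge Ω y)⁻¹ ≤ D := inv_le_of_inv_le₀ hD hgy
  have hg : |gauge Ω y - gauge Ω x| ≤ δ⁻¹ * ‖x - y‖ := by
    have := hlip.dist_le_mul x y
    rw [dist_comm, Real.dist_eq, dist_eq_norm] at this
    exact this
  rw [dist_eq_norm, dist_eq_norm]
  calc ‖(gauge Ω x)⁻¹ • x - (gauge Ω y)⁻¹ • y‖
      = ‖((gauge Ω x)⁻¹ * (gauge Ω y)⁻¹ * (gauge Ω y - gauge Ω x)) • x +
          (gauge Ω y)⁻¹ • (x - y)‖ := by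
        congr 1
        have : (gauge Ω x)⁻¹ * (gauge Ω y)⁻¹ * (gauge Ω y - gauge Ω x) =
          (gauge Ω x)⁻¹ - (gauge Ω y)⁻¹ := by field_simp
        rw [this, sub_smul, smul_sub]
        abel
    _ ≤ (gauge Ω x)⁻¹ * (gauge Ω y)⁻¹ * |gauge Ω y - gauge Ω x| * 1 +
          (gauge Ω y)⁻¹ * ‖x - y‖ := by
        refine (norm_add_le _ _).trans_eq ?_
        rw [norm_smul, norm_smul, hx1, norm_mul, norm_mul, Real.norm_eq_abs, Real.norm_eq_abs,
          Real.norm_eq_abs, abs_of_pos (inv_pos.2 hx0), abs_of_pos (inv_pos.2 hy0)]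
    _ ≤ D * D * (δ⁻¹ * ‖x - y‖) * 1 + D * ‖x - y‖ := by gcongr
    _ = (D * D * δ⁻¹ + D) * ‖x - y‖ := by ring

theorem frontier_subset_image_radial {Ω : Set E} (hc : Convex ℝ Ω) (h0 : Ω ∈ nhds (0 : E))
    {x : E} (hx : x ∈ frontier Ω) :
    ∃ θ : sphere (0 : E) 1, (gauge Ω (θ : E))⁻¹ • (θ : E) = x := by
  have hg : gauge Ω x = 1 := (gauge_eq_one_iff_mem_frontier hc h0).2 hx
  have hx0 : ‖x‖ ≠ 0 := by
    intro h
    rw [norm_eq_zero.1 h, gauge_zero] at hg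
    exact zero_ne_one hg
  refine ⟨⟨‖x‖⁻¹ • x, by simp [norm_smul, hx0]⟩, ?_⟩
  simp only
  rw [gauge_smul_of_nonneg (inv_nonneg.2 (norm_nonneg x)), hg, smul_smul]
  simp [hx0]

theorem lintegral_frontier_le {Ω : Set E} (hc : Convex ℝ Ω) (h0 : Ω ∈ nhds (0 : E)) {L : ℝ≥0}
    (hL : LipschitzOnWith L (fun x => (gauge Ω x)⁻¹ • x) (sphere (0 : E) 1))
    {f : E → ℝ≥0∞} (hf : Measurable f) :
    ∫⁻ x in frontier Ω, f x ∂μHE[n - 1] ≤ (L : ℝ≥0∞) ^ (n - 1) *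
      ∫⁻ θ : sphere (0 : E) 1, f ((gauge Ω (θ : E))⁻¹ • (θ : E)) ∂(volume : Measure E).toSphere := by
  have hg : Measurable fun θ : sphere (0 : E) 1 => (gauge Ω (θ : E))⁻¹ • (θ : E) :=
    (((continuous_gauge hc h0).measurable.comp measurable_subtype_coe).inv).smul
      measurable_subtype_coe
  rw [← lintegral_map hf hg, ← smul_eq_mul, ← lintegral_smul_measure]
  refine lintegral_mono' (Measure.le_iff.2 fun B hB => ?_) le_rfl
  rw [Measure.restrict_apply hB, Measure.smul_apply, Measure.map_apply hg hB, smul_eq_mul]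
  set T := (fun θ : sphere (0 : E) 1 => (gauge Ω (θ : E))⁻¹ • (θ : E)) ⁻¹' B with hT
  have h1 : B ∩ frontier Ω ⊆ (fun x => (gauge Ω x)⁻¹ • x) ''
      (((↑) : sphere (0 : E) 1 → E) '' T) := by
    rintro x ⟨hxB, hx⟩
    obtain ⟨θ, rfl⟩ := frontier_subset_image_radial hc h0 hx
    exact ⟨θ, ⟨θ, hxB, rfl⟩, rfl⟩
  refine (measure_mono h1).trans ((euclideanHausdorffMeasure_image_le_of_lipschitz
    (hL.mono ?_) _).trans ?_)
  · rintro _ ⟨θ, -, rfl⟩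
    exact θ.2
  · gcongr
    exact euclideanHausdorffMeasure_image_le_toSphere (hg hB)

end trace

section trace
variable {n : ℕ}
local notation "E" => EuclideanSpace ℝ (Fin n)

/-- A trace inequality on convex bodies containing a ball around the origin. -/
theorem exists_trace_le_of_ball (hn : 1 ≤ n) {p : ℝ} (hp : 1 ≤ p) {Ω : Set E}
    (hΩ : IsOpenConvexBody Ω) {δ : ℝ} (hδ : 0 < δ) (hball : ball 0 δ ⊆ Ω) :
    ∃ C : ℝ≥0∞, C ≠ ⊤ ∧ ∀ h : ℝ, 0 < h → h ≤ δ / 2 → ∀ (u : E → ℝ) (K : ℝ≥0), LipschitzWith K u →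
      ENNReal.ofReal h * ∫⁻ x in frontier Ω, ‖u x‖ₑ ^ p ∂μHE[n - 1] ≤
        C * ∫⁻ x in Ω, (‖u x‖ₑ ^ p + ENNReal.ofReal h ^ p * ‖fderiv ℝ u x‖ₑ ^ p) := by
  have hc := hΩ.convex
  have hp0 : 0 < p := zero_lt_one.trans_le hp
  have h0 : Ω ∈ nhds (0 : E) := Filter.mem_of_superset (ball_mem_nhds 0 hδ) hball
  obtain ⟨D, hD0, hD⟩ := hΩ.isBounded.subset_closedBall_lt 0 (0 : E)
  obtain ⟨L, hL⟩ := exists_lipschitzOnWith_radial hc hδ hD0 hball hD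
  have habs : Absorbent ℝ Ω := absorbent_nhds_zero h0
  have hδn : 0 < (δ / 2) ^ (n - 1) := by positivity
  refine ⟨(L : ℝ≥0∞) ^ (n - 1) * (2 ^ (p - 1) * (ENNReal.ofReal ((δ / 2) ^ (n - 1)))⁻¹), ?_,
    fun h hh hhδ u K hu => ?_⟩
  · have : ENNReal.ofReal ((δ / 2) ^ (n - 1)) ≠ 0 := by simpa using hδn
    finiteness
  set w : E → ℝ≥0∞ := fun x => ‖u x‖ₑ ^ p + ENNReal.ofReal h ^ p * ‖fderiv ℝ u x‖ₑ ^ p with hw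
  have hum : Measurable fun x => ‖u x‖ₑ ^ p := hu.continuous.measurable.enorm.pow_const p
  have hwm : Measurable w :=
    hum.add (((measurable_fderiv ℝ u).enorm.pow_const p).const_mul _)
  have hwi : Measurable (Ω.indicator w) := hwm.indicator hΩ.isOpen.measurableSet
  have hN : volume {x : E | ¬ DifferentiableAt ℝ u x} = 0 := hu.ae_differentiableAt
  have hNm : MeasurableSet {x : E | ¬ DifferentiableAt ℝ u x} :=
    (measurableSet_of_differentiableAt ℝ u).compl
  have ray : ∀ᵐ θ : sphere (0 : E) 1 ∂(volume : Measure E).toSphere,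
      ENNReal.ofReal h * ‖u ((gauge Ω (θ : E))⁻¹ • (θ : E))‖ₑ ^ p ≤
      2 ^ (p - 1) * (ENNReal.ofReal ((δ / 2) ^ (n - 1)))⁻¹ *
        ∫⁻ r in Ioi (0 : ℝ), ENNReal.ofReal (r ^ (n - 1)) * Ω.indicator w (r • (θ : E)) := by
    filter_upwards [ae_ray_notMem hn hNm hN] with θ hθ
    have hθ1 : ‖(θ : E)‖ = 1 := by simp
    have hg0 : 0 < gauge Ω (θ : E) := by
      have := le_gauge_of_subset_closedBall (x := (θ : E)) habs hD0.le hD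
      rw [hθ1] at this
      exact lt_of_lt_of_le (by positivity) this
    have hgδ : δ * gauge Ω (θ : E) ≤ 1 := by
      have := mul_gauge_le_norm (x := (θ : E)) hball
      rwa [hθ1] at this
    set ρ := (gauge Ω (θ : E))⁻¹ with hρ
    have hρδ : δ ≤ ρ := by
      rw [hρ, ← one_div, le_div_iff₀ hg0]
      exact hgδ
    have hpos : ∀ r ∈ Ioo (ρ - h) ρ, δ / 2 ≤ r := fun r hr => by linarith [hr.1]
    have hφ : LipschitzWith K fun r : ℝ => u (r • (θ : E)) := by
      refine LipschitzWith.of_dist_le_mul fun r s => (hu.dist_le_mul _ _).trans_eq ?_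
      rw [dist_eq_norm, ← sub_smul, norm_smul, hθ1, mul_one, ← dist_eq_norm]
    have hmem : ∀ r ∈ Ioo (ρ - h) ρ, r • (θ : E) ∈ Ω := fun r hr => by
      have hr0 : 0 < r := (half_pos hδ).trans_le (hpos r hr)
      rw [← hΩ.isOpen.interior_eq, ← gauge_lt_one_iff_mem_interior hc h0,
        gauge_smul_of_nonneg hr0.le, smul_eq_mul]
      calc r * gauge Ω (θ : E) < ρ * gauge Ω (θ : E) := by gcongr; exact hr.2
        _ = 1 := inv_mul_cancel₀ hg0.ne'
    have h_int : ∀ᵐ r ∂volume.restrict (Ioo (ρ - h) ρ),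
        ‖u (r • (θ : E))‖ₑ ^ p +
          ENNReal.ofReal h ^ p * ‖deriv (fun r : ℝ => u (r • (θ : E))) r‖ₑ ^ p ≤
        (ENNReal.ofReal ((δ / 2) ^ (n - 1)))⁻¹ *
          (ENNReal.ofReal (r ^ (n - 1)) * Ω.indicator w (r • (θ : E))) := by
      have hsub : Ioo (ρ - h) ρ ⊆ Ioi 0 := fun r hr => (half_pos hδ).trans_le (hpos r hr)
      filter_upwards [ae_restrict_of_ae_restrict_of_subset hsub hθ,
        ae_restrict_mem measurableSet_Ioo] with r hd hr
      have hd' : DifferentiableAt ℝ u (r • (θ : E)) := by simpa using hd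
      have hderiv : HasDerivAt (fun r : ℝ => u (r • (θ : E)))
          (fderiv ℝ u (r • (θ : E)) (θ : E)) r := by
        have h2 : HasDerivAt (fun r : ℝ => r • (θ : E)) (θ : E) r := by
          simpa using (hasDerivAt_id r).smul_const (θ : E)
        exact hd'.hasFDerivAt.comp_hasDerivAt r h2
      have hle : ‖deriv (fun r : ℝ => u (r • (θ : E))) r‖ₑ ≤ ‖fderiv ℝ u (r • (θ : E))‖ₑ := by
        rw [hderiv.deriv, enorm_le_iff_norm_le]
        simpa [hθ1] using (fderiv ℝ u (r • (θ : E))).le_opNorm (θ : E)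
      have hone : 1 ≤ (ENNReal.ofReal ((δ / 2) ^ (n - 1)))⁻¹ * ENNReal.ofReal (r ^ (n - 1)) := by
        rw [← ENNReal.inv_mul_cancel (by simpa using hδn) ENNReal.ofReal_ne_top]
        gcongr
        exact hpos r hr
      rw [indicator_of_mem (hmem r hr), ← mul_assoc]
      refine le_trans ?_ (le_mul_of_one_le_left zero_le hone)
      simp only [hw]
      gcongr
    calc ENNReal.ofReal h * ‖u (ρ • (θ : E))‖ₑ ^ p
        ≤ 2 ^ (p - 1) * ((∫⁻ r in Ioo (ρ - h) ρ, ‖u (r • (θ : E))‖ₑ ^ p) +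
          ENNReal.ofReal h ^ p *
            ∫⁻ r in Ioo (ρ - h) ρ, ‖deriv (fun r : ℝ => u (r • (θ : E))) r‖ₑ ^ p) :=
          ofReal_mul_enorm_rpow_le hp hh hφ ρ
      _ = 2 ^ (p - 1) * ∫⁻ r in Ioo (ρ - h) ρ, (‖u (r • (θ : E))‖ₑ ^ p +
          ENNReal.ofReal h ^ p * ‖deriv (fun r : ℝ => u (r • (θ : E))) r‖ₑ ^ p) := by
          rw [← lintegral_const_mul' _ _ (by finiteness), lintegral_add_left]
          exact hφ.continuous.measurable.enorm.pow_const p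
      _ ≤ 2 ^ (p - 1) * ∫⁻ r in Ioo (ρ - h) ρ, (ENNReal.ofReal ((δ / 2) ^ (n - 1)))⁻¹ *
          (ENNReal.ofReal (r ^ (n - 1)) * Ω.indicator w (r • (θ : E))) := by
          exact mul_le_mul_right (lintegral_mono_ae h_int) _
      _ ≤ _ := by
          rw [lintegral_const_mul' _ _ (by simpa using hδn), mul_assoc]
          gcongr
          exact fun r hr => (half_pos hδ).trans_le (hpos r hr)
  calc ENNReal.ofReal h * ∫⁻ x in frontier Ω, ‖u x‖ₑ ^ p ∂μHE[n - 1]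
      ≤ ENNReal.ofReal h * ((L : ℝ≥0∞) ^ (n - 1) * ∫⁻ θ : sphere (0 : E) 1,
          ‖u ((gauge Ω (θ : E))⁻¹ • (θ : E))‖ₑ ^ p ∂(volume : Measure E).toSphere) := by
        gcongr
        exact lintegral_frontier_le hc h0 hL hum
    _ = (L : ℝ≥0∞) ^ (n - 1) * ∫⁻ θ : sphere (0 : E) 1, ENNReal.ofReal h *
          ‖u ((gauge Ω (θ : E))⁻¹ • (θ : E))‖ₑ ^ p ∂(volume : Measure E).toSphere := by
        rw [lintegral_const_mul' _ _ ENNReal.ofReal_ne_top]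
        ring
    _ ≤ (L : ℝ≥0∞) ^ (n - 1) * ∫⁻ θ : sphere (0 : E) 1,
          2 ^ (p - 1) * (ENNReal.ofReal ((δ / 2) ^ (n - 1)))⁻¹ * (∫⁻ r in Ioi (0 : ℝ),
            ENNReal.ofReal (r ^ (n - 1)) * Ω.indicator w (r • (θ : E)))
            ∂(volume : Measure E).toSphere := by
        exact mul_le_mul_right (lintegral_mono_ae ray) _
    _ = _ := by
        rw [lintegral_const_mul', ← lintegral_polar hn hwi,
          lintegral_indicator hΩ.isOpen.measurableSet, mul_assoc, mul_assoc, mul_assoc]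
        have : ENNReal.ofReal ((δ / 2) ^ (n - 1)) ≠ 0 := by simpa using hδn
        finiteness

/-- A trace inequality on convex bodies. -/
theorem exists_trace_le (hn : 1 ≤ n) {p : ℝ} (hp : 1 ≤ p) {Ω : Set E}
    (hΩ : IsOpenConvexBody Ω) (hne : Ω.Nonempty) :
    ∃ (C : ℝ≥0∞) (δ : ℝ), C ≠ ⊤ ∧ 0 < δ ∧ ∀ h : ℝ, 0 < h → h ≤ δ → ∀ (u : E → ℝ) (K : ℝ≥0),
      LipschitzWith K u →
      ENNReal.ofReal h * ∫⁻ x in frontier Ω, ‖u x‖ₑ ^ p ∂μHE[n - 1] ≤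
        C * ∫⁻ x in Ω, (‖u x‖ₑ ^ p + ENNReal.ofReal h ^ p * ‖fderiv ℝ u x‖ₑ ^ p) := by
  obtain ⟨x₀, hx₀⟩ := hne
  set τ : E ≃ᵢ E := IsometryEquiv.addLeft x₀ with hτ
  have hτa : ∀ x, τ x = x₀ + x := fun x => rfl
  have hΩ' : IsOpenConvexBody (τ ⁻¹' Ω) := by
    refine ⟨hΩ.isOpen.preimage τ.continuous, ?_, hΩ.convex.translate_preimage_right x₀⟩
    rw [← τ.image_symm]
    exact τ.symm.isometry.lipschitz.isBounded_image hΩ.isBounded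
  have h0 : τ ⁻¹' Ω ∈ nhds (0 : E) := hΩ'.isOpen.mem_nhds (by simpa [hτa] using hx₀)
  obtain ⟨δ, hδ, hball⟩ := Metric.mem_nhds_iff.1 h0
  obtain ⟨C, hC, hC'⟩ := exists_trace_le_of_ball hn hp hΩ' hδ hball
  refine ⟨C, δ / 2, hC, by positivity, fun h hh hhδ u K hu => ?_⟩
  have huτ : LipschitzWith K fun x => u (τ x) := by
    have := hu.comp τ.isometry.lipschitz
    rwa [mul_one] at this
  have key := hC' h hh hhδ (fun x => u (τ x)) K huτ
  have hfd : ∀ x, fderiv ℝ (fun x => u (τ x)) x = fderiv ℝ u (τ x) := fun x => by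
    simp only [hτa]
    exact fderiv_comp_add_left x₀
  simp only [hfd] at key
  have hm1 : MeasurePreserving τ (μHE[n - 1] : Measure E) μHE[n - 1] :=
    τ.measurePreserving_euclideanHausdorffMeasure _
  have hm2 : MeasurePreserving τ (volume : Measure E) volume :=
    measurePreserving_add_left volume x₀
  have hemb : MeasurableEmbedding τ := τ.toHomeomorph.measurableEmbedding
  have hfr : frontier (τ ⁻¹' Ω) = τ ⁻¹' frontier Ω := (τ.toHomeomorph.preimage_frontier Ω).symm
  rw [hfr, hm1.setLIntegral_comp_preimage_emb hemb (fun x => ‖u x‖ₑ ^ p),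
    hm2.setLIntegral_comp_preimage_emb hemb
      (fun x => ‖u x‖ₑ ^ p + ENNReal.ofReal h ^ p * ‖fderiv ℝ u x‖ₑ ^ p)] at key
  exact key

end trace

section eigenvalue
variable {n : ℕ} {p : ℝ} {Ω : Set (EuclideanSpace ℝ (Fin n))} {u : EuclideanSpace ℝ (Fin n) → ℝ}
  {K : ℝ≥0}
local notation "E" => EuclideanSpace ℝ (Fin n)

theorem rayleigh_eq_toReal (hp : 0 < p) (hu : LipschitzWith K u) {c : ℝ≥0}
    (hc : (μH[(n : ℝ) - 1] : Measure E) = c • (μHE[n - 1] : Measure E)) (β : ℝ) :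
    rayleigh n p β Ω u = ((∫⁻ x in Ω, ‖fderiv ℝ u x‖ₑ ^ p).toReal +
      β * (c * (∫⁻ x in frontier Ω, ‖u x‖ₑ ^ p ∂μHE[n - 1]).toReal)) /
        (∫⁻ x in Ω, ‖u x‖ₑ ^ p).toReal := by
  have hm : Measurable fun x => |u x| ^ p := hu.continuous.measurable.abs.pow_const p
  have hmd : Measurable fun x => ‖fderiv ℝ u x‖ ^ p := (measurable_fderiv ℝ u).norm.pow_const p
  have h1 : ∀ x, ENNReal.ofReal (|u x| ^ p) = ‖u x‖ₑ ^ p := fun x => by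
    rw [← ENNReal.ofReal_rpow_of_nonneg (abs_nonneg _) hp.le, ← Real.norm_eq_abs,
      ofReal_norm]
  have h2 : ∀ x, ENNReal.ofReal (‖fderiv ℝ u x‖ ^ p) = ‖fderiv ℝ u x‖ₑ ^ p := fun x => by
    rw [← ENNReal.ofReal_rpow_of_nonneg (norm_nonneg _) hp.le, ofReal_norm]
  rw [rayleigh, hc, Measure.restrict_smul, integral_smul_nnreal_measure, NNReal.smul_def,
    smul_eq_mul,
    integral_eq_lintegral_of_nonneg_ae (Filter.Eventually.of_forall fun x => by positivity)
      hmd.aestronglyMeasurable,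
    integral_eq_lintegral_of_nonneg_ae (Filter.Eventually.of_forall fun x => by positivity)
      hm.aestronglyMeasurable,
    integral_eq_lintegral_of_nonneg_ae (Filter.Eventually.of_forall fun x => by positivity)
      hm.aestronglyMeasurable]
  simp only [h1, h2]

theorem integral_abs_rpow_eq_toReal (hp : 0 < p) (hu : LipschitzWith K u) :
    ∫ x in Ω, |u x| ^ p = (∫⁻ x in Ω, ‖u x‖ₑ ^ p).toReal := by
  have hm : Measurable fun x => |u x| ^ p := hu.continuous.measurable.abs.pow_const p
  rw [integral_eq_lintegral_of_nonneg_ae (Filter.Eventually.of_forall fun x => by positivity)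
      hm.aestronglyMeasurable]
  congr 1
  refine lintegral_congr fun x => ?_
  rw [← ENNReal.ofReal_rpow_of_nonneg (abs_nonneg _) hp.le, ← Real.norm_eq_abs,
    ofReal_norm]

theorem setLIntegral_energyDensity {a : ℝ} (hp : 0 < p) (ha : 0 ≤ a) :
    ∫⁻ x in Ω, energyDensity p a u x =
      (∫⁻ x in Ω, ‖fderiv ℝ u x‖ₑ ^ p) + ENNReal.ofReal a * ∫⁻ x in Ω, ‖u x‖ₑ ^ p := by
  rw [← lintegral_const_mul' _ _ ENNReal.ofReal_ne_top,
    ← lintegral_add_left ((measurable_fderiv ℝ u).enorm.pow_const p)]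
  refine lintegral_congr fun x => ?_
  rw [energyDensity, ENNReal.ofReal_add (by positivity) (by positivity), ENNReal.ofReal_mul ha,
    ← ENNReal.ofReal_rpow_of_nonneg (abs_nonneg _) hp.le, ← Real.norm_eq_abs,
    ofReal_norm, ← ENNReal.ofReal_rpow_of_nonneg (norm_nonneg _) hp.le,
    ofReal_norm]

theorem setLIntegral_enorm_fderiv_ne_top (hp : 0 < p) (hΩ : IsOpenConvexBody Ω)
    (hu : LipschitzWith K u) : ∫⁻ x in Ω, ‖fderiv ℝ u x‖ₑ ^ p ≠ ⊤ := by
  refine (setLIntegral_lt_top_of_le_nnreal hΩ.volume_ne_top ⟨K ^ p, fun x _ => ?_⟩).ne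
  rw [ENNReal.coe_rpow_of_nonneg _ hp.le]
  gcongr
  rw [enorm_le_coe]
  exact norm_fderiv_le_of_lipschitz ℝ hu

theorem setLIntegral_enorm_ne_top (hp : 0 < p) (hΩ : IsOpenConvexBody Ω)
    (hu : LipschitzWith K u) : ∫⁻ x in Ω, ‖u x‖ₑ ^ p ≠ ⊤ := by
  obtain ⟨M, hM⟩ := (hΩ.isBounded.isCompact_closure).bddAbove_image
    hu.continuous.nnnorm.continuousOn
  refine (setLIntegral_lt_top_of_le_nnreal hΩ.volume_ne_top ⟨M ^ p, fun x hx => ?_⟩).ne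
  rw [ENNReal.coe_rpow_of_nonneg _ hp.le]
  gcongr
  rw [enorm_le_coe]
  exact hM ⟨x, subset_closure hx, rfl⟩

theorem setLIntegral_frontier_enorm_ne_top (hn : 1 ≤ n) (hp : 1 ≤ p) (hΩ : IsOpenConvexBody Ω)
    (hne : Ω.Nonempty) (hu : LipschitzWith K u) :
    ∫⁻ x in frontier Ω, ‖u x‖ₑ ^ p ∂μHE[n - 1] ≠ ⊤ := by
  have hp0 : 0 < p := zero_lt_one.trans_le hp
  obtain ⟨C, δ, hC, hδ, h⟩ := exists_trace_le hn hp hΩ hne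
  intro htop
  have h1 := h δ hδ le_rfl u K hu
  rw [htop, ENNReal.mul_top (by simpa using hδ), top_le_iff,
    lintegral_add_left (hu.continuous.measurable.enorm.pow_const p),
    lintegral_const_mul' _ _ (by finiteness)] at h1
  have h2 := setLIntegral_enorm_fderiv_ne_top hp0 hΩ hu
  have h3 := setLIntegral_enorm_ne_top hp0 hΩ hu
  refine absurd h1 ?_
  finiteness

/-- Functions that are Lipschitz on the closure may be replaced by globally Lipschitz ones. -/
theorem exists_lipschitzWith_rayleigh_eq (hΩo : IsOpen Ω) (hu : LipschitzOnWith K u (closure Ω))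
    (p β : ℝ) : ∃ v : E → ℝ, LipschitzWith K v ∧
      (∫ x in Ω, |v x| ^ p = ∫ x in Ω, |u x| ^ p) ∧ rayleigh n p β Ω v = rayleigh n p β Ω u := by
  obtain ⟨v, hv, huv⟩ := hu.extend_real
  have hΩuv : EqOn u v Ω := huv.mono subset_closure
  have h1 : ∫ x in Ω, |v x| ^ p = ∫ x in Ω, |u x| ^ p :=
    setIntegral_congr_fun hΩo.measurableSet fun x hx => by simp only [hΩuv hx]
  have h2 : ∫ x in frontier Ω, |v x| ^ p ∂(μH[(n : ℝ) - 1]) =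
      ∫ x in frontier Ω, |u x| ^ p ∂(μH[(n : ℝ) - 1]) :=
    setIntegral_congr_fun isClosed_frontier.measurableSet fun x hx => by
      simp only [huv (frontier_subset_closure hx)]
  have h3 : ∫ x in Ω, ‖fderiv ℝ v x‖ ^ p = ∫ x in Ω, ‖fderiv ℝ u x‖ ^ p :=
    setIntegral_congr_fun hΩo.measurableSet fun x hx => by
      have : v =ᶠ[nhds x] u := (hΩuv.eventuallyEq_of_mem (hΩo.mem_nhds hx)).symm
      simp only [this.fderiv_eq]
  exact ⟨v, hv, h1, by rw [rayleigh, rayleigh, h1, h2, h3]⟩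

theorem bddBelow_rayleigh (hn : 1 ≤ n) (hp : 1 < p) {β : ℝ} (hβ : β < 0)
    (hΩ : IsOpenConvexBody Ω) (hne : Ω.Nonempty) :
    BddBelow { r : ℝ | ∃ u : E → ℝ, (∃ K : ℝ≥0, LipschitzOnWith K u (closure Ω)) ∧
      (0 < ∫ x in Ω, |u x| ^ p) ∧ r = rayleigh n p β Ω u } := by
  have hp0 : 0 < p := zero_lt_one.trans hp
  obtain ⟨c, -, hc⟩ := exists_hausdorffMeasure_eq_smul hn
  obtain ⟨C, δ, hC, hδ, htr⟩ := exists_trace_le hn hp.le hΩ hne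
  set b : ℝ := -β * c with hb
  have hb0 : 0 ≤ b := mul_nonneg (neg_nonneg.2 hβ.le) c.2
  set A : ℝ := b * C.toReal + 1 with hA
  have hC0 : 0 ≤ C.toReal := ENNReal.toReal_nonneg
  have hA0 : 0 < A := by positivity
  set h : ℝ := min δ (A⁻¹ ^ (p - 1)⁻¹) with hh
  have hh0 : 0 < h := lt_min hδ (by positivity)
  have hhp : h ^ (p - 1) ≤ A⁻¹ := by
    calc h ^ (p - 1) ≤ (A⁻¹ ^ (p - 1)⁻¹) ^ (p - 1) :=
          Real.rpow_le_rpow hh0.le (min_le_right _ _) (by linarith)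
      _ = A⁻¹ := Real.rpow_inv_rpow (by positivity) (by linarith)
  refine ⟨-(b * C.toReal / h), ?_⟩
  rintro _ ⟨u, ⟨K, hu⟩, hpos, rfl⟩
  obtain ⟨v, hv, hvu, hR⟩ := exists_lipschitzWith_rayleigh_eq hΩ.isOpen hu p β
  rw [← hvu, integral_abs_rpow_eq_toReal hp0 hv] at hpos
  rw [← hR, rayleigh_eq_toReal hp0 hv hc]
  have hG := setLIntegral_enorm_fderiv_ne_top hp0 hΩ hv
  have hM := setLIntegral_enorm_ne_top hp0 hΩ hv
  have hT := htr h hh0 (min_le_left _ _) v K hv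
  rw [lintegral_add_left (hv.continuous.measurable.enorm.pow_const p),
    lintegral_const_mul' _ _ (by finiteness)] at hT
  have hT' := ENNReal.toReal_mono (by finiteness) hT
  rw [ENNReal.toReal_mul, ENNReal.toReal_mul, ENNReal.toReal_add hM (by finiteness),
    ENNReal.toReal_mul, ← ENNReal.toReal_rpow, ENNReal.toReal_ofReal hh0.le] at hT'
  set G := (∫⁻ x in Ω, ‖fderiv ℝ v x‖ₑ ^ p).toReal
  set M := (∫⁻ x in Ω, ‖v x‖ₑ ^ p).toReal
  set T := (∫⁻ x in frontier Ω, ‖v x‖ₑ ^ p ∂μHE[n - 1]).toReal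
  have hG0 : 0 ≤ G := ENNReal.toReal_nonneg
  have hhh : h ^ p = h * h ^ (p - 1) := by
    rw [Real.rpow_sub_one hh0.ne', mul_div_cancel₀ _ hh0.ne']
  rw [le_div_iff₀ hpos]
  have e1 : b * T * h ≤ b * C.toReal * M + h * G := by
    have e2 : b * C.toReal * h ^ (p - 1) ≤ 1 := by
      calc b * C.toReal * h ^ (p - 1) ≤ A * A⁻¹ := by
            gcongr
            simp [hA]
        _ = 1 := mul_inv_cancel₀ hA0.ne'
    calc b * T * h = b * (h * T) := by ring
      _ ≤ b * (C.toReal * (M + h ^ p * G)) := by gcongr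
      _ = b * C.toReal * M + (b * C.toReal * h ^ (p - 1)) * (h * G) := by rw [hhh]; ring
      _ ≤ b * C.toReal * M + 1 * (h * G) := by gcongr
      _ = _ := by ring
  have e3 : b * T ≤ b * C.toReal / h * M + G := by
    rw [← mul_le_mul_iff_left₀ hh0]
    refine e1.trans_eq ?_
    field_simp
  have e4 : β * (c * T) = -(b * T) := by rw [hb]; ring
  rw [e4]
  linarith

end eigenvalue

section eigenvalue
variable {n : ℕ} {p : ℝ} {Ω : Set (EuclideanSpace ℝ (Fin n))}
local notation "E" => EuclideanSpace ℝ (Fin n)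

/-- Balls and convex bodies of equal perimeter have boundaries of equal Hausdorff measure. -/
theorem euclideanHausdorffMeasure_frontier_eq_of_perim_eq (hn : 1 ≤ n) {R : ℝ} (hR : 0 < R)
    (hper : perim n (ball (0 : E) R) = perim n Ω) :
    μHE[n - 1] (frontier Ω) = μHE[n - 1] (sphere (0 : E) R) := by
  obtain ⟨c, hc0, hc⟩ := exists_hausdorffMeasure_eq_smul hn
  have : Nonempty (Fin n) := ⟨⟨0, hn⟩⟩
  rw [perim, perim, hc, frontier_ball 0 hR.ne', Measure.smul_apply, Measure.smul_apply,
    ENNReal.smul_def, smul_eq_mul, ENNReal.smul_def, smul_eq_mul, ENNReal.toReal_mul,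
    ENNReal.toReal_mul] at hper
  have hper' := mul_left_cancel₀ (by simpa using hc0) hper
  have hω : 0 < volume.real (ball (0 : E) 1) :=
    ENNReal.toReal_pos (measure_ball_pos _ _ zero_lt_one).ne' measure_ball_lt_top.ne
  have hn0 : (0 : ℝ) < n := by exact_mod_cast hn
  have hs := euclideanHausdorffMeasure_sphere (n := n) hn hR
  have hfin : μHE[n - 1] (sphere (0 : E) R) ≠ ⊤ := hs ▸ ENNReal.ofReal_ne_top
  have hpos : 0 < (μHE[n - 1] (sphere (0 : E) R)).toReal := by
    rw [hs, ENNReal.toReal_ofReal (by positivity)]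
    positivity
  have hfin' : μHE[n - 1] (frontier Ω) ≠ ⊤ := fun h => by
    rw [h, ENNReal.toReal_top] at hper'
    exact hpos.ne' hper'
  exact ((ENNReal.toReal_eq_toReal_iff' hfin hfin').1 hper').symm

theorem integral_one_rpow_pos (hΩ : IsOpenConvexBody Ω) (hne : Ω.Nonempty) (p : ℝ) :
    0 < ∫ x in Ω, |(fun _ : E => (1 : ℝ)) x| ^ p := by
  simp only [abs_one, Real.one_rpow, integral_const, smul_eq_mul, mul_one,
    measureReal_restrict_apply_univ]
  exact ENNReal.toReal_pos (hΩ.isOpen.measure_pos _ hne).ne' hΩ.volume_ne_top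

/-- The constant function has nonpositive Rayleigh quotient. -/
theorem rayleigh_one_nonpos (hp : p ≠ 0) {β : ℝ} (hβ : β ≤ 0) :
    rayleigh n p β Ω (fun _ => 1) ≤ 0 := by
  refine div_nonpos_of_nonpos_of_nonneg ?_ (integral_nonneg fun x => by positivity)
  have h1 : ∫ x in Ω, ‖fderiv ℝ (fun _ : E => (1 : ℝ)) x‖ ^ p = 0 := by
    simp [Real.zero_rpow hp]
  rw [h1, zero_add]
  exact mul_nonpos_of_nonpos_of_nonneg hβ (integral_nonneg fun x => by positivity)

/-- A negative Rayleigh quotient on the ball is not below every quotient on a convex body of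
the same perimeter. -/
theorem exists_rayleigh_le (hn : 2 ≤ n) (hp : 1 < p) {β q R : ℝ} (hβ : β < 0) (hq : q < 0)
    (hR : 0 < R) (hΩ : IsOpenConvexBody Ω) (hne : Ω.Nonempty)
    (hper : perim n (ball (0 : E) R) = perim n Ω) {v : E → ℝ} {K : ℝ≥0} (hv : LipschitzWith K v)
    (hpos : 0 < ∫ x in ball (0 : E) R, |v x| ^ p) (hvq : rayleigh n p β (ball 0 R) v = q) :
    ∃ u : E → ℝ, (∃ K : ℝ≥0, LipschitzWith K u) ∧ (0 < ∫ x in Ω, |u x| ^ p) ∧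
      rayleigh n p β Ω u ≤ q := by
  have hn1 : 1 ≤ n := one_le_two.trans hn
  have hp0 : 0 < p := zero_lt_one.trans hp
  obtain ⟨c, -, hc⟩ := exists_hausdorffMeasure_eq_smul hn1
  set b : ℝ := -β * c with hb
  have hb0 : 0 ≤ b := mul_nonneg (neg_nonneg.2 hβ.le) c.2
  have hqa : 0 < -q := neg_pos.2 hq
  have hB := isOpenConvexBody_ball (0 : E) R
  have hBne : (ball (0 : E) R).Nonempty := nonempty_ball.2 hR
  have hv0 : ∃ x ∈ ball (0 : E) R, v x ≠ 0 := by
    by_contra! h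
    rw [setIntegral_congr_fun (g := fun _ => 0) measurableSet_ball fun x hx => by
      simp [h x hx, Real.zero_rpow hp0.ne']] at hpos
    simp at hpos
  have hpow : ∀ t : ℝ, ENNReal.ofReal (|t| ^ p) = ‖t‖ₑ ^ p := fun t => by
    rw [← ENNReal.ofReal_rpow_of_nonneg (abs_nonneg _) hp0.le, ← Real.norm_eq_abs, ofReal_norm]
  have hle : ∫⁻ x in ball (0 : E) R, energyDensity p (-q) v x ≤
      ENNReal.ofReal b * ∫⁻ x in sphere 0 R, ENNReal.ofReal (|v x| ^ p) ∂μHE[n - 1] := by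
    have hT := setLIntegral_frontier_enorm_ne_top hn1 hp.le hB hBne hv
    have hG := setLIntegral_enorm_fderiv_ne_top hp0 hB hv
    have hM := setLIntegral_enorm_ne_top hp0 hB hv
    rw [rayleigh_eq_toReal hp0 hv hc] at hvq
    rw [integral_abs_rpow_eq_toReal hp0 hv] at hpos
    rw [frontier_ball 0 hR.ne'] at hvq hT
    simp only [hpow]
    rw [setLIntegral_energyDensity hp0 hqa.le,
      ← ENNReal.toReal_le_toReal (by finiteness) (by finiteness),
      ENNReal.toReal_add hG (by finiteness), ENNReal.toReal_mul, ENNReal.toReal_mul,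
      ENNReal.toReal_ofReal hqa.le, ENNReal.toReal_ofReal hb0, hb]
    rw [div_eq_iff hpos.ne'] at hvq
    linarith
  obtain ⟨u, ⟨K', hu⟩, ⟨x₀, hx₀, hux₀⟩, hul⟩ := exists_transplant hn hp0 hR hqa hΩ hne
    (euclideanHausdorffMeasure_frontier_eq_of_perim_eq hn1 hR hper) hv hv0 hle
  have hT := setLIntegral_frontier_enorm_ne_top hn1 hp.le hΩ hne hu
  have hG := setLIntegral_enorm_fderiv_ne_top hp0 hΩ hu
  have hM := setLIntegral_enorm_ne_top hp0 hΩ hu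
  have hupos : 0 < (∫⁻ x in Ω, ‖u x‖ₑ ^ p).toReal := by
    refine ENNReal.toReal_pos ?_ hM
    have hum : Measurable fun x => ‖u x‖ₑ ^ p := hu.continuous.measurable.enorm.pow_const p
    rw [← pos_iff_ne_zero, setLIntegral_pos_iff hum]
    have hopen : IsOpen ({x | u x ≠ 0} ∩ Ω) :=
      (isOpen_ne.preimage hu.continuous).inter hΩ.isOpen
    refine (hopen.measure_pos volume ⟨x₀, hux₀, hx₀⟩).trans_le (measure_mono ?_)
    refine inter_subset_inter_left _ fun x hx => ?_
    simpa [Function.mem_support, hp0, hp0.le, hp0.not_gt] using hx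
  refine ⟨u, ⟨K', hu⟩, by rwa [integral_abs_rpow_eq_toReal hp0 hu], ?_⟩
  simp only [hpow] at hul
  rw [setLIntegral_energyDensity hp0 hqa.le,
    ← ENNReal.toReal_le_toReal (by finiteness) (by finiteness),
    ENNReal.toReal_add hG (by finiteness), ENNReal.toReal_mul, ENNReal.toReal_mul,
    ENNReal.toReal_ofReal hqa.le, ENNReal.toReal_ofReal hb0, hb] at hul
  rw [rayleigh_eq_toReal hp0 hu hc, div_le_iff₀ hupos]
  linarith

end eigenvalue

/-- **Reverse Faber–Krahn inequality (β < 0):** among bounded open convex sets of given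
perimeter, the ball maximizes the first Robin eigenvalue of the `p`-Laplacian. -/
theorem stmt16 {n : ℕ} (hn : 2 ≤ n) (p β : ℝ) (hp1 : 1 < p) (hβ : β < 0)
    (Ω : Set (EuclideanSpace ℝ (Fin n))) (hΩo : IsOpen Ω) (hΩb : IsBounded Ω)
    (hΩc : Convex ℝ Ω) (hΩne : Ω.Nonempty)
    (R : ℝ) (hR : 0 < R)
    (Ωstar : Set (EuclideanSpace ℝ (Fin n)))
    (hstar : Ωstar = ball (0 : EuclideanSpace ℝ (Fin n)) R)
    (hper : perim n Ωstar = perim n Ω) :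
    robinEig n p β Ω ≤ robinEig n p β Ωstar := by
  subst hstar
  have hΩ : IsOpenConvexBody Ω := ⟨hΩo, hΩb, hΩc⟩
  have hB := isOpenConvexBody_ball (0 : EuclideanSpace ℝ (Fin n)) R
  have hbdd := bddBelow_rayleigh (one_le_two.trans hn) hp1 hβ hΩ hΩne
  refine le_csInf ⟨_, fun _ => 1, ⟨0, LipschitzWith.const 1 |>.lipschitzOnWith⟩,
    integral_one_rpow_pos hB (nonempty_ball.2 hR) p, rfl⟩ ?_
  rintro _ ⟨v, ⟨K, hv⟩, hpos, rfl⟩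
  rcases le_or_gt 0 (rayleigh n p β (ball 0 R) v) with hq | hq
  · exact (csInf_le hbdd ⟨fun _ => 1, ⟨0, LipschitzWith.const 1 |>.lipschitzOnWith⟩,
      integral_one_rpow_pos hΩ hΩne p, rfl⟩).trans
      ((rayleigh_one_nonpos (by linarith) hβ.le).trans hq)
  · obtain ⟨w, hw, hwv, hR'⟩ := exists_lipschitzWith_rayleigh_eq hB.isOpen hv p β
    obtain ⟨u, ⟨K', hu⟩, hupos, hle⟩ :=
      exists_rayleigh_le hn hp1 hβ hq hR hΩ hΩne hper hw (hwv ▸ hpos) hR'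
    exact (csInf_le hbdd ⟨u, ⟨K', hu.lipschitzOnWith⟩, hupos, rfl⟩).trans hle
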